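/- There exists an absolute constant C > 0 such that, for infinitely many positive integers d, there exists a totally real number field K of degree d over ℚ with discriminant Δ_K ≤ C^d. -/

import Mathlib

open NumberField

/-- A number field is totally real if every embedding into `ℂ` takes real values. -/
def TotallyReal (K : Type*) [Field K] : Prop :=
  ∀ φ : K →+* ℂ, ∀ x : K, (φ x).im = 0

namespace GolodShafarevich

open Module

section Filtration

variable {G : Type*} [Group G] {k V : Type*} [Field k] [AddCommGroup V] [Module k V]

/-- The ascending filtration starting at `W` whose successive quotients are the invariants. -/
def fil (ρ : Representation k G V) (W : Submodule k V) : ℕ → Submodule k V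
  | 0 => W
  | n + 1 => ⨅ g : G, (fil ρ W n).comap (ρ g - 1)

theorem mem_fil_succ {ρ : Representation k G V} {W : Submodule k V} {n : ℕ} {x : V} :
    x ∈ fil ρ W (n + 1) ↔ ∀ g, ρ g x - x ∈ fil ρ W n := by
  simp [fil]

/-- Over a finite field of characteristic `p`, a `p`-group has nonzero fixed vectors in every
nonzero subquotient. -/
theorem exists_mem_fil_one [Finite V] {p : ℕ} [Fact p.Prime] [CharP k p] (hG : IsPGroup p G)
    (ρ : Representation k G V) {W U : Submodule k V} (hW : ∀ g, ∀ x ∈ W, ρ g x ∈ W)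
    (hU : ∀ g, ∀ x ∈ U, ρ g x ∈ U) (hWU : ¬ U ≤ W) :
    ∃ x ∈ U, x ∉ W ∧ x ∈ fil ρ W 1 := by
  let Q := U.map W.mkQ
  have hst : ∀ g, W ≤ W.comap (ρ g) := fun g x hx ↦ hW g x hx
  have hQ : ∀ g, ∀ q ∈ Q, W.mapQ W (ρ g) (hst g) q ∈ Q := by
    rintro g _ ⟨x, hx, rfl⟩
    exact ⟨ρ g x, hU g x hx, by simp⟩
  let act : MulAction G Q :=
    { smul := fun g q ↦ ⟨W.mapQ W (ρ g) (hst g) q, hQ g q q.2⟩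
      one_smul := by
        rintro ⟨q, hq⟩
        obtain ⟨x, hx, rfl⟩ := hq
        apply Subtype.ext
        change W.mapQ W (ρ 1) (hst 1) (W.mkQ x) = _
        simp
      mul_smul := by
        rintro g h ⟨q, hq⟩
        obtain ⟨x, hx, rfl⟩ := hq
        apply Subtype.ext
        change W.mapQ W (ρ (g * h)) (hst _) (W.mkQ x) =
          W.mapQ W (ρ g) (hst g) (W.mapQ W (ρ h) (hst h) (W.mkQ x))
        simp }
  have hne : ∃ q : Q, q ≠ 0 := by
    obtain ⟨x, hx, hxW⟩ := Set.not_subset.mp hWU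
    refine ⟨⟨W.mkQ x, x, hx, rfl⟩, fun h ↦ hxW ?_⟩
    have := congrArg Subtype.val h
    simpa using this
  have hfin : Finite (V ⧸ W) := Finite.of_surjective W.mkQ W.mkQ_surjective
  have hdvd : p ∣ Nat.card Q := by
    obtain ⟨q, hq⟩ := hne
    have hord : addOrderOf q = p := by
      refine addOrderOf_eq_prime ?_ hq
      have : ((p : ℕ) : k) • q = 0 := by simp
      rwa [Nat.cast_smul_eq_nsmul] at this
    rw [← hord]
    exact addOrderOf_dvd_natCard q
  have h0 : (0 : Q) ∈ MulAction.fixedPoints G Q := by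
    intro g
    apply Subtype.ext
    change W.mapQ W (ρ g) (hst g) 0 = 0
    simp
  obtain ⟨⟨q, hq⟩, hfix, hq0⟩ :=
    hG.exists_fixed_point_of_prime_dvd_card_of_fixed_point Q hdvd h0
  obtain ⟨x, hx, rfl⟩ := hq
  refine ⟨x, hx, fun hxW ↦ hq0 ?_, ?_⟩
  · apply Subtype.ext
    exact ((Submodule.Quotient.mk_eq_zero W).2 hxW).symm
  · rw [mem_fil_succ]
    intro g
    have := congrArg Subtype.val (hfix g)
    change W.mapQ W (ρ g) (hst g) (W.mkQ x) = W.mkQ x at this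
    rw [Submodule.mkQ_apply, Submodule.mapQ_apply, Submodule.Quotient.eq] at this
    exact this

/-- The right regular representation on functions on `G`. -/
def reg (k G : Type*) [Field k] [Group G] : Representation k G (G → k) where
  toFun g := LinearMap.funLeft k k (· * g)
  map_one' := by ext; simp [LinearMap.funLeft]
  map_mul' g h := by ext; simp [LinearMap.funLeft, mul_assoc]

@[simp] theorem reg_apply (g : G) (f : G → k) (x : G) : reg k G g f x = f (x * g) := rfl

/-- Coordinatewise powers of a representation. -/
def pow (ρ : Representation k G V) (ι : Type*) : Representation k G (ι → V) where
  toFun g := LinearMap.pi fun i ↦ ρ g ∘ₗ LinearMap.proj i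
  map_one' := by ext; simp
  map_mul' g h := by ext; simp

@[simp] theorem pow_apply (ρ : Representation k G V) (ι : Type*) (g : G) (f : ι → V) (i : ι) :
    pow ρ ι g f i = ρ g (f i) := rfl

theorem exists_injective_of_finrank_le {A B : Type*} [AddCommGroup A] [Module k A]
    [AddCommGroup B] [Module k B] [FiniteDimensional k A] [FiniteDimensional k B]
    (h : finrank k A ≤ finrank k B) : ∃ e : A →ₗ[k] B, Function.Injective e := by
  let bA := finBasis k A
  let bB := finBasis k B
  exact ⟨bA.constr ℕ fun i ↦ bB (Fin.castLE h i), bA.injective_constr_of_linearIndependent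
    (bB.linearIndependent.comp _ (Fin.castLE_injective h))⟩

/-- Finitely many linear forms separating points modulo `W` embed a quotient into a power of
the regular representation. -/
theorem finrank_fil_le [Finite G] [Finite V] [Finite k] {p : ℕ} [Fact p.Prime] [CharP k p]
    (hG : IsPGroup p G) (ρ : Representation k G V) {W : Submodule k V}
    (hW : ∀ g, ∀ x ∈ W, ρ g x ∈ W) (r : ℕ)
    (hr : finrank k (fil ρ W 1) ≤ finrank k W + r) (n : ℕ) :
    finrank k (fil ρ W n) ≤ finrank k W + r * finrank k (fil (reg k G) ⊥ n) := by
  classical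
  have hWle : W ≤ fil ρ W 1 := fun x hx ↦ mem_fil_succ.2 fun g ↦ W.sub_mem (hW g x hx) hx
  obtain ⟨lam, hlam0, hlam1⟩ : ∃ lam : V →ₗ[k] (Fin r → k), (∀ x ∈ W, lam x = 0) ∧
      ∀ x ∈ fil ρ W 1, lam x = 0 → x ∈ W := by
    let Q := (fil ρ W 1).map W.mkQ
    have hQ : finrank k Q ≤ finrank k (Fin r → k) := by
      have h1 := LinearMap.finrank_range_add_finrank_ker (W.mkQ.domRestrict (fil ρ W 1))
      rw [LinearMap.range_domRestrict] at h1
      have h2 : finrank k (W.mkQ.domRestrict (fil ρ W 1)).ker = finrank k W := by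
        rw [LinearMap.ker_domRestrict, Submodule.ker_mkQ]
        exact (Submodule.comapSubtypeEquivOfLe hWle).finrank_eq
      simp only [finrank_fin_fun]
      change finrank k ↥((fil ρ W 1).map W.mkQ) ≤ r
      omega
    obtain ⟨e, he⟩ := exists_injective_of_finrank_le hQ
    obtain ⟨e', he'⟩ := LinearMap.exists_extend e
    refine ⟨e' ∘ₗ W.mkQ, fun x hx ↦ ?_, fun x hx h0 ↦ ?_⟩
    · have : W.mkQ x = 0 := by simpa using hx
      simp only [LinearMap.comp_apply, this, map_zero]
    · have hxQ : W.mkQ x ∈ Q := ⟨x, hx, rfl⟩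
      have h1 : e ⟨W.mkQ x, hxQ⟩ = 0 := by
        rw [← he']; exact h0
      have h2 := he (h1.trans (map_zero e).symm)
      have h3 := congrArg Subtype.val h2
      simpa using h3
  let Lam : V →ₗ[k] (Fin r → G → k) :=
    LinearMap.pi fun i ↦ LinearMap.pi fun x ↦ LinearMap.proj i ∘ₗ lam ∘ₗ ρ x
  have hLam : ∀ y i x, Lam y i x = lam (ρ x y) i := fun _ _ _ ↦ rfl
  have hker : Lam.ker = W := by
    apply le_antisymm
    · by_contra hcon
      obtain ⟨x, hx, hxW, hx1⟩ := exists_mem_fil_one hG ρ hW (U := Lam.ker) (by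
        intro g x hx
        rw [LinearMap.mem_ker] at hx ⊢
        ext i y
        rw [hLam, ← Module.End.mul_apply, ← map_mul, ← hLam, hx]
        rfl) hcon
      refine hxW (hlam1 x hx1 ?_)
      rw [LinearMap.mem_ker] at hx
      ext i
      have := congrFun (congrFun hx i) 1
      rw [hLam, map_one] at this
      exact this
    · intro x hx
      rw [LinearMap.mem_ker]
      ext i g
      rw [hLam, hlam0 _ (hW g x hx)]
      rfl
  have hmap : ∀ n, ∀ y ∈ fil ρ W n, ∀ i, Lam y i ∈ fil (reg k G) ⊥ n := by
    intro n
    induction n with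
    | zero =>
      intro y hy i
      have : y ∈ Lam.ker := by rw [hker]; exact hy
      rw [LinearMap.mem_ker] at this
      simp [this, fil]
    | succ n ih =>
      intro y hy i
      rw [mem_fil_succ] at hy ⊢
      intro g
      convert ih _ (hy g) i using 1
      ext x
      simp [hLam, map_mul]
  have hWn : W ≤ fil ρ W n := by
    have hst : ∀ n, W ≤ fil ρ W n := by
      intro n
      induction n with
      | zero => exact le_rfl
      | succ n ih =>
        exact fun x hx ↦ mem_fil_succ.2 fun g ↦ ih (W.sub_mem (hW g x hx) hx)
    exact hst n
  let f : fil ρ W n →ₗ[k] (Fin r → fil (reg k G) ⊥ n) :=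
    LinearMap.pi fun i ↦ LinearMap.codRestrict _
      ((LinearMap.proj i ∘ₗ Lam).domRestrict (fil ρ W n)) fun y ↦ hmap n y y.2 i
  have hf := LinearMap.finrank_range_add_finrank_ker f
  have hkf : finrank k f.ker ≤ finrank k W := by
    have : f.ker.map (fil ρ W n).subtype ≤ W := by
      rintro _ ⟨y, hy, rfl⟩
      suffices h : (y : V) ∈ Lam.ker by rwa [hker] at h
      rw [LinearMap.mem_ker]
      ext i x
      have h1 := congrArg Subtype.val (congrFun (LinearMap.mem_ker.mp hy) i)
      exact congrFun h1 x
    rw [← Submodule.finrank_map_subtype_eq]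
    exact Submodule.finrank_mono this
  have hrf : finrank k f.range ≤ r * finrank k (fil (reg k G) ⊥ n) := by
    refine (Submodule.finrank_le _).trans ?_
    rw [Module.finrank_pi_fintype]
    simp
  omega

end Filtration

end GolodShafarevich

namespace GolodShafarevich

open Module

section Main

variable {G : Type*} [Group G]

/-- Normalized inhomogeneous `2`-cocycles with values in the trivial module `ℤ/2`. -/
structure IsCocycle (c : G → G → ZMod 2) : Prop where
  cocycle : ∀ g h k, c g h + c (g * h) k = c h k + c g (h * k)
  one_left : ∀ g, c 1 g = 0
  one_right : ∀ g, c g 1 = 0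

/-- The differences along a tuple of elements of `G`, acting by left translation. -/
def diff {d : ℕ} (g : Fin d → G) : (G → ZMod 2) →ₗ[ZMod 2] (Fin d → G → ZMod 2) :=
  LinearMap.pi fun i ↦ LinearMap.funLeft (ZMod 2) (ZMod 2) (g i * ·) - LinearMap.id

theorem diff_apply {d : ℕ} (g : Fin d → G) (f : G → ZMod 2) (i : Fin d) (x : G) :
    diff g f i x = f (g i * x) - f x := rfl

theorem diff_reg {d : ℕ} (g : Fin d → G) (f : G → ZMod 2) (h : G) :
    diff g (reg (ZMod 2) G h f) = pow (reg (ZMod 2) G) (Fin d) h (diff g f) := by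
  ext i x
  simp [diff_apply, mul_assoc]

theorem diff_eq_zero_iff {d : ℕ} {g : Fin d → G} (hg : Subgroup.closure (Set.range g) = ⊤)
    (f : G → ZMod 2) : diff g f = 0 ↔ ∀ x, f x = f 1 := by
  constructor
  · intro h x
    have key : ∀ i x, f (g i * x) = f x := fun i x ↦ by
      have := congrFun (congrFun h i) x
      rw [diff_apply] at this
      exact sub_eq_zero.mp this
    let H : Subgroup G :=
      { carrier := {a | ∀ x, f (a * x) = f x}
        one_mem' := by simp
        mul_mem' := fun {a b} ha hb x ↦ by rw [mul_assoc, ha, hb]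
        inv_mem' := fun {a} ha x ↦ by rw [← ha, mul_inv_cancel_left] }
    have hH : H = ⊤ := by
      rw [eq_top_iff, ← hg, Subgroup.closure_le]
      rintro _ ⟨i, rfl⟩
      exact key i
    have := (hH ▸ Subgroup.mem_top x : x ∈ H) 1
    simpa using this
  · intro h
    ext i x
    rw [diff_apply, h, h x]
    simp

/-- A quantitative Golod–Shafarevich inequality: a finite `2`-group with `d` generators
independent modulo the Frattini subgroup has more than `d ^ 2 / 4` relations, the latter being
measured by the number of classes of `2`-cocycles. -/
theorem not_finite {T : Type*} [Finite G] [Finite T] (hG : IsPGroup 2 G) {r d : ℕ} (hd : 2 ≤ d)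
    (hrd : 4 * r ≤ d * d) (g : Fin d → G) (hg : Subgroup.closure (Set.range g) = ⊤)
    (hchar : ∀ a : Fin d → ZMod 2, ∃ χ : G → ZMod 2, (∀ x y, χ (x * y) = χ x + χ y) ∧
      ∀ i, χ (g i) = a i)
    (hT : Nat.card T ≤ 2 ^ r) (Ob : (G → G → ZMod 2) → T)
    (hOb : ∀ c c', IsCocycle c → IsCocycle c' → Ob c = Ob c' →
      ∃ b : G → ZMod 2, ∀ x y, c x y - c' x y = b x + b y - b (x * y)) : False := by
  classical
  let R := reg (ZMod 2) G
  let P := pow R (Fin d)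
  let W := (diff g).range
  let D : ℕ → ℕ := fun n ↦ finrank (ZMod 2) (fil R ⊥ n)
  have hconstW : ∀ F : Fin d → G → ZMod 2, (∀ i x, F i x = F i 1) → F ∈ W := by
    intro F hF
    obtain ⟨χ, hχ, hχg⟩ := hchar fun i ↦ F i 1
    refine ⟨χ, ?_⟩
    ext i x
    rw [diff_apply, hχ, hχg, hF i x]
    ring
  have hW : ∀ h, ∀ x ∈ W, P h x ∈ W := by
    rintro h _ ⟨f, rfl⟩
    exact ⟨R h f, diff_reg g f h⟩
  have hWle : W ≤ fil P W 1 := fun x hx ↦ mem_fil_succ.2 fun h ↦ W.sub_mem (hW h x hx) hx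
  have hr : finrank (ZMod 2) (fil P W 1) ≤ finrank (ZMod 2) W + r := by
    have hex : ∀ y ∈ fil P W 1, ∃ f : G → G → ZMod 2, f 1 = 0 ∧
        ∀ h, diff g (f h) = P h y - y := by
      intro y hy
      rw [mem_fil_succ] at hy
      choose f hf using hy
      refine ⟨Function.update f 1 0, by simp, fun h ↦ ?_⟩
      by_cases hh : h = 1
      · subst hh; simp
      · rw [Function.update_of_ne hh, hf]
    choose! f hf1 hf using hex
    let c : (Fin d → G → ZMod 2) → G → G → ZMod 2 := fun y a b ↦
      f y a 1 + f y b a - f y (a * b) 1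
    have hconst : ∀ y ∈ fil P W 1, ∀ a b x, f y a x + f y b (x * a) - f y (a * b) x = c y a b := by
      intro y hy a b
      have h0 : diff g (f y a + R a (f y b) - f y (a * b)) = 0 := by
        rw [map_sub, map_add, diff_reg, hf y hy, hf y hy, hf y hy, map_sub, map_mul]
        simp only [Module.End.mul_apply]
        change (P a) y - y + ((P a) ((P b) y) - (P a) y) - ((P a) ((P b) y) - y) = 0
        abel
      intro x
      have := (diff_eq_zero_iff hg _).mp h0 x
      simpa [R] using this
    have hcoc : ∀ y ∈ fil P W 1, IsCocycle (c y) := by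
      intro y hy
      refine ⟨fun a b e ↦ ?_, fun a ↦ ?_, fun a ↦ ?_⟩
      · have h1 := hconst y hy b e a
        simp only [c, mul_assoc] at h1 ⊢
        linear_combination h1
      · simp [c, hf1 y hy]
      · simp [c, hf1 y hy]
    have hsep : ∀ y ∈ fil P W 1, ∀ y' ∈ fil P W 1, Ob (c y) = Ob (c y') → y - y' ∈ W := by
      intro y hy y' hy' h
      obtain ⟨b, hb⟩ := hOb _ _ (hcoc y hy) (hcoc y' hy') h
      let e : G → G → ZMod 2 := fun a x ↦ f y a x - f y' a x - b a
      have he : ∀ a u x, e (a * u) x = e a x + e u (x * a) := by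
        intro a u x
        have h1 := hconst y hy a u x
        have h2 := hconst y' hy' a u x
        have h3 := hb a u
        simp only [e]
        linear_combination -h1 + h2 - h3
      let F : G → ZMod 2 := fun x ↦ e x 1
      have hF : ∀ h x, F (x * h) - F x = e h x := by
        intro h x
        simp only [F]
        rw [he]
        simp
      have hinv : ∀ h, P h (y - y' - diff g F) = y - y' - diff g F := by
        intro h
        have h1 := hf y hy h
        have h2 := hf y' hy' h
        have h3 : diff g (R h F - F) = diff g (f y h - f y' h) := by
          rw [← sub_eq_zero, ← map_sub, diff_eq_zero_iff hg]
          intro x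
          have := hF h x
          have h4 := hF h 1
          simp only [Pi.sub_apply, R, reg_apply, e] at this h4 ⊢
          linear_combination this - h4
        rw [map_sub, map_sub, h1, h2, diff_reg] at h3
        rw [map_sub, map_sub]
        change P h (diff g F) - _ = _ at h3
        linear_combination -h3
      have hmem : y - y' - diff g F ∈ W := by
        apply hconstW
        intro i x
        have := congrFun (congrFun (hinv x) i) 1
        rw [pow_apply, reg_apply, one_mul] at this
        exact this
      have := W.add_mem hmem ⟨F, rfl⟩
      simpa using this
    -- counting
    let Q := (fil P W 1).map W.mkQ
    have hQ : ∀ q : Q, ∃ y ∈ fil P W 1, W.mkQ y = q := fun q ↦ q.2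
    choose s hs hsq using hQ
    have hinj : Function.Injective fun q : Q ↦ Ob (c (s q)) := by
      intro q q' h
      have := hsep _ (hs q) _ (hs q') h
      apply Subtype.ext
      rw [← hsq, ← hsq, ← sub_eq_zero, ← map_sub]
      exact (Submodule.Quotient.mk_eq_zero W).2 this
    have hcard : Nat.card Q ≤ 2 ^ r := (Nat.card_le_card_of_injective _ hinj).trans hT
    have hQr : finrank (ZMod 2) Q ≤ r := by
      have : Finite Q := Finite.of_injective _ hinj
      rw [Module.natCard_eq_pow_finrank (K := ZMod 2), Nat.card_zmod] at hcard
      exact (Nat.pow_le_pow_iff_right (by norm_num)).mp hcard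
    have h1 := LinearMap.finrank_range_add_finrank_ker (W.mkQ.domRestrict (fil P W 1))
    rw [LinearMap.range_domRestrict] at h1
    have h2 : finrank (ZMod 2) (W.mkQ.domRestrict (fil P W 1)).ker = finrank (ZMod 2) W := by
      rw [LinearMap.ker_domRestrict, Submodule.ker_mkQ]
      exact (Submodule.comapSubtypeEquivOfLe hWle).finrank_eq
    change finrank (ZMod 2) ↥((fil P W 1).map W.mkQ) ≤ r at hQr
    omega
  have hZ : ∀ n, finrank (ZMod 2) (fil P W n) ≤ finrank (ZMod 2) W + r * D n :=
    finrank_fil_le hG P hW r hr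
  have hsub : ∀ n, ∀ F : Fin d → G → ZMod 2, (∀ i, F i ∈ fil R ⊥ (n + 1)) → F ∈ fil P W n := by
    intro n
    induction n with
    | zero =>
      intro F hF
      refine hconstW F fun i x ↦ ?_
      have := mem_fil_succ.mp (hF i) x
      have := congrFun ((Submodule.mem_bot _).mp this) 1
      simpa [R, sub_eq_zero] using this
    | succ n ih =>
      intro F hF
      rw [mem_fil_succ]
      exact fun h ↦ ih _ fun i ↦ mem_fil_succ.mp (hF i) h
  have hpull : ∀ n f, (∀ i, diff g f i ∈ fil R ⊥ n) → f ∈ fil R ⊥ (n + 1) := by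
    intro n
    induction n with
    | zero =>
      intro f hf
      rw [mem_fil_succ]
      have h0 : diff g f = 0 := funext fun i ↦ (Submodule.mem_bot _).mp (hf i)
      rw [diff_eq_zero_iff hg] at h0
      intro h
      refine (Submodule.mem_bot _).mpr ?_
      ext x
      simp [R, h0 (x * h), h0 x]
    | succ n ih =>
      intro f hf
      rw [mem_fil_succ]
      intro h
      refine ih _ fun i ↦ ?_
      have := mem_fil_succ.mp (hf i) h
      rw [map_sub, diff_reg]
      exact this
  have hstep : ∀ n, d * D (n + 1) + 1 ≤ D (n + 2) + r * D n := by
    intro n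
    let A : Submodule (ZMod 2) (Fin d → G → ZMod 2) :=
      Submodule.pi Set.univ fun _ ↦ fil R ⊥ (n + 1)
    have hA : finrank (ZMod 2) A = d * D (n + 1) := by
      let e : A ≃ₗ[ZMod 2] (Fin d → fil R ⊥ (n + 1)) :=
        { toFun := fun F i ↦ ⟨F.1 i, F.2 i trivial⟩
          map_add' := fun _ _ ↦ rfl
          map_smul' := fun _ _ ↦ rfl
          invFun := fun F ↦ ⟨fun i ↦ (F i).1, fun i _ ↦ (F i).2⟩
          left_inv := fun _ ↦ rfl
          right_inv := fun _ ↦ rfl }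
      rw [e.finrank_eq, Module.finrank_pi_fintype]
      simp [D]
    have hAW : A ⊓ W ≤ (fil R ⊥ (n + 2)).map (diff g) := by
      rintro _ ⟨hF, f, rfl⟩
      exact ⟨f, hpull _ _ fun i ↦ hF i trivial, rfl⟩
    have hsup : A ⊔ W ≤ fil P W n := by
      refine sup_le (fun F hF ↦ hsub n F fun i ↦ hF i trivial) ?_
      have : ∀ n, W ≤ fil P W n := by
        intro n
        induction n with
        | zero => exact le_rfl
        | succ n ih => exact fun x hx ↦ mem_fil_succ.2 fun h ↦ ih (W.sub_mem (hW h x hx) hx)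
      exact this n
    have h1 := Submodule.finrank_sup_add_finrank_inf_eq A W
    have h2 := Submodule.finrank_mono hsup
    have h3 := Submodule.finrank_mono hAW
    have h4 := LinearMap.finrank_range_add_finrank_ker ((diff g).domRestrict (fil R ⊥ (n + 2)))
    rw [LinearMap.range_domRestrict] at h4
    have h5 : 1 ≤ finrank (ZMod 2) ((diff g).domRestrict (fil R ⊥ (n + 2))).ker := by
      have h1mem : (1 : G → ZMod 2) ∈ fil R ⊥ (n + 2) := by
        refine hpull _ _ fun i ↦ ?_
        have : diff g 1 = 0 := by ext; simp [diff_apply]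
        rw [this]
        exact Submodule.zero_mem _
      rw [Nat.one_le_iff_ne_zero]
      intro h
      rw [Submodule.finrank_eq_zero] at h
      have : (⟨1, h1mem⟩ : fil R ⊥ (n + 2)) ∈ ((diff g).domRestrict (fil R ⊥ (n + 2))).ker := by
        rw [LinearMap.mem_ker]
        ext
        simp [diff_apply]
      rw [h, Submodule.mem_bot] at this
      have := congrFun (congrArg Subtype.val this) 1
      simp at this
    have h6 := hZ n
    simp only [D] at *
    omega
  have hD0 : D 0 = 0 := finrank_bot _ _
  have hgrow : ∀ n, d * D n + 2 ≤ 2 * D (n + 1) ∨ (n = 0 ∧ 1 ≤ D 1) := by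
    intro n
    induction n with
    | zero =>
      right
      refine ⟨rfl, ?_⟩
      simp only [D]
      rw [Nat.one_le_iff_ne_zero]
      intro h
      rw [Submodule.finrank_eq_zero] at h
      have h1 : (1 : G → ZMod 2) ∈ fil R ⊥ 1 := by
        refine hpull _ _ fun i ↦ ?_
        have : diff g 1 = 0 := by ext; simp [diff_apply]
        rw [this]
        exact Submodule.zero_mem _
      rw [h, Submodule.mem_bot] at h1
      simpa using congrFun h1 1
    | succ n ih =>
      left
      have hs := hstep n
      have h3 : 4 * r * D n ≤ d * d * D n := Nat.mul_le_mul_right _ hrd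
      rcases ih with ih | ⟨rfl, ih⟩
      · have h4 : d * (d * D n + 2) ≤ d * (2 * D (n + 1)) := Nat.mul_le_mul_left _ ih
        nlinarith
      · rw [hD0] at hs
        nlinarith
  have hlin : ∀ n, n ≤ D n := by
    intro n
    induction n with
    | zero => simp
    | succ n ih =>
      rcases hgrow n with h | ⟨rfl, h⟩
      · have : 2 * D n ≤ d * D n := Nat.mul_le_mul_right _ hd
        omega
      · simpa using h
  have hbound := Submodule.finrank_le (fil R ⊥ (finrank (ZMod 2) (G → ZMod 2) + 1))
  have := hlin (finrank (ZMod 2) (G → ZMod 2) + 1)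
  simp only [D] at this
  omega

end Main

end GolodShafarevich

namespace GolodShafarevich

open Module

section Characters

variable {G : Type*} [Group G]

/-- The space of additive characters of `G` with values in `ℤ/2`. -/
def chars (G : Type*) [Group G] : Submodule (ZMod 2) (G → ZMod 2) where
  carrier := {χ | ∀ x y, χ (x * y) = χ x + χ y}
  add_mem' := fun {a b} ha hb x y ↦ by simp only [Pi.add_apply, ha x y, hb x y]; ring
  zero_mem' := by simp
  smul_mem' := fun c a ha x y ↦ by simp only [Pi.smul_apply, ha x y, smul_add]

theorem closure_eq_top_of_chars [Finite G] (hG : IsPGroup 2 G) (S : Set G)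
    (hS : ∀ χ ∈ chars G, (∀ g ∈ S, χ g = 0) → χ = 0) : Subgroup.closure S = ⊤ := by
  classical
  by_contra hne
  obtain ⟨n, hn⟩ := IsPGroup.iff_card.mp hG
  obtain ⟨m, hm⟩ := IsPGroup.iff_card.mp (hG.to_subgroup (Subgroup.closure S))
  have hmn : m < n := by
    by_contra hle
    refine hne (Subgroup.eq_top_of_card_eq _ (le_antisymm (Subgroup.card_le_card_group _) ?_))
    rw [hn, hm]
    exact Nat.pow_le_pow_right (by norm_num) (not_lt.mp hle)
  obtain ⟨k, rfl⟩ : ∃ k, n = k + 1 := ⟨n - 1, by omega⟩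
  obtain ⟨K, hK, hSK⟩ := Sylow.exists_subgroup_card_pow_prime_le 2 (m := k) (n := m)
    (by rw [hn]; exact pow_dvd_pow _ (by omega)) (Subgroup.closure S) hm (by omega)
  have hidx : K.index = 2 := by
    have := K.card_mul_index
    rw [hK, hn, pow_succ] at this
    exact Nat.eq_of_mul_eq_mul_left (by positivity) this
  have hχ : (fun x ↦ if x ∈ K then 0 else 1 : G → ZMod 2) = 0 := by
    refine hS _ (fun x y ↦ ?_) fun g hg ↦ ?_
    · have := Subgroup.mul_mem_iff_of_index_two hidx (a := x) (b := y)
      by_cases hx : x ∈ K <;> by_cases hy : y ∈ K <;> simp [this, hx, hy]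
      decide
    · simp [hSK (Subgroup.subset_closure hg)]
  have : K = ⊤ := by
    rw [eq_top_iff]
    intro x _
    by_contra hx
    simpa [hx] using congrFun hχ x
  rw [this, Subgroup.index_top] at hidx
  omega

theorem exists_generators [Finite G] (hG : IsPGroup 2 G) :
    ∃ g : Fin (finrank (ZMod 2) (chars G)) → G, Subgroup.closure (Set.range g) = ⊤ ∧
      ∀ a : Fin (finrank (ZMod 2) (chars G)) → ZMod 2, ∃ χ ∈ chars G, ∀ i, χ (g i) = a i := by
  let ev : G → Dual (ZMod 2) (chars G) := fun g ↦ LinearMap.proj g ∘ₗ (chars G).subtype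
  have hspan : Submodule.span (ZMod 2) (Set.range ev) = ⊤ := by
    rw [← Subspace.dualCoannihilator_dualAnnihilator_eq (W := Submodule.span _ _)]
    have : (Submodule.span (ZMod 2) (Set.range ev)).dualCoannihilator = ⊥ := by
      rw [eq_bot_iff]
      intro χ hχ
      rw [Submodule.mem_dualCoannihilator] at hχ
      rw [Submodule.mem_bot]
      ext g
      exact hχ (ev g) (Submodule.subset_span ⟨g, rfl⟩)
    rw [this, Submodule.dualAnnihilator_bot]
  obtain ⟨f, hf, hfs⟩ : ∃ f : Fin (finrank (ZMod 2) (chars G)) → Dual (ZMod 2) (chars G),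
      (∀ i, f i ∈ Set.range ev) ∧ Submodule.span (ZMod 2) (Set.range f) = ⊤ := by
    obtain ⟨f, hf, hfs, -⟩ := Submodule.exists_fun_fin_finrank_span_eq (ZMod 2) (Set.range ev)
    have hdim : finrank (ZMod 2) (chars G) =
        finrank (ZMod 2) (Submodule.span (ZMod 2) (Set.range ev)) := by
      rw [hspan, finrank_top, Subspace.dual_finrank_eq]
    refine ⟨f ∘ Fin.cast hdim, fun i ↦ hf _, ?_⟩
    rw [(Fin.rightInverse_cast hdim).surjective.range_comp, hfs, hspan]
  choose g hg using hf
  have hinj : ∀ χ ∈ chars G, (∀ i, χ (g i) = 0) → χ = 0 := by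
    intro χ hχ h0
    have h1 : Submodule.span (ZMod 2) (Set.range f) ≤
        LinearMap.ker (Dual.eval (ZMod 2) (chars G) ⟨χ, hχ⟩) := by
      rw [Submodule.span_le]
      rintro _ ⟨i, rfl⟩
      rw [← hg]
      exact h0 i
    rw [hfs] at h1
    ext x
    exact h1 (Submodule.mem_top : ev x ∈ ⊤)
  let L : chars G →ₗ[ZMod 2] (Fin (finrank (ZMod 2) (chars G)) → ZMod 2) :=
    LinearMap.pi fun i ↦ ev (g i)
  have hL : Function.Injective L := by
    rw [← LinearMap.ker_eq_bot, eq_bot_iff]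
    intro χ hχ
    rw [Submodule.mem_bot]
    exact Subtype.ext (hinj χ χ.2 fun i ↦ congrFun (LinearMap.mem_ker.mp hχ) i)
  have hLs : Function.Surjective L :=
    (LinearMap.injective_iff_surjective_of_finrank_eq_finrank (by simp)).mp hL
  refine ⟨g, closure_eq_top_of_chars hG _ fun χ hχ h ↦ hinj χ hχ fun i ↦ h _ ⟨i, rfl⟩,
    fun a ↦ ?_⟩
  obtain ⟨χ, hχ⟩ := hLs a
  exact ⟨χ, χ.2, fun i ↦ congrFun hχ i⟩

/-- A finite `2`-group with `s` independent characters has more than `s ^ 2 / 4` relations. -/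
theorem not_finite_of_chars {T : Type*} [Finite G] [Finite T] (hG : IsPGroup 2 G) {r s : ℕ}
    (hs : 2 ≤ s) (hrs : 4 * r ≤ s * s) (χ : Fin s → G → ZMod 2)
    (hχ : ∀ i x y, χ i (x * y) = χ i x + χ i y) (hind : LinearIndependent (ZMod 2) χ)
    (hT : Nat.card T ≤ 2 ^ r) (Ob : (G → G → ZMod 2) → T)
    (hOb : ∀ c c', IsCocycle c → IsCocycle c' → Ob c = Ob c' →
      ∃ b : G → ZMod 2, ∀ x y, c x y - c' x y = b x + b y - b (x * y)) : False := by
  obtain ⟨g, hg, hgχ⟩ := exists_generators hG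
  have hd : s ≤ finrank (ZMod 2) (chars G) := by
    have h : LinearIndependent (ZMod 2) (fun i ↦ (⟨χ i, hχ i⟩ : chars G)) :=
      LinearIndependent.of_comp (chars G).subtype hind
    simpa using h.fintype_card_le_finrank
  exact not_finite hG (hs.trans hd) (hrs.trans (Nat.mul_le_mul hd hd)) g hg
    (fun a ↦ hgχ a) hT Ob hOb

end Characters

end GolodShafarevich

namespace LocalSquare

variable {K Γ : Type*} [Field K] [LinearOrderedCommGroupWithZero Γ] (v : Valuation K Γ)

/-- `x` is so close to a square that it is a square in the completion. -/
def LS (x : K) : Prop := ∃ z, v (x - z ^ 2) < v (4 * x)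

/-- `b` is close to a norm from `K(√a)`. -/
def AN (a b : K) : Prop := ∃ x y, v (b - (x ^ 2 - a * y ^ 2)) < v b

theorem val_natCast_le_one (n : ℕ) : v n ≤ 1 := by
  induction n with
  | zero => simp
  | succ n ih =>
    push_cast
    exact (v.map_add _ _).trans (max_le ih (by simp))

theorem val_intCast_le_one (n : ℤ) : v n ≤ 1 := by
  obtain ⟨n, rfl | rfl⟩ := n.eq_nat_or_neg
  · exact_mod_cast val_natCast_le_one v n
  · rw [Int.cast_neg, Valuation.map_neg]
    exact_mod_cast val_natCast_le_one v n

theorem val_four_le_one : v 4 ≤ 1 := by exact_mod_cast val_natCast_le_one v 4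

theorem val_two_le_one : v 2 ≤ 1 := by exact_mod_cast val_natCast_le_one v 2

theorem val_four : v 4 = v 2 * v 2 := by rw [← map_mul]; norm_num

variable {v}

theorem val_eq_of_sub_lt {x y : K} (h : v (x - y) < v x) : v y = v x := by
  rw [Valuation.map_sub_swap] at h
  exact v.map_eq_of_sub_lt h

theorem LS.ne_zero {x : K} (h : LS v x) : x ≠ 0 := by
  rintro rfl
  obtain ⟨z, hz⟩ := h
  simp at hz

theorem lt_of_lt_four_mul {x y : K} (h : v y < v (4 * x)) : v y < v x := by
  refine h.trans_le ?_
  rw [map_mul]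
  exact mul_le_of_le_one_left' (val_four_le_one v)

theorem LS.exists_eq {x : K} (h : LS v x) : ∃ z, z ≠ 0 ∧ v (z ^ 2) = v x ∧
    v (x - z ^ 2) < v (4 * x) := by
  obtain ⟨z, hz⟩ := h
  have h1 := val_eq_of_sub_lt (lt_of_lt_four_mul hz)
  refine ⟨z, ?_, h1, hz⟩
  rintro rfl
  have : v x = 0 := by simpa using h1.symm
  exact (LS.ne_zero ⟨0, hz⟩) (v.zero_iff.mp this)

theorem LS.mul {x y : K} (hx : LS v x) (hy : LS v y) : LS v (x * y) := by
  obtain ⟨z, -, hz1, hz⟩ := hx.exists_eq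
  obtain ⟨w, -, hw1, hw⟩ := hy.exists_eq
  refine ⟨z * w, ?_⟩
  have h0 : x * y - (z * w) ^ 2 = (x - z ^ 2) * y + z ^ 2 * (y - w ^ 2) := by ring
  have hx0 : 0 < v x := (v.pos_iff).2 hx.ne_zero
  have hy0 : 0 < v y := (v.pos_iff).2 hy.ne_zero
  rw [h0]
  apply v.map_add_lt
  · rw [map_mul, ← mul_assoc, map_mul v (4 * x)]
    exact mul_lt_mul_of_pos_right hz hy0
  · rw [map_mul, hz1, mul_left_comm, map_mul v x]
    exact mul_lt_mul_of_pos_left hw hx0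

theorem LS.congr {x y : K} (hx : LS v x) (h : v (x - y) < v (4 * x)) : LS v y := by
  obtain ⟨z, hz⟩ := hx
  have h1 := val_eq_of_sub_lt (lt_of_lt_four_mul h)
  refine ⟨z, ?_⟩
  rw [map_mul, h1, ← map_mul]
  have : y - z ^ 2 = (x - z ^ 2) - (x - y) := by ring
  rw [this]
  exact v.map_sub_lt hz h

theorem LS.sq [CharZero K] {z : K} (hz : z ≠ 0) : LS v (z ^ 2) :=
  ⟨z, by
    rw [sub_self, map_zero]
    exact (v.pos_iff).2 (by simp [hz])⟩

theorem LS.one [CharZero K] : LS v 1 := by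
  simpa using LS.sq (v := v) (one_ne_zero)

theorem LS.of_isSquare [CharZero K] {x : K} (hx : x ≠ 0) (h : IsSquare x) : LS v x := by
  obtain ⟨z, rfl⟩ := h
  rw [← pow_two]
  exact LS.sq (by rintro rfl; simp at hx)

theorem LS.mul_sq_iff [CharZero K] {x c : K} (hc : c ≠ 0) : LS v (x * c ^ 2) ↔ LS v x := by
  refine ⟨fun h ↦ ?_, fun h ↦ h.mul (LS.sq hc)⟩
  have := h.mul (LS.sq (inv_ne_zero hc))
  rwa [mul_assoc, ← mul_pow, mul_inv_cancel₀ hc, one_pow, mul_one] at this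

theorem LS.inv [CharZero K] {x : K} (hx : LS v x) : LS v x⁻¹ := by
  have := hx.mul (LS.sq (inv_ne_zero hx.ne_zero))
  rwa [pow_two, ← mul_assoc, mul_inv_cancel₀ hx.ne_zero, one_mul] at this

theorem LS.mul_iff_right [CharZero K] {x y : K} (hx : LS v x) : LS v (x * y) ↔ LS v y := by
  refine ⟨fun h ↦ ?_, fun h ↦ hx.mul h⟩
  have := hx.inv.mul h
  rwa [inv_mul_cancel_left₀ hx.ne_zero] at this

theorem LS.of_mul_self {x y : K} [CharZero K] (hx : LS v x) (hxy : LS v (x * y)) : LS v y :=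
  hx.mul_iff_right.mp hxy

variable (v)

/-- The group of local squares. -/
def lsGroup [CharZero K] : Subgroup Kˣ where
  carrier := {x | LS v (x : K)}
  one_mem' := by simpa using LS.one
  mul_mem' := fun ha hb ↦ by simpa using LS.mul ha hb
  inv_mem' := fun {a} ha ↦ by simpa using LS.inv (x := (a : K)) ha

theorem mem_lsGroup [CharZero K] {x : Kˣ} : x ∈ lsGroup v ↔ LS v (x : K) := Iff.rfl

variable {v}

theorem AN.ne_zero {a b : K} (h : AN v a b) : b ≠ 0 := by
  rintro rfl
  obtain ⟨x, y, h⟩ := h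
  simp at h

theorem AN.of_eq {a b x y : K} (hb : b ≠ 0) (h : b = x ^ 2 - a * y ^ 2) : AN v a b :=
  ⟨x, y, by rw [← h, sub_self, map_zero]; exact v.pos_iff.2 hb⟩

theorem AN.sq {a z : K} (hz : z ≠ 0) : AN v a (z ^ 2) :=
  AN.of_eq (x := z) (y := 0) (pow_ne_zero _ hz) (by ring)

theorem AN.neg_self {a : K} (ha : a ≠ 0) : AN v a (-a) :=
  AN.of_eq (x := 0) (y := 1) (neg_ne_zero.mpr ha) (by ring)

theorem AN.of_LS {a b : K} (h : LS v b) : AN v a b := by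
  obtain ⟨z, hz⟩ := h
  exact ⟨z, 0, by simpa using lt_of_lt_four_mul hz⟩

theorem AN.mul {a b c : K} (hb : AN v a b) (hc : AN v a c) : AN v a (b * c) := by
  have hb0 : 0 < v b := (v.pos_iff).2 hb.ne_zero
  have hc0 : 0 < v c := (v.pos_iff).2 hc.ne_zero
  obtain ⟨x, y, h⟩ := hb
  obtain ⟨z, w, h'⟩ := hc
  refine ⟨x * z + a * y * w, x * w + y * z, ?_⟩
  have h0 : b * c - ((x * z + a * y * w) ^ 2 - a * (x * w + y * z) ^ 2) =
    (b - (x ^ 2 - a * y ^ 2)) * c + (x ^ 2 - a * y ^ 2) * (c - (z ^ 2 - a * w ^ 2)) := by ring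
  rw [h0]
  apply v.map_add_lt
  · rw [map_mul, map_mul]
    exact mul_lt_mul_of_pos_right h hc0
  · rw [map_mul, val_eq_of_sub_lt h, map_mul]
    exact mul_lt_mul_of_pos_left h' hb0

theorem AN.inv {a b : K} (hb : AN v a b) : AN v a b⁻¹ := by
  have := hb.mul (AN.sq (inv_ne_zero hb.ne_zero))
  rwa [pow_two, ← mul_assoc, mul_inv_cancel₀ hb.ne_zero, one_mul] at this

theorem AN.mul_iff_right {a x y : K} (hx : AN v a x) : AN v a (x * y) ↔ AN v a y := by
  refine ⟨fun h ↦ ?_, fun h ↦ hx.mul h⟩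
  have := hx.inv.mul h
  rwa [inv_mul_cancel_left₀ hx.ne_zero] at this

theorem AN.congr {a b c : K} (hb : AN v a b) (h : v (b - c) < v b) : AN v a c := by
  obtain ⟨x, y, hxy⟩ := hb
  refine ⟨x, y, ?_⟩
  rw [val_eq_of_sub_lt h]
  have : c - (x ^ 2 - a * y ^ 2) = (b - (x ^ 2 - a * y ^ 2)) - (b - c) := by ring
  rw [this]
  exact v.map_sub_lt hxy h

variable (v)

/-- The group of approximate norms. -/
def anGroup (a : K) : Subgroup Kˣ where
  carrier := {x | AN v a (x : K)}
  one_mem' := by simpa using AN.sq (v := v) (a := a) one_ne_zero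
  mul_mem' := fun ha hb ↦ by simpa using AN.mul ha hb
  inv_mem' := fun {b} ha ↦ by simpa using AN.inv (b := (b : K)) ha

theorem mem_anGroup {a : K} {x : Kˣ} : x ∈ anGroup v a ↔ AN v a (x : K) := Iff.rfl

variable {v}

/-- Away from `2`, if `a` is not a local square then there is no cancellation in norms. -/
theorem max_le_of_not_LS {a p q : K} (h2 : v 2 = 1) (ha : ¬ LS v a) :
    v (p ^ 2 - a * q ^ 2) = max (v (p ^ 2)) (v (a * q ^ 2)) := by
  have h4 : v 4 = 1 := by rw [val_four, h2, one_mul]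
  by_cases hne : v (p ^ 2) = v (a * q ^ 2)
  · rw [← hne, max_self]
    by_cases ha0 : a = 0
    · simp [ha0]
    by_cases hq : q = 0
    · simp [hq]
    refine le_antisymm ((v.map_sub _ _).trans (by rw [← hne, max_self])) ?_
    by_contra! hlt
    refine ha ⟨p / q, ?_⟩
    have : a - (p / q) ^ 2 = -(p ^ 2 - a * q ^ 2) / q ^ 2 := by field_simp; ring
    have hq0 : 0 < v (q ^ 2) := v.pos_iff.2 (pow_ne_zero _ hq)
    rw [this, map_div₀, Valuation.map_neg, map_mul, h4, one_mul, div_lt_iff₀ hq0, ← map_mul, ← hne]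
    exact hlt
  · rw [sub_eq_add_neg, v.map_add_of_distinct_val (by rwa [Valuation.map_neg]), Valuation.map_neg]

end LocalSquare

section

open IsDedekindDomain NumberField LocalSquare
open scoped WithZero

namespace Places

/-- The finite places of a number field. -/
abbrev Pl (F : Type*) [Field F] [NumberField F] := HeightOneSpectrum (𝓞 F)

/-- The valuation attached to a finite place. -/
noncomputable abbrev vl {F : Type*} [Field F] [NumberField F] (v : Pl F) : Valuation F ℤᵐ⁰ :=
  v.valuation F

section comap

variable {F M : Type*} [Field F] [NumberField F] [Field M] [NumberField M]

theorem valuation_eq_one_of_notMem (v : Pl F) {r : 𝓞 F} (h : r ∉ v.asIdeal) :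
    vl v (r : F) = 1 :=
  (v.valuation_eq_one_iff_notMem).2 h

/-- The restriction of a place along a field homomorphism. -/
noncomputable def comapPl (f : F →+* M) (w : Pl M) : Pl F where
  asIdeal := w.asIdeal.comap (RingOfIntegers.mapRingHom f)
  isPrime := w.isPrime.comap _
  ne_bot := by
    intro h
    have h0 : ((Ideal.absNorm w.asIdeal : ℕ) : 𝓞 F) ∈
        w.asIdeal.comap (RingOfIntegers.mapRingHom f) := by
      rw [Ideal.mem_comap, map_natCast]
      exact Ideal.absNorm_mem _
    rw [h, Ideal.mem_bot, Nat.cast_eq_zero, Ideal.absNorm_eq_zero_iff] at h0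
    exact w.ne_bot h0

theorem mem_comapPl {f : F →+* M} {w : Pl M} {r : 𝓞 F} :
    r ∈ (comapPl f w).asIdeal ↔ RingOfIntegers.mapRingHom f r ∈ w.asIdeal := Iff.rfl

theorem comapPl_le_one (f : F →+* M) (w : Pl M) {x : F} (hx : vl (comapPl f w) x ≤ 1) :
    vl w (f x) ≤ 1 ∧ (vl (comapPl f w) x < 1 → vl w (f x) < 1) := by
  obtain ⟨n, d, h⟩ := (comapPl f w).exists_primeCompl_mul_eq_of_integer x hx
  replace h : x * ((d : 𝓞 F) : F) = (n : F) := h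
  have hd : vl w (f (d : 𝓞 F)) = 1 := by
    rw [← RingOfIntegers.mapRingHom_apply]
    exact valuation_eq_one_of_notMem w d.2
  have hd' : vl (comapPl f w) ((d : 𝓞 F) : F) = 1 := valuation_eq_one_of_notMem _ d.2
  have h1 : vl w (f x) = vl w (RingOfIntegers.mapRingHom f n : 𝓞 M) := by
    rw [RingOfIntegers.mapRingHom_apply, ← h, map_mul, map_mul, hd, mul_one]
  have h2 : vl (comapPl f w) x = vl (comapPl f w) (n : F) := by
    rw [← h, map_mul, hd', mul_one]
  rw [h1, h2]
  exact ⟨w.valuation_le_one _, fun h3 ↦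
    (w.valuation_lt_one_iff_mem _).2
      (mem_comapPl.1 ((HeightOneSpectrum.valuation_lt_one_iff_mem _ _).1 h3))⟩

theorem comapPl_isEquiv (f : F →+* M) (w : Pl M) :
    (vl (comapPl f w)).IsEquiv ((vl w).comap f) := by
  rw [Valuation.isEquiv_iff_val_le_one]
  intro x
  refine ⟨fun h ↦ (comapPl_le_one f w h).1, fun h ↦ ?_⟩
  by_contra! hx
  have h0 : x ≠ 0 := by rintro rfl; simp at hx
  have hx' : vl (comapPl f w) x⁻¹ < 1 := by
    rw [map_inv₀]; exact inv_lt_one_of_one_lt₀ hx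
  have := (comapPl_le_one f w hx'.le).2 hx'
  rw [map_inv₀, map_inv₀] at this
  have h3 : vl w (f x) ≠ 0 := by simpa using h0
  rw [inv_lt_one₀ (zero_lt_iff.mpr h3)] at this
  exact absurd h (not_le.mpr this)

theorem comapPl_lt (f : F →+* M) (w : Pl M) {x y : F} :
    vl (comapPl f w) x < vl (comapPl f w) y ↔ vl w (f x) < vl w (f y) :=
  (comapPl_isEquiv f w).lt_iff_lt

theorem comapPl_le (f : F →+* M) (w : Pl M) {x y : F} :
    vl (comapPl f w) x ≤ vl (comapPl f w) y ↔ vl w (f x) ≤ vl w (f y) :=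
  (comapPl_isEquiv f w).le_iff_le

theorem comapPl_eq (f : F →+* M) (w : Pl M) {x y : F} :
    vl (comapPl f w) x = vl (comapPl f w) y ↔ vl w (f x) = vl w (f y) := by
  rw [le_antisymm_iff, le_antisymm_iff, comapPl_le, comapPl_le]

theorem comapPl_lt_one (f : F →+* M) (w : Pl M) {x : F} :
    vl (comapPl f w) x < 1 ↔ vl w (f x) < 1 := by
  simpa using comapPl_lt f w (x := x) (y := 1)

theorem comapPl_le_one_iff (f : F →+* M) (w : Pl M) {x : F} :
    vl (comapPl f w) x ≤ 1 ↔ vl w (f x) ≤ 1 := by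
  simpa using comapPl_le f w (x := x) (y := 1)

theorem comapPl_eq_one (f : F →+* M) (w : Pl M) {x : F} :
    vl (comapPl f w) x = 1 ↔ vl w (f x) = 1 := by
  simpa using comapPl_eq f w (x := x) (y := 1)

theorem LS_of_comapPl (f : F →+* M) (w : Pl M) {x : F} (h : LS (vl (comapPl f w)) x) :
    LS (vl w) (f x) := by
  obtain ⟨z, hz⟩ := h
  refine ⟨f z, ?_⟩
  rw [comapPl_lt, map_mul f, map_ofNat, map_sub, map_pow] at hz
  exact hz

theorem comapPl_comp {N : Type*} [Field N] [NumberField N] (f : F →+* M) (g : M →+* N)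
    (w : Pl N) : comapPl f (comapPl g w) = comapPl (g.comp f) w := by
  ext x
  simp only [mem_comapPl]
  rfl

theorem comapPl_id (w : Pl M) : comapPl (RingHom.id M) w = w := by
  ext x
  simp only [mem_comapPl]
  rfl

theorem eq_of_le_one {v w : Pl F} (h : ∀ x : F, vl v x ≤ 1 → vl w x ≤ 1) : v = w := by
  by_contra hne
  have : ¬ v.asIdeal ≤ w.asIdeal := fun h1 ↦ hne
    (HeightOneSpectrum.ext ((v.isMaximal).eq_of_le w.isPrime.ne_top h1))
  obtain ⟨b, hb, hb'⟩ := SetLike.not_le_iff_exists.1 this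
  have : ¬ w.asIdeal ≤ v.asIdeal := fun h1 ↦ hne
    (HeightOneSpectrum.ext ((w.isMaximal).eq_of_le v.isPrime.ne_top h1)).symm
  obtain ⟨a, ha, ha'⟩ := SetLike.not_le_iff_exists.1 this
  have h2 : vl v ((a : F)⁻¹) ≤ 1 := by
    rw [map_inv₀, valuation_eq_one_of_notMem v ha', inv_one]
  have h3 := h _ h2
  have h4 := (w.valuation_lt_one_iff_mem (K := F) a).2 ha
  rw [map_inv₀] at h3
  have h5 : a ≠ 0 := by rintro rfl; simp at ha'
  rw [inv_le_one₀ (zero_lt_iff.2 (by simpa using h5))] at h3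
  exact absurd h4 (not_lt.2 h3)

theorem exists_comapPl_eq (f : F →+* M) (v : Pl F) : ∃ w, comapPl f w = v := by
  let : Algebra F M := f.toAlgebra
  have hinj : RingHom.ker (algebraMap (𝓞 F) (𝓞 M)) ≤ v.asIdeal := by
    rw [(RingHom.injective_iff_ker_eq_bot _).1 (FaithfulSMul.algebraMap_injective (𝓞 F) (𝓞 M))]
    exact bot_le
  have := v.isMaximal
  obtain ⟨Q, hQ, hQ'⟩ := Ideal.exists_ideal_over_maximal_of_isIntegral v.asIdeal hinj
  refine ⟨⟨Q, hQ.isPrime, ?_⟩, HeightOneSpectrum.ext ?_⟩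
  · rintro rfl
    rw [← RingHom.ker, (RingHom.injective_iff_ker_eq_bot _).1
      (FaithfulSMul.algebraMap_injective (𝓞 F) (𝓞 M))] at hQ'
    exact v.ne_bot hQ'.symm
  · exact hQ'

theorem finite_ne_one {x : F} (hx : x ≠ 0) : {v : Pl F | vl v x ≠ 1}.Finite := by
  refine ((HeightOneSpectrum.Support.finite (𝓞 F) x).union
    (HeightOneSpectrum.Support.finite (𝓞 F) x⁻¹)).subset fun v hv ↦ ?_
  rcases lt_or_gt_of_ne hv with h | h
  · right
    change 1 < vl v x⁻¹
    rw [map_inv₀]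
    exact (one_lt_inv₀ (zero_lt_iff.2 (by simpa using hx))).2 h
  · exact Or.inl h

theorem finite_fiber (f : F →+* M) (v : Pl F) : {w : Pl M | comapPl f w = v}.Finite := by
  obtain ⟨r, hr, hr0⟩ := Submodule.exists_mem_ne_zero_of_ne_bot v.ne_bot
  have h0 : f (r : F) ≠ 0 := by simp [hr0]
  refine (finite_ne_one h0).subset ?_
  rintro w rfl
  refine ne_of_lt ?_
  rw [← comapPl_lt_one]
  exact (HeightOneSpectrum.valuation_lt_one_iff_mem _ _).2 hr

theorem finite_preimage (f : F →+* M) {S : Set (Pl F)} (hS : S.Finite) :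
    (comapPl f ⁻¹' S).Finite := by
  have : comapPl f ⁻¹' S = ⋃ v ∈ S, {w | comapPl f w = v} := by ext; simp
  rw [this]
  exact hS.biUnion fun v _ ↦ finite_fiber f v

theorem exists_exp_lt {γ : ℤᵐ⁰} (h : γ ≠ 0) : ∃ n : ℕ, WithZero.exp (-(n : ℤ)) < γ := by
  refine ⟨γ.log.natAbs + 1, ?_⟩
  conv_rhs => rw [← WithZero.exp_log h]
  rw [WithZero.exp_lt_exp]
  omega

/-- Weak approximation at finitely many finite places. -/
theorem exists_approx {S : Set (Pl F)} (hS : S.Finite) (x c : Pl F → F)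
    (hc : ∀ v ∈ S, c v ≠ 0) : ∃ y, ∀ v ∈ S, vl v (y - x v) < vl v (c v) := by
  classical
  lift S to Finset (Pl F) using hS
  obtain ⟨D, hD⟩ := IsLocalization.exist_integer_multiples (nonZeroDivisors (𝓞 F)) S x
  have hD0 : ((D : 𝓞 F) : F) ≠ 0 := by
    simp
  choose! a ha using hD
  have hn : ∀ v ∈ S, ∃ n : ℕ, WithZero.exp (-(n : ℤ)) < vl v ((D : 𝓞 F) * c v) := by
    intro v hv
    apply exists_exp_lt
    rw [(vl v).ne_zero_iff]
    exact mul_ne_zero hD0 (hc v hv)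
  choose! n hn using hn
  obtain ⟨b, hb⟩ := IsDedekindDomain.exists_forall_sub_mem_ideal (s := S)
    (fun v : Pl F ↦ v.asIdeal) n (fun v _ ↦ v.prime)
    (fun v _ w _ hne h ↦ hne (HeightOneSpectrum.ext h)) (fun v ↦ a v)
  refine ⟨b / (D : 𝓞 F), fun v hv ↦ ?_⟩
  have h1 := (v.intValuation_le_pow_iff_mem _ _).2 (hb v hv)
  rw [← v.valuation_of_algebraMap (K := F)] at h1
  have h2 := h1.trans_lt (hn v hv)
  have h3 : (((b - a v : 𝓞 F) : F)) = (D : 𝓞 F) * (b / (D : 𝓞 F) - x v) := by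
    have h4 : (a v : F) = (D : 𝓞 F) * x v := by
      exact (ha v hv).trans (Algebra.smul_def (D : 𝓞 F) (x v))
    change (b : F) - (a v : F) = _
    rw [h4]
    field_simp
  change vl v ((b - a v : 𝓞 F) : F) < _ at h2
  rw [h3, map_mul, map_mul] at h2
  exact lt_of_mul_lt_mul_of_nonneg_left h2 zero_le

end comap

section galois

variable {F K : Type*} [Field F] [NumberField F] [Field K] [NumberField K] [Algebra F K]

theorem comapPl_algEquiv (σ : K ≃ₐ[F] K) (w : Pl K) :
    comapPl (algebraMap F K) (comapPl (σ : K →+* K) w) = comapPl (algebraMap F K) w := by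
  rw [comapPl_comp]
  congr 1
  ext x
  simp

/-- The Galois group permutes transitively the places above a given one. -/
theorem exists_comapPl_algEquiv [IsGalois F K] {w w' : Pl K}
    (h : comapPl (algebraMap F K) w = comapPl (algebraMap F K) w') :
    ∃ σ : K ≃ₐ[F] K, comapPl (σ : K →+* K) w = w' := by
  classical
  by_contra! hne
  let A : Set (Pl K) := Set.range fun σ : K ≃ₐ[F] K ↦ comapPl (σ : K →+* K) w
  let B : Set (Pl K) := Set.range fun σ : K ≃ₐ[F] K ↦ comapPl (σ : K →+* K) w'
  have hAB : ∀ v ∈ B, v ∉ A := by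
    rintro v ⟨τ, rfl⟩ ⟨σ, hσ⟩
    refine hne (σ * τ⁻¹) ?_
    have h1 := congrArg (comapPl ((τ⁻¹ : K ≃ₐ[F] K) : K →+* K)) hσ
    simp only [comapPl_comp] at h1
    have h2 : ((τ : K ≃ₐ[F] K) : K →+* K).comp ((τ⁻¹ : K ≃ₐ[F] K) : K →+* K) = RingHom.id K := by
      ext x
      exact AlgEquiv.apply_symm_apply τ x
    rw [h2, comapPl_id] at h1
    rw [← h1]
    congr 1
  obtain ⟨y, hy⟩ := exists_approx (S := A ∪ B) ((Set.finite_range _).union (Set.finite_range _))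
    (fun v ↦ if v ∈ A then 1 else 0) (fun _ ↦ 1) (fun _ _ ↦ one_ne_zero)
  have hyA : ∀ σ : K ≃ₐ[F] K, vl w (σ y) = 1 := by
    intro σ
    have h1 := hy _ (Or.inl ⟨σ, rfl⟩)
    rw [if_pos (show _ ∈ A from ⟨σ, rfl⟩), map_one] at h1
    have : vl (comapPl (σ : K →+* K) w) y = 1 := by
      rw [← (vl (comapPl (σ : K →+* K) w)).map_one] at h1
      rw [(vl _).map_eq_of_sub_lt h1, map_one]
    simpa using (comapPl_eq_one _ _).1 this
  have hyB : ∀ σ : K ≃ₐ[F] K, vl w' (σ y) < 1 := by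
    intro σ
    have h1 := hy _ (Or.inr ⟨σ, rfl⟩)
    rw [if_neg (hAB _ ⟨σ, rfl⟩), map_one, sub_zero] at h1
    simpa using (comapPl_lt_one _ _).1 h1
  have hN : algebraMap F K (Algebra.norm F y) = ∏ σ : K ≃ₐ[F] K, σ y :=
    Algebra.norm_eq_prod_automorphisms F y
  have h1 : vl (comapPl (algebraMap F K) w) (Algebra.norm F y) = 1 := by
    rw [comapPl_eq_one, hN, map_prod]
    exact Finset.prod_eq_one fun σ _ ↦ hyA σ
  have h2 : vl (comapPl (algebraMap F K) w') (Algebra.norm F y) < 1 := by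
    rw [comapPl_lt_one, hN, map_prod]
    rw [← Finset.mul_prod_erase _ _ (Finset.mem_univ (1 : K ≃ₐ[F] K))]
    refine mul_lt_one_of_lt_of_le (hyB 1) (Finset.prod_le_one' fun σ _ ↦ (hyB σ).le)
  rw [← h, h1] at h2
  exact lt_irrefl _ h2

end galois

end Places

end

section

open IsDedekindDomain NumberField LocalSquare
open scoped WithZero

namespace Places

variable {F : Type*} [Field F] [NumberField F]

/-- Minus the additive valuation. -/
noncomputable def od (v : Pl F) (x : F) : ℤ := (vl v x).log

theorem vl_ne_zero (v : Pl F) {x : F} (hx : x ≠ 0) : vl v x ≠ 0 := by simpa using hx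

theorem vl_pos (v : Pl F) {x : F} (hx : x ≠ 0) : 0 < vl v x := zero_lt_iff.2 (vl_ne_zero v hx)

theorem exp_od (v : Pl F) {x : F} (hx : x ≠ 0) : WithZero.exp (od v x) = vl v x :=
  WithZero.exp_log (vl_ne_zero v hx)

theorem od_mul (v : Pl F) {x y : F} (hx : x ≠ 0) (hy : y ≠ 0) :
    od v (x * y) = od v x + od v y := by
  rw [od, map_mul, WithZero.log_mul (vl_ne_zero v hx) (vl_ne_zero v hy), od, od]

@[simp] theorem od_one (v : Pl F) : od v 1 = 0 := by simp [od]

theorem od_inv (v : Pl F) (x : F) : od v x⁻¹ = -od v x := by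
  simp [od]

theorem od_pow (v : Pl F) (x : F) (n : ℕ) : od v (x ^ n) = n * od v x := by
  simp [od]

theorem od_zpow (v : Pl F) (x : F) (n : ℤ) : od v (x ^ n) = n * od v x := by
  simp [od]

theorem od_lt (v : Pl F) {x y : F} (hx : x ≠ 0) (hy : y ≠ 0) :
    od v x < od v y ↔ vl v x < vl v y := by
  rw [← exp_od v hx, ← exp_od v hy, WithZero.exp_lt_exp]

theorem od_eq (v : Pl F) {x y : F} (hx : x ≠ 0) (hy : y ≠ 0) :
    od v x = od v y ↔ vl v x = vl v y := by
  rw [← exp_od v hx, ← exp_od v hy, WithZero.exp_inj]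

theorem od_eq_zero (v : Pl F) {x : F} (hx : x ≠ 0) : od v x = 0 ↔ vl v x = 1 := by
  rw [← od_one v, od_eq v hx one_ne_zero, map_one]

theorem exists_od_eq (v : Pl F) (n : ℤ) : ∃ x : F, x ≠ 0 ∧ od v x = n := by
  obtain ⟨x, hx⟩ := v.valuation_surjective F (WithZero.exp n)
  refine ⟨x, ?_, ?_⟩
  · rintro rfl; rw [map_zero] at hx; exact WithZero.exp_ne_zero hx.symm
  · rw [od, hx, WithZero.log_exp]

theorem even_od_of_eq_sq (v : Pl F) {x z : F} (h : vl v x = vl v (z ^ 2)) : Even (od v x) := by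
  rw [od, h]
  change Even (od v (z ^ 2))
  rw [od_pow]
  exact (even_two.natCast).mul_right _

theorem exists_eq_sq_of_even_od (v : Pl F) {x : F} (hx : x ≠ 0) (h : Even (od v x)) :
    ∃ z : F, z ≠ 0 ∧ vl v x = vl v (z ^ 2) := by
  obtain ⟨k, hk⟩ := h
  obtain ⟨z, hz, hzk⟩ := exists_od_eq v k
  refine ⟨z, hz, ?_⟩
  rw [← od_eq v hx (pow_ne_zero _ hz), od_pow, hk, hzk]
  push_cast
  ring

section residue

theorem exists_sub_lt_one (v : Pl F) {x : F} (hx : vl v x ≤ 1) :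
    ∃ a : 𝓞 F, vl v (x - a) < 1 := by
  obtain ⟨a, ha⟩ := v.exists_valuation_sub_lt_of_integer hx (1 : (ℤᵐ⁰)ˣ)
  exact ⟨a, by rw [Valuation.map_sub_swap]; exact ha⟩

noncomputable instance (v : Pl F) : Field (𝓞 F ⧸ v.asIdeal) :=
  haveI := v.isMaximal
  Ideal.Quotient.field _

instance (v : Pl F) : Finite (𝓞 F ⧸ v.asIdeal) := Ideal.finiteQuotientOfFreeOfNeBot _ v.ne_bot

theorem mk_eq_mk_iff (v : Pl F) (a b : 𝓞 F) :
    Ideal.Quotient.mk v.asIdeal a = Ideal.Quotient.mk v.asIdeal b ↔ vl v ((a : F) - b) < 1 := by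
  rw [Ideal.Quotient.eq, ← v.valuation_lt_one_iff_mem (K := F)]
  exact Iff.rfl

theorem ringChar_residue_ne_two (v : Pl F) (h2 : vl v 2 = 1) :
    ringChar (𝓞 F ⧸ v.asIdeal) ≠ 2 := by
  intro h
  have h1 : ((2 : ℕ) : 𝓞 F ⧸ v.asIdeal) = 0 := by
    rw [← h]; exact ringChar.Nat.cast_ringChar
  have h3 : Ideal.Quotient.mk v.asIdeal 2 = Ideal.Quotient.mk v.asIdeal 0 := by
    simpa [map_ofNat] using h1
  rw [mk_eq_mk_iff] at h3
  have : vl v (2 : F) < 1 := by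
    have h5 : (((2 : 𝓞 F) : F) - ((0 : 𝓞 F) : F)) = 2 := sub_zero _
    rwa [h5] at h3
  exact absurd h2 this.ne

theorem isSquare_residue_iff (v : Pl F) (h2 : vl v 2 = 1) {x : F} (hx : vl v x = 1) {a : 𝓞 F}
    (ha : vl v (x - a) < 1) : IsSquare (Ideal.Quotient.mk v.asIdeal a) ↔ LS (vl v) x := by
  have h4 : vl v 4 = 1 := by rw [val_four, h2, one_mul]
  constructor
  · rintro ⟨r, hr⟩
    obtain ⟨c, rfl⟩ := Ideal.Quotient.mk_surjective r
    rw [← map_mul, mk_eq_mk_iff] at hr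
    refine ⟨c, ?_⟩
    rw [map_mul, h4, hx, one_mul]
    have : x - (c : F) ^ 2 = (x - a) + (a - (c * c : 𝓞 F)) := by
      change x - (c : F) ^ 2 = (x - a) + ((a : F) - (c : F) * c)
      ring
    rw [this]
    exact (vl v).map_add_lt ha hr
  · rintro ⟨z, hz⟩
    rw [map_mul, h4, hx, one_mul] at hz
    have hz1 : vl v (z ^ 2) = 1 := by
      rw [← hx]; exact val_eq_of_sub_lt (by rwa [hx])
    have hz2 : vl v z = 1 := by
      rw [map_pow] at hz1
      exact (pow_eq_one_iff_of_nonneg zero_le two_ne_zero).1 hz1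
    obtain ⟨c, hc⟩ := exists_sub_lt_one v hz2.le
    refine ⟨Ideal.Quotient.mk _ c, ?_⟩
    rw [← map_mul, mk_eq_mk_iff]
    have : (a : F) - (c * c : 𝓞 F) = (x - z ^ 2) - (x - a) + (z - c) * (z + c) := by
      change (a : F) - (c : F) * c = _
      ring
    rw [this]
    refine (vl v).map_add_lt ((vl v).map_sub_lt hz ha) ?_
    rw [map_mul]
    refine mul_lt_one_of_lt_of_le hc ?_
    exact (vl v).map_add_le hz2.le (v.valuation_le_one c)

theorem mk_ne_zero_of {v : Pl F} {x : F} (hx : vl v x = 1) {a : 𝓞 F}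
    (ha : vl v (x - a) < 1) : Ideal.Quotient.mk v.asIdeal a ≠ 0 := by
  intro h
  rw [← map_zero (Ideal.Quotient.mk v.asIdeal), mk_eq_mk_iff] at h
  have h' : vl v (a : F) < 1 := by simpa using h
  have : vl v x < 1 := by
    have h3 := (vl v).map_add_lt ha h'
    simpa using h3
  exact absurd hx this.ne

/-- At odd places the product of two nonsquare units is a square. -/
theorem LS_mul_of_not_LS (v : Pl F) (h2 : vl v 2 = 1) {x y : F} (hx : vl v x = 1)
    (hy : vl v y = 1) (hx' : ¬ LS (vl v) x) (hy' : ¬ LS (vl v) y) : LS (vl v) (x * y) := by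
  classical
  obtain ⟨a, ha⟩ := exists_sub_lt_one v hx.le
  obtain ⟨b, hb⟩ := exists_sub_lt_one v hy.le
  have := Fintype.ofFinite (𝓞 F ⧸ v.asIdeal)
  have h3 := ringChar_residue_ne_two v h2
  rw [← isSquare_residue_iff v h2 hx ha, ← quadraticChar_neg_one_iff_not_isSquare] at hx'
  rw [← isSquare_residue_iff v h2 hy hb, ← quadraticChar_neg_one_iff_not_isSquare] at hy'
  have hab : vl v (x * y - (a * b : 𝓞 F)) < 1 := by
    have : x * y - (a * b : 𝓞 F) = (x - a) * y + a * (y - b) := by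
      change x * y - (a : F) * b = _
      ring
    rw [this]
    refine (vl v).map_add_lt ?_ ?_
    · rw [map_mul, hy, mul_one]; exact ha
    · rw [map_mul, mul_comm]; exact mul_lt_one_of_lt_of_le hb (v.valuation_le_one a)
  have hxy : vl v (x * y) = 1 := by rw [map_mul, hx, hy, one_mul]
  rw [← isSquare_residue_iff v h2 hxy hab, ← quadraticChar_one_iff_isSquare (mk_ne_zero_of hxy hab),
    map_mul, map_mul, hx', hy']
  norm_num

theorem exists_unit_not_LS (v : Pl F) (h2 : vl v 2 = 1) : ∃ x : F, vl v x = 1 ∧ ¬ LS (vl v) x := by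
  classical
  have := Fintype.ofFinite (𝓞 F ⧸ v.asIdeal)
  obtain ⟨r, hr⟩ := FiniteField.exists_nonsquare (ringChar_residue_ne_two v h2)
  obtain ⟨a, rfl⟩ := Ideal.Quotient.mk_surjective r
  have ha : vl v (a : F) = 1 := by
    refine valuation_eq_one_of_notMem v fun h ↦ hr ?_
    rw [Ideal.Quotient.eq_zero_iff_mem.2 h]
    exact IsSquare.zero
  exact ⟨a, ha, fun h ↦ hr ((isSquare_residue_iff v h2 ha (by simp)).2 h)⟩

/-- At odd places units are norms from unramified quadratic extensions. -/
theorem AN_of_units (v : Pl F) (h2 : vl v 2 = 1) {a b : F} (ha : vl v a = 1)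
    (hb : vl v b = 1) : AN (vl v) a b := by
  classical
  obtain ⟨α, hα⟩ := exists_sub_lt_one v ha.le
  obtain ⟨β, hβ⟩ := exists_sub_lt_one v hb.le
  have := Fintype.ofFinite (𝓞 F ⧸ v.asIdeal)
  have hα0 := mk_ne_zero_of ha hα
  open Polynomial in
  obtain ⟨p, q, hpq⟩ := FiniteField.exists_root_sum_quadratic (R := 𝓞 F ⧸ v.asIdeal)
    (f := X ^ 2 - C (Ideal.Quotient.mk v.asIdeal β))
    (g := C (-(Ideal.Quotient.mk v.asIdeal α)) * X ^ 2)
    (degree_X_pow_sub_C two_pos _) (degree_C_mul_X_pow 2 (neg_ne_zero.2 hα0))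
    (by
      have := Fintype.card (𝓞 F ⧸ v.asIdeal)
      have h5 := ringChar_residue_ne_two v h2
      exact FiniteField.odd_card_of_char_ne_two h5)
  obtain ⟨p, rfl⟩ := Ideal.Quotient.mk_surjective p
  obtain ⟨q, rfl⟩ := Ideal.Quotient.mk_surjective q
  have h5 : Ideal.Quotient.mk v.asIdeal β = Ideal.Quotient.mk v.asIdeal (p ^ 2 - α * q ^ 2) := by
    simp only [Polynomial.eval_sub, Polynomial.eval_pow, Polynomial.eval_X, Polynomial.eval_C,
      Polynomial.eval_mul] at hpq
    simp only [map_sub, map_mul, map_pow]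
    linear_combination -hpq
  rw [mk_eq_mk_iff] at h5
  refine ⟨p, q, ?_⟩
  rw [hb]
  have : b - ((p : F) ^ 2 - a * (q : F) ^ 2) =
      (b - β) + ((β : F) - (p ^ 2 - α * q ^ 2 : 𝓞 F)) + (a - α) * (q : F) ^ 2 := by
    change b - ((p : F) ^ 2 - a * (q : F) ^ 2) =
      (b - β) + ((β : F) - ((p : F) ^ 2 - α * (q : F) ^ 2)) + (a - α) * (q : F) ^ 2
    ring
  rw [this]
  refine (vl v).map_add_lt ((vl v).map_add_lt hβ h5) ?_
  rw [map_mul, map_pow]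
  exact mul_lt_one_of_lt_of_le hα (pow_le_one₀ zero_le (v.valuation_le_one q))

end residue

section index

theorem index_le_of_cover {G : Type*} [CommGroup G] (H : Subgroup G) (R : Finset G)
    (h : ∀ x, ∃ r ∈ R, x * r ∈ H) : H.index ≠ 0 ∧ H.index ≤ R.card := by
  classical
  have hs : Function.Surjective fun r : R ↦ ((r : G)⁻¹ : G ⧸ H) := by
    intro q
    obtain ⟨x, rfl⟩ := QuotientGroup.mk_surjective q
    obtain ⟨r, hr, hx⟩ := h x
    refine ⟨⟨r, hr⟩, ?_⟩
    change ((r⁻¹ : G) : G ⧸ H) = (x : G ⧸ H)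
    rw [QuotientGroup.eq]
    simpa [mul_comm] using hx
  have hf : Finite (G ⧸ H) := Finite.of_surjective _ hs
  refine ⟨Subgroup.index_ne_zero_iff_finite.2 hf, ?_⟩
  have := Nat.card_le_card_of_surjective _ hs
  simpa [Subgroup.index] using this

theorem index_lsGroup_odd (v : Pl F) (h2 : vl v 2 = 1) :
    (lsGroup (vl v)).index ≠ 0 ∧ (lsGroup (vl v)).index ≤ 4 := by
  classical
  obtain ⟨ε, hε, hε'⟩ := exists_unit_not_LS v h2
  have hε0 : ε ≠ 0 := by rintro rfl; simp at hε
  obtain ⟨π, hπ0, hπ⟩ := exists_od_eq v 1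
  have key : ∀ x : F, x ≠ 0 → Even (od v x) → LS (vl v) x ∨ LS (vl v) (x * ε) := by
    intro x hx hev
    obtain ⟨z, hz, hxz⟩ := exists_eq_sq_of_even_od v hx hev
    have h1 : vl v (x * z⁻¹ ^ 2) = 1 := by
      rw [map_mul, hxz, ← map_mul, ← mul_pow, mul_inv_cancel₀ hz]; simp
    by_contra! hn
    have h3 := LS_mul_of_not_LS v h2 h1 hε
      (by rw [LS.mul_sq_iff (inv_ne_zero hz)]; exact hn.1) hε'
    rw [mul_right_comm, LS.mul_sq_iff (inv_ne_zero hz)] at h3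
    exact hn.2 h3
  let e : Fˣ := Units.mk0 ε hε0
  let p : Fˣ := Units.mk0 π hπ0
  obtain ⟨h1, h3⟩ := index_le_of_cover (lsGroup (vl v)) ({1, e, p, p * e} : Finset Fˣ) (by
    intro x
    rcases Int.even_or_odd (od v (x : F)) with hx | hx
    · rcases key x x.ne_zero hx with h | h
      · exact ⟨1, by simp, by simpa [mem_lsGroup, e, p] using h⟩
      · exact ⟨e, by simp, by simpa [mem_lsGroup, e, p] using h⟩
    · have hx' : Even (od v (x * π)) := by
        rw [od_mul v x.ne_zero hπ0, hπ]; exact hx.add_one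
      rcases key (x * π) (mul_ne_zero x.ne_zero hπ0) hx' with h | h
      · exact ⟨p, by simp, by simpa [mem_lsGroup, e, p] using h⟩
      · exact ⟨p * e, by simp, by simpa [mem_lsGroup, mul_assoc, e, p] using h⟩)
  exact ⟨h1, h3.trans (Finset.card_le_four)⟩

/-- The completion at `v` is `ℚ₂`. -/
def IsQ2 (v : Pl F) : Prop :=
  vl v 2 < 1 ∧ (∀ x : F, x ≠ 0 → ∃ k : ℤ, vl v x = vl v 2 ^ k) ∧
    ∀ x : F, vl v x ≤ 1 → vl v x < 1 ∨ vl v (x - 1) < 1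

theorem IsQ2.le_two {v : Pl F} (hv : IsQ2 v) {x : F} (hx : vl v x < 1) : vl v x ≤ vl v 2 := by
  by_cases hx0 : x = 0
  · simp [hx0]
  obtain ⟨k, hk⟩ := hv.2.1 x hx0
  have h2 : 0 < vl v 2 := vl_pos v two_ne_zero
  rw [hk] at hx ⊢
  have hk0 : 0 < k := by
    by_contra! h
    exact absurd hx (not_lt.2 (one_le_zpow_of_nonpos₀ h2 hv.1.le h))
  calc vl v 2 ^ k ≤ vl v 2 ^ (1 : ℤ) := zpow_le_zpow_right_of_le_one₀ h2 hv.1.le hk0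
    _ = _ := zpow_one _

theorem IsQ2.exists_int {v : Pl F} (hv : IsQ2 v) (n : ℕ) {x : F} (hx : vl v x ≤ 1) :
    ∃ m : ℤ, vl v (x - m) ≤ vl v (2 ^ n) := by
  induction n with
  | zero => exact ⟨0, by simpa using hx⟩
  | succ n ih =>
    obtain ⟨m, hm⟩ := ih
    have h2 : (2 : F) ^ n ≠ 0 := pow_ne_zero _ two_ne_zero
    have h0 : x - m = (x - m) / 2 ^ n * 2 ^ n := by field_simp
    have h1 : vl v ((x - m) / 2 ^ n) ≤ 1 := by
      rw [map_div₀]; exact div_le_one_of_le₀ hm zero_le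
    rcases hv.2.2 _ h1 with h | h
    · refine ⟨m, ?_⟩
      rw [h0, map_mul, pow_succ', map_mul]
      exact mul_le_mul_left (hv.le_two h) _
    · refine ⟨m + 2 ^ n, ?_⟩
      have : x - ((m + 2 ^ n : ℤ) : F) = ((x - m) / 2 ^ n - 1) * 2 ^ n := by
        push_cast; field_simp; ring
      rw [this, map_mul, pow_succ', map_mul]
      exact mul_le_mul_left (hv.le_two h) _

theorem IsQ2.LS_of_sub_le {v : Pl F} (hv : IsQ2 v) {x : F} (h : vl v (x - 1) ≤ vl v 8) :
    LS (vl v) x := by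
  have h8 : vl v 8 < vl v 4 := by
    have : (8 : F) = 4 * 2 := by norm_num
    rw [this, map_mul]
    exact mul_lt_of_lt_one_right (vl_pos v (by norm_num)) hv.1
  have h4 : vl v 4 ≤ 1 := val_four_le_one _
  have hx : vl v x = 1 := by
    have := (vl v).map_eq_of_sub_lt (x := 1) (y := x)
      (by rw [map_one]; exact (h.trans_lt h8).trans_le h4)
    rw [this, map_one]
  refine ⟨1, ?_⟩
  rw [one_pow, map_mul, hx, mul_one]
  exact h.trans_lt h8

theorem index_lsGroup_two (v : Pl F) (hv : IsQ2 v) :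
    (lsGroup (vl v)).index ≠ 0 ∧ (lsGroup (vl v)).index ≤ 8 := by
  classical
  have key : ∀ x : F, vl v x = 1 → ∃ m ∈ ({1, 3, 5, 7} : Finset ℕ), LS (vl v) (x * m) := by
    intro x hx
    obtain ⟨m, hm⟩ := hv.exists_int 3 hx.le
    have h8 : ((2 : F) ^ 3) = 8 := by norm_num
    rw [h8] at hm
    have hle : ∀ k : ℤ, vl v ((8 : F) * k) ≤ vl v 8 := fun k ↦ by
      rw [map_mul]; exact mul_le_of_le_one_right' (val_intCast_le_one _ k)
    have hodd : ∀ k : ℤ, m ≠ 2 * k := by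
      rintro k rfl
      have h1 : vl v (x - (2 * k : ℤ)) < 1 := by
        refine hm.trans_lt ?_
        rw [← h8, map_pow]
        exact pow_lt_one₀ zero_le hv.1 (by norm_num)
      have h2 : vl v ((2 * k : ℤ) : F) < 1 := by
        push_cast
        rw [map_mul]
        exact mul_lt_one_of_lt_of_le hv.1 (val_intCast_le_one _ k)
      have h3 := (vl v).map_add_lt h1 h2
      rw [sub_add_cancel, hx] at h3
      exact lt_irrefl _ h3
    have hfin : ∀ c : ℕ, ∀ k j : ℤ, m = c + 8 * k → (c : ℤ) * c = 1 + 8 * j → LS (vl v) (x * c) := by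
      intro c k j hck hcj
      apply hv.LS_of_sub_le
      have : x * c - 1 = (x - m) * c + 8 * (k * c + j : ℤ) := by
        have h1 : (m : F) = c + 8 * k := by exact_mod_cast congrArg (Int.cast (R := F)) hck
        have h2 : (c : F) * c = 1 + 8 * j := by exact_mod_cast congrArg (Int.cast (R := F)) hcj
        push_cast
        rw [h1]
        linear_combination h2
      rw [this]
      refine (vl v).map_add_le ?_ (hle _)
      rw [map_mul]
      exact (mul_le_of_le_one_right' (val_natCast_le_one _ c)).trans hm
    have hm8 : m % 8 = 1 ∨ m % 8 = 3 ∨ m % 8 = 5 ∨ m % 8 = 7 := by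
      have := hodd (m / 2)
      omega
    have hdiv := Int.emod_add_mul_ediv m 8
    rcases hm8 with h | h | h | h
    · exact ⟨1, by simp, hfin 1 (m / 8) 0 (by push_cast; omega) (by norm_num)⟩
    · exact ⟨3, by simp, hfin 3 (m / 8) 1 (by push_cast; omega) (by norm_num)⟩
    · exact ⟨5, by simp, hfin 5 (m / 8) 3 (by push_cast; omega) (by norm_num)⟩
    · exact ⟨7, by simp, hfin 7 (m / 8) 6 (by push_cast; omega) (by norm_num)⟩
  let R : Finset Fˣ := (({1, 2} : Finset ℕ) ×ˢ ({1, 3, 5, 7} : Finset ℕ)).image fun p ↦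
    if h : ((p.1 * p.2 : ℕ) : F) ≠ 0 then Units.mk0 _ h else 1
  have hR : R.card ≤ 8 := Finset.card_image_le
  obtain ⟨h1, h3⟩ := index_le_of_cover (lsGroup (vl v)) R (by
    intro x
    obtain ⟨k, hk⟩ := hv.2.1 x x.ne_zero
    have h20 : (2 : F) ≠ 0 := two_ne_zero
    obtain ⟨i, hi, hi'⟩ : ∃ i ∈ ({1, 2} : Finset ℕ), ∃ z : F, z ≠ 0 ∧ vl v (x * i * z ^ 2) = 1 := by
      rcases Int.even_or_odd' k with ⟨j, hj | hj⟩
      · refine ⟨1, by simp, 2 ^ (-j), zpow_ne_zero _ h20, ?_⟩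
        rw [Nat.cast_one, mul_one, map_mul, hk, ← map_zpow₀, ← map_mul, ← zpow_natCast, ← zpow_mul,
          ← zpow_add₀ h20, hj]
        have : 2 * j + -j * ((2 : ℕ) : ℤ) = 0 := by push_cast; ring
        rw [this]; simp
      · refine ⟨2, by simp, 2 ^ (-j - 1), zpow_ne_zero _ h20, ?_⟩
        rw [Nat.cast_two, map_mul, map_mul, hk, ← map_zpow₀, ← map_mul, ← map_mul, ← zpow_natCast,
          ← zpow_mul, ← zpow_add_one₀ h20, ← zpow_add₀ h20, hj]
        have : 2 * j + 1 + 1 + (-j - 1) * ((2 : ℕ) : ℤ) = 0 := by push_cast; ring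
        rw [this]; simp
    obtain ⟨z, hz, hz'⟩ := hi'
    obtain ⟨m, hm, hm'⟩ := key _ hz'
    have h0 : ((i * m : ℕ) : F) ≠ 0 := by
      simp only [Finset.mem_insert, Finset.mem_singleton] at hi hm
      rw [Nat.cast_ne_zero]
      rcases hi with rfl | rfl <;> rcases hm with rfl | rfl | rfl | rfl <;> norm_num
    refine ⟨Units.mk0 _ h0, ?_, ?_⟩
    · refine Finset.mem_image.2 ⟨(i, m), Finset.mem_product.2 ⟨hi, hm⟩, ?_⟩
      rw [dif_pos h0]
    · rw [mem_lsGroup, ← LS.mul_sq_iff hz]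
      convert hm' using 1
      simp only [Units.val_mul, Units.val_mk0]
      push_cast
      ring)
  exact ⟨h1, h3.trans hR⟩

end index

/-- At an odd place where `a` is not a square, not everything is a local norm. -/
theorem exists_not_AN (v : Pl F) (h2 : vl v 2 = 1) {a : F} (ha0 : a ≠ 0) (ha : ¬ LS (vl v) a) :
    ∃ b : F, b ≠ 0 ∧ ¬ AN (vl v) a b := by
  rcases Int.even_or_odd (od v a) with h | h
  · obtain ⟨π, hπ0, hπ⟩ := exists_od_eq v 1
    refine ⟨π, hπ0, ?_⟩
    rintro ⟨x, y, hxy⟩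
    have h1 := val_eq_of_sub_lt hxy
    rw [max_le_of_not_LS h2 ha] at h1
    obtain ⟨c, hc, hc'⟩ := exists_eq_sq_of_even_od v ha0 h
    have : Even (od v π) := by
      rcases max_choice (vl v (x ^ 2)) (vl v (a * y ^ 2)) with h3 | h3
      · exact even_od_of_eq_sq v (h1.symm.trans h3)
      · refine even_od_of_eq_sq v (z := c * y) (h1.symm.trans (h3.trans ?_))
        rw [map_mul, hc', ← map_mul, mul_pow]
    rw [hπ] at this
    exact absurd this (by decide)
  · obtain ⟨ε, hε, hε'⟩ := exists_unit_not_LS v h2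
    have hε0 : ε ≠ 0 := by rintro rfl; simp at hε
    refine ⟨ε, hε0, ?_⟩
    rintro ⟨x, y, hxy⟩
    have h1 := val_eq_of_sub_lt hxy
    rw [max_le_of_not_LS h2 ha, hε] at h1
    have hne : vl v (a * y ^ 2) ≠ 1 := by
      intro h3
      by_cases hy : y = 0
      · simp [hy] at h3
      rw [← od_eq_zero v (mul_ne_zero ha0 (pow_ne_zero _ hy)),
        od_mul v ha0 (pow_ne_zero _ hy), od_pow] at h3
      rcases h with ⟨k, hk⟩
      push_cast at h3
      omega
    have hlt : vl v (a * y ^ 2) < 1 := lt_of_le_of_ne (h1 ▸ le_max_right _ _) hne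
    refine hε' ⟨x, ?_⟩
    rw [map_mul, val_four, h2, one_mul, one_mul, hε]
    have : ε - x ^ 2 = (ε - (x ^ 2 - a * y ^ 2)) - a * y ^ 2 := by ring
    rw [this]
    exact (vl v).map_sub_lt (by rwa [hε] at hxy) hlt

end Places

end

namespace FGAbelian

open Module

/-- The rank of an abelian group. -/
noncomputable def rk (A : Type*) [CommGroup A] : ℕ := finrank ℤ (Additive A)

section

variable {A B : Type*} [CommGroup A] [CommGroup B]

theorem rk_congr (e : A ≃* B) : rk A = rk B :=
  e.toAdditive.toIntLinearEquiv.finrank_eq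

theorem finite_congr (e : A ≃* B) [Module.Finite ℤ (Additive A)] :
    Module.Finite ℤ (Additive B) :=
  Module.Finite.equiv e.toAdditive.toIntLinearEquiv

instance finite_subgroup [Module.Finite ℤ (Additive A)] (H : Subgroup A) :
    Module.Finite ℤ (Additive H) :=
  inferInstanceAs (Module.Finite ℤ (AddSubgroup.toIntSubmodule H.toAddSubgroup))

theorem rk_quotient [Module.Finite ℤ (Additive A)] (H : Subgroup A) :
    rk (A ⧸ H) + rk H = rk A :=
  Submodule.finrank_quotient_add_finrank (R := ℤ) (AddSubgroup.toIntSubmodule H.toAddSubgroup)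

theorem rk_range_add_ker [Module.Finite ℤ (Additive A)] (f : A →* B) :
    rk f.range + rk f.ker = rk A := by
  rw [← rk_quotient f.ker, rk_congr (QuotientGroup.quotientKerEquivRange f)]

theorem finite_of_ker_range (f : A →* B) [Module.Finite ℤ (Additive f.ker)]
    [Module.Finite ℤ (Additive f.range)] : Module.Finite ℤ (Additive A) := by
  have h1 : Module.Finite ℤ (Additive (A ⧸ f.ker)) :=
    finite_congr (QuotientGroup.quotientKerEquivRange f).symm
  have h2 : Module.Finite ℤ (AddSubgroup.toIntSubmodule f.ker.toAddSubgroup) :=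
    inferInstanceAs (Module.Finite ℤ (Additive f.ker))
  have h3 : Module.Finite ℤ (Additive A ⧸ AddSubgroup.toIntSubmodule f.ker.toAddSubgroup) := h1
  exact Module.Finite.of_submodule_quotient (AddSubgroup.toIntSubmodule f.ker.toAddSubgroup)

theorem rk_eq_zero_of_finite [Finite A] : rk A = 0 := by
  have : Finite (Additive A) := ‹Finite A›
  have : Module.Finite ℤ (Additive A) := inferInstance
  refine finrank_eq_zero_iff_isTorsion.2 fun x ↦ ?_
  refine ⟨⟨Nat.card (Additive A), ?_⟩, ?_⟩
  · simp [mem_nonZeroDivisors_iff_ne_zero, Nat.card_pos.ne']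
  · change (Nat.card (Additive A) : ℤ) • x = 0
    rw [natCast_zsmul]
    exact card_nsmul_eq_zero'

theorem rk_of_index_ne_zero [Module.Finite ℤ (Additive A)] (H : Subgroup A) (h : H.index ≠ 0) :
    rk H = rk A := by
  have : Finite (A ⧸ H) := Subgroup.index_ne_zero_iff_finite.1 h
  rw [← rk_quotient H, rk_eq_zero_of_finite (A := A ⧸ H), zero_add]

end

section index

variable {M : Type*} [AddCommGroup M]

theorem index_range_two_nsmul [Module.Finite ℤ M] :
    (nsmulAddMonoidHom (α := M) 2).range.index =
      2 ^ finrank ℤ M * Nat.card (nsmulAddMonoidHom (α := M) 2).ker := by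
  let T : AddSubgroup M := AddCommGroup.torsion M
  have hTfin : Finite T := by
    have h1 : Module.Finite ℤ (AddSubgroup.toIntSubmodule T) := inferInstance
    have h2 : Module.IsTorsion ℤ (AddSubgroup.toIntSubmodule T) := by
      rw [← finrank_eq_zero_iff_isTorsion]
      have := Submodule.finrank_quotient_add_finrank (R := ℤ) (AddSubgroup.toIntSubmodule T)
      have h3 := finrank_quotient_torsion_eq (M := M)
      change finrank ℤ (M ⧸ (AddSubgroup.toIntSubmodule T)) = _ at h3
      omega
    exact Module.finite_of_fg_torsion (AddSubgroup.toIntSubmodule T) h2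
  have hfree : IsAddTorsionFree (M ⧸ T) := inferInstance
  have hfin : Module.Finite ℤ (M ⧸ T) :=
    inferInstanceAs (Module.Finite ℤ (M ⧸ AddSubgroup.toIntSubmodule T))
  have hfr : Module.Free ℤ (M ⧸ T) := inferInstance
  have h1 := AddSubgroup.index_range_nsmul (M ⧸ T) 2
  have h2 : finrank ℤ (M ⧸ T) = finrank ℤ M := finrank_quotient_torsion_eq (M := M)
  rw [h2] at h1
  let f := QuotientAddGroup.mk' T
  have hmap : ((nsmulAddMonoidHom (α := M) 2).range).map f =
      (nsmulAddMonoidHom (α := M ⧸ T) 2).range := by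
    ext x
    constructor
    · rintro ⟨_, ⟨y, rfl⟩, rfl⟩
      exact ⟨f y, by simp⟩
    · rintro ⟨y, rfl⟩
      obtain ⟨y, rfl⟩ := QuotientAddGroup.mk'_surjective T y
      exact ⟨2 • y, ⟨y, rfl⟩, by simp [f]⟩
  have h3 := AddSubgroup.index_map ((nsmulAddMonoidHom (α := M) 2).range) f
  rw [hmap, h1, AddMonoidHom.range_eq_top.2 (QuotientAddGroup.mk'_surjective T),
    AddSubgroup.index_top, mul_one, QuotientAddGroup.ker_mk'] at h3
  set R := (nsmulAddMonoidHom (α := M) 2).range with hR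
  have h4 := AddSubgroup.relIndex_mul_index (le_sup_left : R ≤ R ⊔ T)
  rw [← h4, ← h3, mul_comm]
  congr 1
  rw [sup_comm, AddSubgroup.relIndex_sup_right]
  have h5 : R.addSubgroupOf T = (nsmulAddMonoidHom (α := T) 2).range := by
    ext ⟨x, hx⟩
    rw [AddSubgroup.mem_addSubgroupOf]
    constructor
    · rintro ⟨y, hy⟩
      change 2 • y = x at hy
      have hyT : y ∈ T := by
        have : 2 • (y : M ⧸ T) = 0 := by
          change ((2 • y : M) : M ⧸ T) = 0
          rw [hy]
          exact (QuotientAddGroup.eq_zero_iff x).2 hx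
        have h6 : (y : M ⧸ T) = 0 := by simpa using this
        exact (QuotientAddGroup.eq_zero_iff y).1 h6
      exact ⟨⟨y, hyT⟩, Subtype.ext hy⟩
    · rintro ⟨y, hy⟩
      exact ⟨y, congrArg Subtype.val hy⟩
  rw [AddSubgroup.relIndex, h5]
  have h7 := AddSubgroup.card_mul_index (nsmulAddMonoidHom (α := T) 2).range
  have h8 := AddSubgroup.card_mul_index (nsmulAddMonoidHom (α := T) 2).ker
  rw [AddSubgroup.index_ker, mul_comm] at h8
  have h9 : 0 < Nat.card (nsmulAddMonoidHom (α := T) 2).range := Nat.card_pos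
  have h10 : (nsmulAddMonoidHom (α := T) 2).range.index =
      Nat.card (nsmulAddMonoidHom (α := T) 2).ker :=
    Nat.eq_of_mul_eq_mul_left h9 (h7.trans h8.symm)
  rw [h10]
  refine Nat.card_congr ⟨fun x ↦ ⟨x.1, ?_⟩, fun x ↦ ⟨⟨x.1, ?_⟩, ?_⟩, fun _ ↦ rfl, fun _ ↦ rfl⟩
  · exact congrArg Subtype.val x.2
  · refine isOfFinAddOrder_iff_nsmul_eq_zero.2 ⟨2, two_pos, x.2⟩
  · exact Subtype.ext x.2

theorem index_range_sq {A : Type*} [CommGroup A] [Module.Finite ℤ (Additive A)] :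
    (powMonoidHom (α := A) 2).range.index = 2 ^ rk A * Nat.card (powMonoidHom (α := A) 2).ker :=
  index_range_two_nsmul (M := Additive A)

end index

end FGAbelian

section

open IsDedekindDomain NumberField LocalSquare FGAbelian Module
open scoped WithZero

namespace Places

variable {F : Type*} [Field F] [NumberField F]

/-- The group of `T`-units. -/
def sU (T : Set (Pl F)) : Subgroup Fˣ where
  carrier := {x | ∀ v ∉ T, vl v (x : F) = 1}
  one_mem' := fun v _ ↦ by simp
  mul_mem' := fun ha hb v hv ↦ by simp [ha v hv, hb v hv]
  inv_mem' := fun ha v hv ↦ by simpa using ha v hv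

theorem sU_mono {T T' : Set (Pl F)} (h : T ⊆ T') : sU T ≤ sU T' :=
  fun _ hx v hv ↦ hx v fun h' ↦ hv (h h')

theorem neg_one_mem_sU (T : Set (Pl F)) : (-1 : Fˣ) ∈ sU T := fun v _ ↦ by simp

theorem card_ker_sq {H : Subgroup Fˣ} (h : (-1 : Fˣ) ∈ H) :
    Nat.card (powMonoidHom (α := H) 2).ker = 2 := by
  rw [Nat.card_eq_two_iff]
  refine ⟨⟨1, by simp⟩, ⟨⟨-1, h⟩, Subtype.ext (by simp)⟩, fun h1 ↦ ?_, ?_⟩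
  · have h2 := congrArg (fun x : (powMonoidHom (α := H) 2).ker ↦ ((x : H) : Fˣ)) h1
    have h3 : (1 : Fˣ) = -1 := h2
    have h4 : (1 : F) = -1 := by simpa using congrArg Units.val h3
    have : (2 : F) = 0 := by linear_combination h4
    exact two_ne_zero this
  · ext ⟨⟨x, hx⟩, hx'⟩
    have h2 : x ^ 2 = 1 := congrArg Subtype.val hx'
    have h3 : (x : F) ^ 2 = 1 := by simpa using congrArg Units.val h2
    simp only [Set.mem_insert_iff, Set.mem_singleton_iff, Set.mem_univ, iff_true]
    rcases sq_eq_one_iff.1 h3 with h | h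
    · left; exact Subtype.ext (Subtype.ext (Units.ext h))
    · right; exact Subtype.ext (Subtype.ext (Units.ext h))

/-- The valuations of a `T`-unit. -/
noncomputable def odHom (T : Set (Pl F)) : sU T →* Multiplicative (T → ℤ) where
  toFun x := Multiplicative.ofAdd fun v ↦ od (v : Pl F) (x : Fˣ)
  map_one' := by
    rw [← ofAdd_zero]
    congr 1
    ext v
    simp
  map_mul' x y := by
    rw [← ofAdd_add]
    congr 1
    ext v
    simp [od_mul]

theorem exists_unit_of_vl_eq_one {x : F} (hx : ∀ v : Pl F, vl v x = 1) :
    ∃ u : (𝓞 F)ˣ, ((u : 𝓞 F) : F) = x := by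
  obtain ⟨a, ha⟩ := HeightOneSpectrum.mem_integers_of_valuation_le_one (R := 𝓞 F) F x
    fun v ↦ (hx v).le
  obtain ⟨b, hb⟩ := HeightOneSpectrum.mem_integers_of_valuation_le_one (R := 𝓞 F) F x⁻¹
    fun v ↦ by
      have := hx v
      change vl v x⁻¹ ≤ 1
      rw [map_inv₀, this, inv_one]
  have hx0 : x ≠ 0 := by
    rintro rfl
    simp only [map_eq_zero_iff _ (FaithfulSMul.algebraMap_injective (𝓞 F) F)] at ha hb
    by_cases h : ∃ v : Pl F, True
    · obtain ⟨v, -⟩ := h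
      simpa using hx v
    · have := NumberField.RingOfIntegers.not_isField F
      obtain ⟨P, hP, hP'⟩ := Ring.not_isField_iff_exists_prime.1 this
      exact h ⟨⟨P, hP', hP⟩, trivial⟩
  have hab : a * b = 1 := by
    apply FaithfulSMul.algebraMap_injective (𝓞 F) F
    rw [map_mul, ha, hb, map_one, mul_inv_cancel₀ hx0]
  exact ⟨⟨a, b, hab, by rw [mul_comm]; exact hab⟩, ha⟩

noncomputable def unitsEquivKer (T : Set (Pl F)) : (𝓞 F)ˣ ≃* (odHom T).ker :=
  MulEquiv.ofBijective
    (MonoidHom.codRestrict ((Units.map (algebraMap (𝓞 F) F).toMonoidHom).codRestrict (sU T)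
      fun u v _ ↦ (valuation_eq_one_of_notMem v fun h ↦
        v.isPrime.ne_top (Ideal.eq_top_of_isUnit_mem _ h u.isUnit))) (odHom T).ker
      (fun u ↦ by
        rw [MonoidHom.mem_ker]
        change Multiplicative.ofAdd _ = Multiplicative.ofAdd _
        congr 1
        ext v
        refine (od_eq_zero (v : Pl F) (Units.ne_zero _)).2 ?_
        exact (valuation_eq_one_of_notMem (v : Pl F) fun h ↦
          (v : Pl F).isPrime.ne_top (Ideal.eq_top_of_isUnit_mem _ h u.isUnit))))
    (by
      constructor
      · intro a b hab
        have := congrArg (fun x : (odHom T).ker ↦ (((x : sU T) : Fˣ) : F)) hab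
        exact Units.ext (FaithfulSMul.algebraMap_injective (𝓞 F) F this)
      · rintro ⟨⟨x, hx⟩, hx'⟩
        obtain ⟨u, hu⟩ := exists_unit_of_vl_eq_one (x := (x : F)) (fun v ↦ by
          by_cases hv : v ∈ T
          · rw [← od_eq_zero v x.ne_zero]
            exact congrFun (congrArg Multiplicative.toAdd hx') ⟨v, hv⟩
          · exact hx v hv)
        refine ⟨u, Subtype.ext (Subtype.ext (Units.ext hu))⟩)

theorem exists_od_ne_zero (v : Pl F) : ∃ x : F, x ≠ 0 ∧ od v x ≠ 0 ∧ ∀ w ≠ v, vl w x = 1 := by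
  have h0 : v.asIdeal ∈ nonZeroDivisors (Ideal (𝓞 F)) := mem_nonZeroDivisors_of_ne_zero v.ne_bot
  have h1 : ClassGroup.mk0 (⟨v.asIdeal, h0⟩ ^ Fintype.card (ClassGroup (𝓞 F))) = 1 := by
    rw [map_pow, pow_card_eq_one]
  rw [ClassGroup.mk0_eq_one_iff] at h1
  obtain ⟨a, ha⟩ := h1
  have ha' : v.asIdeal ^ Fintype.card (ClassGroup (𝓞 F)) = Ideal.span {a} := ha
  have hpos : Fintype.card (ClassGroup (𝓞 F)) ≠ 0 := Fintype.card_ne_zero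
  have ha0 : a ≠ 0 := by
    rintro rfl
    rw [Ideal.span_singleton_eq_bot.2 rfl] at ha'
    exact v.ne_bot (pow_eq_zero_iff hpos |>.1 ha')
  refine ⟨a, by simpa using ha0, ?_, ?_⟩
  · rw [Ne, od_eq_zero v (by simpa using ha0)]
    refine ne_of_lt ((v.valuation_lt_one_iff_mem _).2 ?_)
    exact (Ideal.pow_le_self hpos) (ha' ▸ Ideal.mem_span_singleton_self a)
  · intro w hw
    refine valuation_eq_one_of_notMem w fun h ↦ hw ?_
    rw [← Ideal.span_singleton_le_iff_mem, ← ha', w.isPrime.pow_le_iff hpos] at h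
    exact (HeightOneSpectrum.ext (v.isMaximal.eq_of_le w.isPrime.ne_top h)).symm

theorem rk_range_odHom {T : Set (Pl F)} (hT : T.Finite) : rk (odHom T).range = T.ncard := by
  classical
  have : Fintype T := hT.fintype
  apply le_antisymm
  · have h := Submodule.finrank_le (R := ℤ) (M := T → ℤ)
      (AddSubgroup.toIntSubmodule (odHom T).range.toAddSubgroup')
    rw [finrank_fintype_fun_eq_card] at h
    rw [← Nat.card_coe_set_eq, Nat.card_eq_fintype_card]
    exact h
  · choose x hx0 hx1 hx2 using fun v : T ↦ exists_od_ne_zero (v : Pl F)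
    let y : T → sU T := fun v ↦ ⟨Units.mk0 (x v) (hx0 v), fun w hw ↦ hx2 v w fun h ↦ hw (h ▸ v.2)⟩
    let z : T → (odHom T).range.toAddSubgroup' := fun v ↦ ⟨_, ⟨y v, rfl⟩⟩
    have hz : ∀ v w : T, ((z v : T → ℤ)) w = if w = v then od (v : Pl F) (x v) else 0 := by
      intro v w
      split_ifs with h
      · rw [h]; rfl
      · exact (od_eq_zero _ (hx0 v)).2 (hx2 v w fun h' ↦ h (Subtype.ext h'))
    have hli : LinearIndependent ℤ (fun v ↦ (z v : T → ℤ)) := by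
      rw [Fintype.linearIndependent_iff]
      intro g hg v
      have := congrFun hg v
      simp only [Finset.sum_apply, Pi.smul_apply, hz, smul_eq_mul, mul_ite, mul_zero,
        Finset.sum_ite_eq, Finset.mem_univ, if_true, Pi.zero_apply, mul_eq_zero] at this
      exact this.resolve_right (hx1 v)
    have hli' : LinearIndependent ℤ (M := AddSubgroup.toIntSubmodule (odHom T).range.toAddSubgroup') z :=
      LinearIndependent.of_comp (Submodule.subtype _) hli
    have h := hli'.fintype_card_le_finrank
    rw [← Nat.card_coe_set_eq, Nat.card_eq_fintype_card]
    exact h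

instance finite_additive_fun {ι : Type*} [Finite ι] :
    Module.Finite ℤ (Additive (Multiplicative (ι → ℤ))) :=
  inferInstanceAs (Module.Finite ℤ (ι → ℤ))

theorem finite_sU {T : Set (Pl F)} (hT : T.Finite) : Module.Finite ℤ (Additive (sU T)) := by
  have : Finite T := hT
  have := finite_congr (unitsEquivKer T)
  exact finite_of_ker_range (odHom T)

theorem rk_sU {T : Set (Pl F)} (hT : T.Finite) : rk (sU T) = T.ncard + Units.rank F := by
  have := finite_sU hT
  rw [← rk_range_add_ker (odHom T), rk_range_odHom hT, ← rk_congr (unitsEquivKer T)]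
  congr 1
  exact Units.finrank_eq F

theorem index_sq_sU {T : Set (Pl F)} (hT : T.Finite) :
    (powMonoidHom (α := sU T) 2).range.index = 2 ^ (T.ncard + Fintype.card (InfinitePlace F)) := by
  have := finite_sU hT
  rw [index_range_sq, card_ker_sq (neg_one_mem_sU T), rk_sU hT, ← pow_succ, Units.rank, add_assoc,
    Nat.sub_add_cancel Fintype.card_pos]

/-- The class group of `T`-integers is trivial. -/
def ClT (T : Set (Pl F)) : Prop :=
  ∀ n : Pl F → ℤ, (Function.support n).Finite → ∃ f : F, f ≠ 0 ∧ ∀ v ∉ T, od v f = n v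

theorem ClT.mono {T T' : Set (Pl F)} (h : ClT T) (hT : T ⊆ T') : ClT T' := fun n hn ↦ by
  obtain ⟨f, hf, h'⟩ := h n hn
  exact ⟨f, hf, fun v hv ↦ h' v fun h ↦ hv (hT h)⟩

open scoped Classical in
theorem ClT_of_single {T : Set (Pl F)}
    (h : ∀ v, ∃ f : F, f ≠ 0 ∧ ∀ w ∉ T, od w f = if w = v then -1 else 0) : ClT T := by
  choose f hf0 hf using h
  intro n hn
  refine ⟨∏ v ∈ hn.toFinset, f v ^ (-n v), Finset.prod_ne_zero_iff.2 fun v _ ↦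
    zpow_ne_zero _ (hf0 v), fun w hw ↦ ?_⟩
  have : ∀ s : Finset (Pl F), od w (∏ v ∈ s, f v ^ (-n v)) = ∑ v ∈ s, od w (f v ^ (-n v)) := by
    intro s
    induction s using Finset.induction_on with
    | empty => simp
    | insert a s ha ih =>
      rw [Finset.prod_insert ha, Finset.sum_insert ha, od_mul, ih]
      · exact zpow_ne_zero _ (hf0 a)
      · exact Finset.prod_ne_zero_iff.2 fun v _ ↦ zpow_ne_zero _ (hf0 v)
  rw [this]
  simp only [od_zpow, hf _ w hw, mul_ite, mul_neg, mul_one, neg_neg, mul_zero]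
  rw [Finset.sum_ite_eq]
  simp only [Set.Finite.mem_toFinset, Function.mem_support, ne_eq, ite_not]
  split_ifs with h
  · exact h.symm
  · rfl

theorem exists_ClT (F : Type*) [Field F] [NumberField F] :
    ∃ T : Set (Pl F), T.Finite ∧ ClT T := by
  classical
  choose I hI using fun c : ClassGroup (𝓞 F) ↦ ClassGroup.mk0_surjective c
  have hI0 : ∀ c, (I c : Ideal (𝓞 F)) ≠ 0 := fun c ↦ nonZeroDivisors.ne_zero (I c).2
  let T : Set (Pl F) := ⋃ c, {v | v.asIdeal ∣ (I c : Ideal (𝓞 F))}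
  refine ⟨T, Set.finite_iUnion fun c ↦ Ideal.finite_factors (hI0 c), ClT_of_single fun v ↦ ?_⟩
  have h0 : v.asIdeal ∈ nonZeroDivisors (Ideal (𝓞 F)) := mem_nonZeroDivisors_of_ne_zero v.ne_bot
  let c := (ClassGroup.mk0 ⟨v.asIdeal, h0⟩)⁻¹
  have h1 : ClassGroup.mk0 (⟨v.asIdeal, h0⟩ * I c) = 1 := by
    rw [map_mul, hI, mul_inv_cancel]
  rw [ClassGroup.mk0_eq_one_iff] at h1
  obtain ⟨a, ha⟩ := h1
  have ha' : v.asIdeal * I c = Ideal.span {a} := ha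
  have ha0 : a ≠ 0 := by
    rintro rfl
    rw [Ideal.span_singleton_eq_bot.2 rfl] at ha'
    exact mul_ne_zero v.ne_bot (hI0 c) ha'
  have hF0 : (a : F) ≠ 0 := by simpa using ha0
  have hmem : ∀ J : Ideal (𝓞 F), a ∈ J ↔ v.asIdeal * I c ≤ J := fun J ↦ by
    rw [ha', Ideal.span_singleton_le_iff_mem]
  refine ⟨a, hF0, fun w hw ↦ ?_⟩
  have hwI : ¬ (I c : Ideal (𝓞 F)) ≤ w.asIdeal := fun h ↦
    hw (Set.mem_iUnion.2 ⟨c, Ideal.dvd_iff_le.2 h⟩)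
  split_ifs with h
  · subst h
    have h3 : vl w (a : F) = WithZero.exp (-1) := by
      have e1 : vl w (a : F) = w.intValuation a := w.valuation_of_algebraMap a
      rw [e1]
      have e2 : w.intValuation a ≤ WithZero.exp (-((1 : ℕ) : ℤ)) := by
        rw [w.intValuation_le_pow_iff_mem, pow_one, hmem]
        exact Ideal.mul_le_left.trans le_rfl
      have e3 : ¬ w.intValuation a ≤ WithZero.exp (-((2 : ℕ) : ℤ)) := by
        rw [w.intValuation_le_pow_iff_mem, hmem, pow_two]
        intro h
        have h5 := Ideal.dvd_iff_le.2 h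
        have h6 : w.asIdeal ∣ (I c : Ideal (𝓞 F)) := (mul_dvd_mul_iff_left w.ne_bot).1 h5
        exact hwI (Ideal.dvd_iff_le.1 h6)
      have e0 : w.intValuation a ≠ 0 := w.intValuation_ne_zero a ha0
      rw [← WithZero.exp_log e0, WithZero.exp_le_exp] at e2 e3
      rw [← WithZero.exp_log e0, WithZero.exp_inj]
      push_cast at e2 e3
      omega
    rw [od, h3, WithZero.log_exp]
  · refine (od_eq_zero _ hF0).2 (valuation_eq_one_of_notMem w fun h4 ↦ ?_)
    rw [hmem, w.isPrime.mul_le] at h4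
    rcases h4 with h4 | h4
    · exact h (HeightOneSpectrum.ext (v.isMaximal.eq_of_le w.isPrime.ne_top h4)).symm
    · exact hwI h4

theorem exists_ClT_superset {B : Set (Pl F)} (hB : B.Finite) :
    ∃ T : Set (Pl F), T.Finite ∧ B ⊆ T ∧ ClT T := by
  obtain ⟨T, hT, h⟩ := exists_ClT F
  exact ⟨B ∪ T, hB.union hT, Set.subset_union_left, h.mono Set.subset_union_right⟩

end Places

end

section

open Module

namespace FGAbelian

theorem card_ker_two {A : Type*} [CommGroup A] {e : A} (he : e ≠ 1) (he2 : e ^ 2 = 1)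
    (h : ∀ a : A, a ^ 2 = 1 → a = 1 ∨ a = e) : Nat.card (powMonoidHom (α := A) 2).ker = 2 := by
  rw [Nat.card_eq_two_iff]
  refine ⟨⟨1, by simp⟩, ⟨e, he2⟩, fun h1 ↦ he (congrArg Subtype.val h1).symm, ?_⟩
  ext ⟨x, hx⟩
  simp only [Set.mem_insert_iff, Set.mem_singleton_iff, Set.mem_univ, iff_true]
  rcases h x hx with h | h
  · left; exact Subtype.ext h
  · right; exact Subtype.ext h

/-- Index of the group of norms in a quadratic situation satisfying Hilbert's theorem 90. -/
theorem index_norm_range {A B : Type*} [CommGroup A] [CommGroup B]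
    [Module.Finite ℤ (Additive A)] [Module.Finite ℤ (Additive B)]
    (ι : B →* A) (hι : Function.Injective ι) (N : A →* B) (τ : A →* A)
    (hιN : ∀ a, ι (N a) = a * τ a) (hNι : ∀ b, N (ι b) = b ^ 2) (hτ : ∀ a, τ (τ a) = a)
    (h90 : ∀ y, N y = 1 → ∃ z, y = z / τ z) (hfix : ∀ z, τ z = z → ∃ b, z = ι b)
    {e : B} (he : e ≠ 1) (he2 : e ^ 2 = 1) (htor : ∀ a : A, a ^ 2 = 1 → a = 1 ∨ a = ι e) :
    N.range.index * 2 ^ rk A = 2 ^ (2 * rk B) := by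
  have hNτ : ∀ a, N (τ a) = N a := fun a ↦ hι (by rw [hιN, hιN, hτ, mul_comm])
  have hcB : Nat.card (powMonoidHom (α := B) 2).ker = 2 :=
    card_ker_two he he2 fun a ha ↦ by
      rcases htor (ι a) (by rw [← map_pow, ha, map_one]) with h | h
      · left; exact hι (by simpa using h)
      · right; exact hι h
  have hcK : Nat.card (powMonoidHom (α := N.ker) 2).ker = 2 := by
    refine card_ker_two (e := ⟨ι e, by rw [MonoidHom.mem_ker, hNι, he2]⟩) (fun h ↦ ?_) ?_ ?_
    · exact he (hι (by simpa using congrArg Subtype.val h))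
    · exact Subtype.ext (by simp [← map_pow, he2])
    · rintro ⟨a, ha⟩ h
      rcases htor a (by simpa using congrArg Subtype.val h) with h | h
      · left; exact Subtype.ext h
      · right; exact Subtype.ext h
  have hK := index_range_sq (A := N.ker)
  have hB := index_range_sq (A := B)
  rw [hcB] at hB
  rw [hcK] at hK
  set sB := (powMonoidHom (α := B) 2).range with hsB
  set sK := (powMonoidHom (α := N.ker) 2).range with hsK
  have hle : sB ≤ N.range := by
    rintro _ ⟨b, rfl⟩
    exact ⟨ι b, by simp [hNι]⟩
  have hi := Subgroup.relIndex_mul_index hle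
  let φ : A →* N.ker := MonoidHom.codRestrict
    { toFun := fun z ↦ z / τ z, map_one' := by simp
      map_mul' := fun a b ↦ by simp [mul_div_mul_comm] } N.ker
    fun z ↦ by simp [MonoidHom.mem_ker, hNτ]
  have hφ : ∀ z, (φ z : A) = z / τ z := fun z ↦ rfl
  have hφs : Function.Surjective φ := by
    rintro ⟨y, hy⟩
    obtain ⟨z, hz⟩ := h90 y hy
    exact ⟨z, Subtype.ext hz.symm⟩
  have key : sB.comap N = sK.comap φ := by
    ext z
    rw [Subgroup.mem_comap, Subgroup.mem_comap]
    constructor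
    · rintro ⟨c, hc⟩
      have hc' : N z = c ^ 2 := hc.symm
      refine ⟨⟨z / ι c, by rw [MonoidHom.mem_ker, map_div, hNι, hc', div_self']⟩, Subtype.ext ?_⟩
      have h1 : z * τ z = ι c ^ 2 := by rw [← hιN, hc', map_pow]
      change (z / ι c) ^ 2 = z / τ z
      rw [div_pow, ← h1, pow_two, mul_div_mul_left_eq_div]
    · rintro ⟨⟨y, hy⟩, hyz⟩
      have h1 : y ^ 2 = z / τ z := congrArg Subtype.val hyz
      obtain ⟨t, rfl⟩ := h90 y hy
      obtain ⟨b, hb⟩ := hfix (z / t ^ 2) (by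
        rw [map_div, map_pow]
        rw [div_pow, div_eq_div_iff_mul_eq_mul] at h1
        rw [div_eq_div_iff_mul_eq_mul, mul_comm, h1, mul_comm])
      refine ⟨b * N t, ?_⟩
      change (b * N t) ^ 2 = N z
      rw [div_eq_iff_eq_mul] at hb
      rw [hb, map_mul, hNι, map_pow, mul_pow]
  have h1 : sB.relIndex N.range = sK.index := by
    rw [← Subgroup.index_comap, key, Subgroup.index_comap_of_surjective _ hφs]
  have hsB0 : sB.index ≠ 0 := by rw [hB]; positivity
  have hN0 : N.range.index ≠ 0 := fun h ↦ hsB0 (by rw [← hi, h, mul_zero])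
  have h2 := rk_range_add_ker N
  rw [rk_of_index_ne_zero _ hN0] at h2
  rw [h1, hK, hB] at hi
  have h3 : 2 ^ rk N.ker * N.range.index = 2 ^ rk B := by
    have : (2 ^ rk N.ker * N.range.index) * 2 = 2 ^ rk B * 2 := by rw [← hi]; ring
    omega
  rw [← h2, pow_add, mul_comm, mul_assoc, h3, ← pow_add, two_mul]

end FGAbelian

/-- `M` is the quadratic extension of `F` generated by a square root `u` of the nonsquare `x`,
with conjugation `σ`. -/
structure IsQuad {F M : Type*} [Field F] [Field M] [Algebra F M] (x : F) (u : M)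
    (σ : M ≃ₐ[F] M) : Prop where
  sq : u ^ 2 = algebraMap F M x
  span : ∀ y : M, ∃ p q : F, y = algebraMap F M p + algebraMap F M q * u
  conj : σ u = -u
  not_sq : ¬ IsSquare x

namespace IsQuad

universe u in
theorem exists_isQuad {F : Type u} [Field F] [NumberField F] {x : F} (hx : ¬ IsSquare x) :
    ∃ (M : Type u) (_ : Field M) (_ : NumberField M) (_ : Algebra F M) (u : M)
      (σ : M ≃ₐ[F] M), IsQuad x u σ := by
  have hirr : Irreducible (Polynomial.X ^ 2 - Polynomial.C x) := by
    rw [X_pow_sub_C_irreducible_iff_of_prime Nat.prime_two]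
    intro b hb
    exact hx ⟨b, by rw [← hb, pow_two]⟩
  have : Fact (Irreducible (Polynomial.X ^ 2 - Polynomial.C x)) := ⟨hirr⟩
  let M := AdjoinRoot (Polynomial.X ^ 2 - Polynomial.C x)
  have hmon : (Polynomial.X ^ 2 - Polynomial.C x).Monic := Polynomial.monic_X_pow_sub_C x two_ne_zero
  have hfin : Module.Finite F M := hmon.finite_adjoinRoot
  have hnf : NumberField M := NumberField.of_module_finite F M
  let u : M := AdjoinRoot.root _
  have hu : u ^ 2 = algebraMap F M x := by
    have := AdjoinRoot.eval₂_root (Polynomial.X ^ 2 - Polynomial.C x)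
    simp only [Polynomial.eval₂_sub, Polynomial.eval₂_pow, Polynomial.eval₂_X,
      Polynomial.eval₂_C, sub_eq_zero] at this
    exact this
  have hsp : ∀ y : M, ∃ p q : F, y = algebraMap F M p + algebraMap F M q * u := by
    intro y
    obtain ⟨g, rfl⟩ := AdjoinRoot.mk_surjective y
    induction g using Polynomial.induction_on' with
    | add f g hf hg =>
      obtain ⟨p, q, h⟩ := hf
      obtain ⟨p', q', h'⟩ := hg
      refine ⟨p + p', q + q', ?_⟩
      rw [map_add, h, h', map_add, map_add]
      ring
    | monomial n a =>
      have h1 : AdjoinRoot.mk (Polynomial.X ^ 2 - Polynomial.C x) (Polynomial.monomial n a)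
          = algebraMap F M a * u ^ n := by
        rw [← Polynomial.C_mul_X_pow_eq_monomial, map_mul, map_pow, AdjoinRoot.mk_X]
        rfl
      rw [h1]
      rcases Nat.even_or_odd' n with ⟨k, rfl | rfl⟩
      · exact ⟨a * x ^ k, 0, by rw [pow_mul, hu]; simp⟩
      · exact ⟨0, a * x ^ k, by
          have : u ^ (2 * k + 1) = (u ^ 2) ^ k * u := by ring
          rw [this, hu]; simp; ring⟩
  let σ₀ : M →ₐ[F] M := AdjoinRoot.liftAlgHom _ (Algebra.ofId F M) (-u) (by
    simp only [Polynomial.eval₂_sub, Polynomial.eval₂_pow, Polynomial.eval₂_X,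
      Polynomial.eval₂_C, neg_sq, hu]
    exact sub_self _)
  have hσ : σ₀ u = -u := AdjoinRoot.liftAlgHom_root _ _ _ _
  have hσσ : σ₀.comp σ₀ = AlgHom.id F M := by
    refine AlgHom.ext fun y ↦ ?_
    obtain ⟨p, q, rfl⟩ := hsp y
    simp only [AlgHom.comp_apply, map_add, map_mul, AlgHom.commutes, hσ, map_neg, AlgHom.id_apply]
    rw [neg_neg u]
  refine ⟨M, inferInstance, hnf, inferInstance, u, AlgEquiv.ofAlgHom σ₀ σ₀ hσσ hσσ,
    hu, hsp, hσ, hx⟩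

end IsQuad

end

section

open IsDedekindDomain NumberField LocalSquare Places Module

theorem Places.vl_comapPl_equiv {M M' : Type*} [Field M] [NumberField M] [Field M']
    [NumberField M'] (σ : M ≃+* M') (w : Pl M') (x : M) :
    vl (comapPl (σ : M →+* M') w) x = vl w (σ x) := by
  set v := comapPl (σ : M →+* M') w with hv
  by_cases hx : x = 0
  · simp [hx]
  have hσ : ∀ {y : M}, y ≠ 0 → σ y ≠ 0 := fun hy ↦ (map_ne_zero_iff σ σ.injective).2 hy
  obtain ⟨π, hπ0, hπ⟩ := exists_od_eq v (-1)
  have h1 : ∀ y : M, y ≠ 0 → od w (σ y) = -od v y * od w (σ π) := fun y hy ↦ by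
    have h2 : vl v y = vl v (π ^ (-od v y)) := by
      rw [← od_eq v hy (zpow_ne_zero _ hπ0), od_zpow, hπ]
      ring
    have h3 : vl w (σ y) = vl w (σ (π ^ (-od v y))) := (comapPl_eq (σ : M →+* M') w).1 h2
    rwa [← od_eq w (hσ hy) (hσ (zpow_ne_zero _ hπ0)), map_zpow₀, od_zpow] at h3
  have h4 : od w (σ π) = -1 := by
    obtain ⟨t, ht0, ht⟩ := exists_od_eq w 1
    have h5 := h1 (σ.symm t) ((map_ne_zero_iff σ.symm σ.symm.injective).2 ht0)
    rw [σ.apply_symm_apply, ht] at h5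
    have h6 : vl w (σ π) < vl w (σ 1) := by
      refine (comapPl_lt (σ : M →+* M') w).1 ?_
      rw [← hv, ← od_lt v hπ0 one_ne_zero, hπ]
      simp
    rw [← od_lt w (hσ hπ0) (hσ one_ne_zero)] at h6
    simp only [map_one, od_one] at h6
    rcases Int.eq_one_or_neg_one_of_mul_eq_one' h5.symm with h | h <;> omega
  have h7 := h1 x hx
  rw [h4] at h7
  rw [← exp_od v hx, ← exp_od w (hσ hx), h7]
  simp

namespace IsQuad

section Field

variable {F M : Type*} [Field F] [Field M] [Algebra F M] {x : F} {u : M} {σ : M ≃ₐ[F] M}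

theorem ne_zero (h : IsQuad x u σ) : x ≠ 0 := fun hx ↦ h.not_sq (hx ▸ IsSquare.zero)

theorem u_ne_zero (h : IsQuad x u σ) : u ≠ 0 := fun hu ↦ by
  have := h.sq
  rw [hu, zero_pow two_ne_zero, eq_comm, map_eq_zero] at this
  exact h.ne_zero this

theorem u_notMem (h : IsQuad x u σ) (p : F) : algebraMap F M p ≠ u := fun hp ↦ by
  have := h.sq
  rw [← hp, ← map_pow] at this
  exact h.not_sq ⟨p, by rw [← (algebraMap F M).injective this, pow_two]⟩

theorem apply_add (h : IsQuad x u σ) (p q : F) :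
    σ (algebraMap F M p + algebraMap F M q * u) = algebraMap F M p - algebraMap F M q * u := by
  simp [h.conj, sub_eq_add_neg]

theorem apply_apply (h : IsQuad x u σ) (y : M) : σ (σ y) = y := by
  obtain ⟨p, q, rfl⟩ := h.span y
  simp [h.conj]

theorem indep (h : IsQuad x u σ) {p q : F} (hpq : algebraMap F M p + algebraMap F M q * u = 0) :
    p = 0 ∧ q = 0 := by
  by_cases hq : q = 0
  · subst hq
    simpa using hpq
  · refine (h.u_notMem (-p / q) ?_).elim
    have : algebraMap F M q ≠ 0 := by simpa using hq
    rw [map_div₀, div_eq_iff this, map_neg]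
    linear_combination -hpq

theorem exists_of_fixed [CharZero F] (h : IsQuad x u σ) {y : M} (hy : σ y = y) :
    ∃ p : F, y = algebraMap F M p := by
  obtain ⟨p, q, rfl⟩ := h.span y
  rw [h.apply_add] at hy
  have : CharZero M := charZero_of_injective_algebraMap (algebraMap F M).injective
  have h2 : algebraMap F M q * u = 0 := by
    have : (2 : M) * (algebraMap F M q * u) = 0 := by linear_combination -hy
    simpa using this
  exact ⟨p, by rw [h2, add_zero]⟩

theorem mul_conj (h : IsQuad x u σ) (p q : F) :
    (algebraMap F M p + algebraMap F M q * u) * σ (algebraMap F M p + algebraMap F M q * u) =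
      algebraMap F M (p ^ 2 - x * q ^ 2) := by
  rw [h.apply_add, map_sub, map_mul, map_pow, map_pow, ← h.sq]
  ring

/-- The norm of a quadratic extension. -/
noncomputable def nrm (h : IsQuad x u σ) : M →* F where
  toFun y := (h.span y).choose ^ 2 - x * (h.span y).choose_spec.choose ^ 2
  map_one' := by
    apply (algebraMap F M).injective
    rw [← h.mul_conj, ← (h.span 1).choose_spec.choose_spec]
    simp
  map_mul' y z := by
    apply (algebraMap F M).injective
    rw [map_mul, ← h.mul_conj, ← h.mul_conj, ← h.mul_conj, ← (h.span y).choose_spec.choose_spec,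
      ← (h.span z).choose_spec.choose_spec, ← (h.span (y * z)).choose_spec.choose_spec, map_mul]
    ring

theorem algebraMap_nrm (h : IsQuad x u σ) (y : M) : algebraMap F M (h.nrm y) = y * σ y := by
  change algebraMap F M ((h.span y).choose ^ 2 - x * (h.span y).choose_spec.choose ^ 2) = _
  rw [← h.mul_conj, ← (h.span y).choose_spec.choose_spec]

theorem nrm_eq (h : IsQuad x u σ) (p q : F) :
    h.nrm (algebraMap F M p + algebraMap F M q * u) = p ^ 2 - x * q ^ 2 := by
  apply (algebraMap F M).injective
  rw [h.algebraMap_nrm, h.mul_conj]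

/-- Hilbert's theorem 90 -/
theorem exists_eq_div (h : IsQuad x u σ) [CharZero F] {y : M} (hy : y * σ y = 1) :
    ∃ z : M, z ≠ 0 ∧ y = z / σ z := by
  by_cases h1 : y = -1
  · refine ⟨u, h.u_ne_zero, ?_⟩
    rw [h.conj, h1, div_neg, div_self h.u_ne_zero]
  · have h0 : 1 + y ≠ 0 := fun h0 ↦ h1 (by linear_combination h0)
    refine ⟨1 + y, h0, ?_⟩
    have : σ (1 + y) ≠ 0 := (map_ne_zero_iff σ σ.injective).2 h0
    rw [eq_div_iff this, map_add, map_one]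
    linear_combination hy

theorem finiteDimensional (h : IsQuad x u σ) : FiniteDimensional F M := by
  refine Module.Finite.of_surjective (Fintype.linearCombination F ![(1 : M), u]) fun y ↦ ?_
  obtain ⟨p, q, rfl⟩ := h.span y
  exact ⟨![p, q], by simp [Fintype.linearCombination_apply, Algebra.smul_def]⟩

theorem finrank_eq (h : IsQuad x u σ) : finrank F M = 2 := by
  have hli : LinearIndependent F ![(1 : M), u] := by
    rw [LinearIndependent.pair_iff]
    intro s t hst
    refine h.indep ?_
    simpa [Algebra.smul_def] using hst
  have hsp : ⊤ ≤ Submodule.span F (Set.range ![(1 : M), u]) := by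
    rintro y -
    obtain ⟨p, q, rfl⟩ := h.span y
    rw [Matrix.range_cons, Matrix.range_cons, Matrix.range_empty, Set.union_empty,
      Set.singleton_union, Submodule.mem_span_pair]
    exact ⟨p, q, by simp [Algebra.smul_def]⟩
  simpa using finrank_eq_card_basis (Basis.mk hli hsp)

theorem isGalois [CharZero F] (h : IsQuad x u σ) : IsGalois F M := by
  have := h.finiteDimensional
  refine IsGalois.of_fixedField_eq_bot F M (eq_bot_iff.2 fun y hy ↦ ?_)
  obtain ⟨p, hp⟩ := h.exists_of_fixed (hy ⟨σ, trivial⟩)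
  exact ⟨p, hp.symm⟩

end Field

section NumberField

variable {F M : Type*} [Field F] [Field M] [NumberField F] [NumberField M] [Algebra F M]
  {x : F} {u : M} {σ : M ≃ₐ[F] M}

theorem comapPl_conj (_ : IsQuad x u σ) (w : Pl M) :
    comapPl (algebraMap F M) (comapPl (σ : M →+* M) w) = comapPl (algebraMap F M) w :=
  comapPl_algEquiv σ w

/-- Primes at which `x` is a local square split. -/
theorem comapPl_conj_ne (h : IsQuad x u σ) {w : Pl M}
    (hx : LS (vl (comapPl (algebraMap F M) w)) x) : comapPl (σ : M →+* M) w ≠ w := by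
  intro hw
  obtain ⟨z, hz0, hz, hz'⟩ := hx.exists_eq
  rw [map_mul, ← hz, ← map_mul, comapPl_lt] at hz'
  set Z := algebraMap F M z with hZ
  have hZ0 : Z ≠ 0 := by simpa [hZ] using hz0
  have h1 : vl w ((u - Z) * (u + Z)) < vl w (4 * Z ^ 2) := by
    convert hz' using 2
    · rw [map_sub, map_pow, ← h.sq]; ring
    · rw [map_mul, map_pow, map_ofNat]
  have h2 : vl w (u - Z) = vl w (u + Z) := by
    have h3 := vl_comapPl_equiv (σ : M ≃+* M) w (u - Z)
    rw [show comapPl ((σ : M ≃+* M) : M →+* M) w = w from hw] at h3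
    rw [h3, ← Valuation.map_neg]
    congr 1
    change -σ (u - Z) = u + Z
    rw [map_sub, h.conj, AlgEquiv.commutes]
    ring
  rw [map_mul, h2, ← pow_two, ← map_pow] at h1
  have h6 : vl w (u + Z) < vl w (2 * Z) := by
    have h7 : (4 * Z ^ 2) = (2 * Z) ^ 2 := by ring
    rw [h7, map_pow, map_pow] at h1
    exact lt_of_pow_lt_pow_left₀ 2 zero_le h1
  have h8 : vl w (2 * Z) ≤ vl w (u + Z) := by
    have : 2 * Z = (u + Z) - (u - Z) := by ring
    rw [this]
    refine ((vl w).map_sub _ _).trans ?_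
    rw [h2, max_self]
  exact absurd h8 h6.not_ge

/-- At a prime unramified in `M`, elements of `M` fixed in absolute value by the conjugation have
the absolute value of an element of `F`. -/
theorem exists_vl_eq (h : IsQuad x u σ) (v : Pl F) (h2 : vl v 2 = 1) (hx : Even (od v x)) (y : M) :
    ∃ f : F, ∀ w : Pl M, comapPl (algebraMap F M) w = v → vl w y = vl w (σ y) →
      vl w y = vl w (algebraMap F M f) := by
  obtain ⟨g, hg0, hg⟩ := exists_eq_sq_of_even_od v h.ne_zero hx
  have hG0 : algebraMap F M g ≠ 0 := by simpa using hg0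
  obtain ⟨p, q, rfl⟩ := h.span y
  refine ⟨if vl v p ≤ vl v (q * g) then q * g else p, ?_⟩
  rintro w rfl hw
  rw [h.apply_add] at hw
  have hw2 : vl w 2 = 1 := by
    have := (comapPl_eq_one (algebraMap F M) w).1 h2
    rwa [show algebraMap F M 2 = 2 from map_ofNat _ 2] at this
  have hu : vl w u = vl w (algebraMap F M g) := by
    have := (comapPl_eq (algebraMap F M) w).1 hg
    rw [map_pow, ← h.sq, map_pow, map_pow] at this
    exact (pow_left_inj₀ zero_le zero_le two_ne_zero).1 this
  have hqg : vl w (algebraMap F M q * u) = vl w (algebraMap F M (q * g)) := by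
    rw [map_mul, hu, ← map_mul, map_mul (algebraMap F M)]
  set P := algebraMap F M p
  set Q := algebraMap F M q * u
  have h3 : vl w P ≤ vl w (P + Q) := by
    have : vl w P = vl w (2 * P) := by rw [(vl w).map_mul, hw2, one_mul]
    rw [this, show 2 * P = (P + Q) + (P - Q) by ring]
    exact ((vl w).map_add _ _).trans (by rw [← hw, max_self])
  have h4 : vl w Q ≤ vl w (P + Q) := by
    have : vl w Q = vl w (2 * Q) := by rw [(vl w).map_mul 2 Q, hw2, one_mul]
    rw [this, show 2 * Q = (P + Q) - (P - Q) by ring]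
    exact ((vl w).map_sub _ _).trans (by rw [← hw, max_self])
  have h5 := (vl w).map_add P Q
  split_ifs with hc
  · rw [comapPl_le, ← hqg] at hc
    rw [← hqg]
    exact le_antisymm (h5.trans (by simp [P, hc])) h4
  · rw [not_le, comapPl_lt, ← hqg] at hc
    exact le_antisymm (h5.trans (by simp [P, hc.le])) h3

end NumberField

end IsQuad

end

section

open IsDedekindDomain NumberField LocalSquare Places Module FGAbelian

namespace Places

/-- The group of global norms from the quadratic extension given by `x`. -/
def nmGroup {F : Type*} [Field F] (x : F) : Subgroup Fˣ where
  carrier := {b | ∃ p q : F, (b : F) = p ^ 2 - x * q ^ 2}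
  one_mem' := ⟨1, 0, by simp⟩
  mul_mem' := by
    rintro a b ⟨p, q, h⟩ ⟨p', q', h'⟩
    exact ⟨p * p' + x * q * q', p * q' + q * p', by rw [Units.val_mul, h, h']; ring⟩
  inv_mem' := by
    rintro b ⟨p, q, h⟩
    refine ⟨p / b, q / b, ?_⟩
    have : (b : F) ≠ 0 := b.ne_zero
    rw [Units.val_inv_eq_inv_val]
    field_simp
    exact h

theorem mem_nmGroup {F : Type*} [Field F] {x : F} {b : Fˣ} :
    b ∈ nmGroup x ↔ ∃ p q : F, (b : F) = p ^ 2 - x * q ^ 2 := Iff.rfl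

variable {F : Type*} [Field F] [NumberField F]

theorem nmGroup_le_anGroup (v : Pl F) (x : F) : nmGroup x ≤ anGroup (vl v) x :=
  fun b ⟨_, _, h⟩ ↦ AN.of_eq (v := vl v) b.ne_zero h

/-- The set `T` of primes is large enough for the quadratic extension given by `x`, which moreover
splits at the even and at the infinite primes. -/
structure Large (x : F) (T : Set (Pl F)) : Prop where
  finite : T.Finite
  clT : ClT T
  two : ∀ v, vl v 2 ≠ 1 → v ∈ T
  LS_two : ∀ v, vl v 2 ≠ 1 → LS (vl v) x
  even : ∀ v ∉ T, Even (od v x)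
  pos : ∀ φ : F →+* ℝ, 0 < φ x

end Places

namespace IsQuad

variable {F M : Type*} [Field F] [Field M] [NumberField F] [NumberField M] [Algebra F M]
  {x : F} {u : M} {σ : M ≃ₐ[F] M}

theorem card_infinitePlace (h : IsQuad x u σ) (hpos : ∀ φ : F →+* ℝ, 0 < φ x) :
    Fintype.card (InfinitePlace M) = 2 * Fintype.card (InfinitePlace F) := by
  have := h.isGalois
  have hun : IsUnramifiedAtInfinitePlaces F M := by
    refine ⟨fun w ↦ ?_⟩
    rw [InfinitePlace.isUnramified_iff, or_iff_not_imp_right, InfinitePlace.not_isComplex_iff_isReal]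
    intro hr
    rw [← InfinitePlace.mk_embedding w, InfinitePlace.comap_mk, InfinitePlace.isReal_mk_iff] at hr
    rw [InfinitePlace.isReal_iff]
    set ψ := w.embedding
    have h0 := hpos hr.embedding
    have h1 : ψ u ^ 2 = ((hr.embedding x : ℝ) : ℂ) := by
      rw [hr.coe_embedding_apply, ← map_pow, h.sq]
      rfl
    obtain ⟨s, hs⟩ : ∃ s : ℝ, ψ u = s := by
      have h2 : ψ u ^ 2 = ((√(hr.embedding x) : ℝ) : ℂ) ^ 2 := by
        rw [h1, ← Complex.ofReal_pow, Real.sq_sqrt h0.le]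
      rcases sq_eq_sq_iff_eq_or_eq_neg.1 h2 with h3 | h3
      · exact ⟨_, h3⟩
      · exact ⟨-√(hr.embedding x), by rw [h3]; simp⟩
    rw [ComplexEmbedding.isReal_iff]
    ext y
    obtain ⟨p, q, rfl⟩ := h.span y
    have h4 : ∀ p : F, (starRingEnd ℂ) (ψ (algebraMap F M p)) = ψ (algebraMap F M p) := fun p ↦
      congrArg (fun f : F →+* ℂ ↦ f p) (ComplexEmbedding.isReal_iff.1 hr)
    simp [ComplexEmbedding.conjugate_coe_eq, h4, hs]
  rw [IsUnramifiedAtInfinitePlaces.card_infinitePlace F M, h.finrank_eq, mul_comm]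

theorem ncard_preimage (h : IsQuad x u σ) {T : Set (Pl F)} (hT : T.Finite) :
    2 * T.ncard ≤ (comapPl (algebraMap F M) ⁻¹' T).ncard + {v ∈ T | ¬ LS (vl v) x}.ncard := by
  classical
  choose g hg using exists_comapPl_eq (algebraMap F M)
  set S := {v ∈ T | LS (vl v) x} with hS
  have hSP : S.ncard + {v ∈ T | ¬ LS (vl v) x}.ncard = T.ncard := by
    rw [← Set.ncard_union_eq ?_ (hT.subset (Set.sep_subset _ _)) (hT.subset (Set.sep_subset _ _))]
    · congr 1
      ext v
      simp only [Set.mem_union, Set.mem_ofPred_eq]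
      tauto
    · rw [Set.disjoint_left]
      exact fun v hv hv' ↦ hv'.2 hv.2
  have hginj : Function.Injective g := fun a b hab ↦ by rw [← hg a, hab, hg]
  have hginj' : Function.Injective fun v ↦ comapPl (σ : M →+* M) (g v) := fun a b hab ↦ by
    have := congrArg (comapPl (algebraMap F M)) hab
    simpa only [h.comapPl_conj, hg] using this
  have h1 : g '' T ∪ (fun v ↦ comapPl (σ : M →+* M) (g v)) '' S ⊆
      comapPl (algebraMap F M) ⁻¹' T := by
    rintro _ (⟨v, hv, rfl⟩ | ⟨v, hv, rfl⟩)
    · simpa [hg] using hv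
    · simpa [h.comapPl_conj, hg] using hv.1
  have h2 := Set.ncard_le_ncard h1 (finite_preimage _ hT)
  rw [Set.ncard_union_eq ?_ (hT.image _) ((hT.subset (Set.sep_subset _ _)).image _),
    Set.ncard_image_of_injective _ hginj, Set.ncard_image_of_injective _ hginj'] at h2
  · change T.ncard + S.ncard ≤ _ at h2
    omega
  · rw [Set.disjoint_left]
    rintro _ ⟨v, hv, rfl⟩ ⟨v', hv', h3⟩
    have h4 : v' = v := by
      have := congrArg (comapPl (algebraMap F M)) h3
      simpa only [h.comapPl_conj, hg] using this
    subst h4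
    exact h.comapPl_conj_ne (w := g v') (by rw [hg]; exact hv'.2) h3

omit [NumberField F] in
theorem vl_conj (_ : IsQuad x u σ) (w : Pl M) (y : M) :
    vl w (σ y) = vl (comapPl (σ : M →+* M) w) y :=
  (vl_comapPl_equiv (σ : M ≃+* M) w y).symm

theorem exists_sU_eq_div (h : IsQuad x u σ) {T : Set (Pl F)} (hT : Large x T) {y : M}
    (hy : ∀ w ∉ comapPl (algebraMap F M) ⁻¹' T, vl w y = 1) (hy1 : y * σ y = 1) :
    ∃ z : M, z ≠ 0 ∧ (∀ w ∉ comapPl (algebraMap F M) ⁻¹' T, vl w z = 1) ∧ y = z / σ z := by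
  classical
  obtain ⟨z, hz0, hz⟩ := h.exists_eq_div hy1
  have hσz0 : σ z ≠ 0 := (map_ne_zero_iff σ σ.injective).2 hz0
  have h1 : ∀ v : Pl F, ∃ f : F, v ∉ T → f ≠ 0 ∧
      ∀ w : Pl M, comapPl (algebraMap F M) w = v → vl w z = vl w (algebraMap F M f) := by
    intro v
    by_cases hv : v ∈ T
    · exact ⟨0, fun h ↦ (h hv).elim⟩
    obtain ⟨f, hf⟩ := h.exists_vl_eq v (by_contra fun h2 ↦ hv (hT.two v h2)) (hT.even v hv) z
    have h2 : ∀ w : Pl M, comapPl (algebraMap F M) w = v →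
        vl w z = vl w (algebraMap F M f) := by
      intro w hw
      refine hf w hw ?_
      have h3 := hy w (by rw [Set.mem_preimage, hw]; exact hv)
      rw [hz, map_div₀, div_eq_one_iff_eq (vl_ne_zero w hσz0)] at h3
      exact h3
    obtain ⟨w, hw⟩ := exists_comapPl_eq (algebraMap F M) v
    refine ⟨f, fun _ ↦ ⟨?_, h2⟩⟩
    rintro rfl
    have := h2 w hw
    rw [map_zero, map_zero] at this
    exact vl_ne_zero w hz0 this
  choose f hf using h1
  obtain ⟨t, ht0, ht⟩ := hT.clT (fun v ↦ if v ∈ T then 0 else od v (f v)) (by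
    refine ((finite_ne_one hz0).image (comapPl (algebraMap F M))).subset fun v hv ↦ ?_
    obtain ⟨w, hw⟩ := exists_comapPl_eq (algebraMap F M) v
    refine ⟨w, ?_, hw⟩
    rw [Function.mem_support] at hv
    by_cases hvT : v ∈ T
    · simp [hvT] at hv
    rw [if_neg hvT, Ne, od_eq_zero v (hf v hvT).1] at hv
    rw [Set.mem_ofPred_eq, (hf v hvT).2 w hw]
    rw [← hw] at hv ⊢
    exact fun h ↦ hv ((comapPl_eq_one (algebraMap F M) w).2 h))
  have ht0' : algebraMap F M t ≠ 0 := by simpa using ht0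
  refine ⟨z / algebraMap F M t, div_ne_zero hz0 ht0', fun w hw ↦ ?_, ?_⟩
  · have hv : comapPl (algebraMap F M) w ∉ T := hw
    rw [map_div₀, div_eq_one_iff_eq (vl_ne_zero w ht0'), (hf _ hv).2 w rfl, ← comapPl_eq,
      ← od_eq _ (hf _ hv).1 ht0, ht _ hv, if_neg hv]
  · rw [map_div₀, AlgEquiv.commutes, div_div_div_cancel_right₀ ht0', hz]

theorem index_nmGroup_le (h : IsQuad x u σ) {T : Set (Pl F)} (hT : Large x T) :
    ((nmGroup x).subgroupOf (sU T)).index ≠ 0 ∧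
      ((nmGroup x).subgroupOf (sU T)).index * 2 ≤ 2 ^ {v ∈ T | ¬ LS (vl v) x}.ncard := by
  set T' := comapPl (algebraMap F M) ⁻¹' T with hT'
  have hT'f : T'.Finite := finite_preimage _ hT.finite
  have := finite_sU hT.finite
  have := finite_sU hT'f
  have hT'iff : ∀ w : Pl M, w ∈ T' ↔ comapPl (algebraMap F M) w ∈ T := fun _ ↦ Iff.rfl
  let ι : sU T →* sU T' := ((Units.map (algebraMap F M : F →* M)).comp (sU T).subtype).codRestrict
    (sU T') fun b w hw ↦ (comapPl_eq_one (algebraMap F M) w).1 (b.2 _ hw)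
  have hσT' : ∀ w, comapPl (σ : M →+* M) w ∈ T' ↔ w ∈ T' := fun w ↦ by
    rw [hT'iff, hT'iff, h.comapPl_conj]
  have hσ1 : ∀ a : sU T', ∀ w ∉ T', vl w (σ ((a : Mˣ) : M)) = 1 := fun a w hw ↦ by
    rw [h.vl_conj]
    exact a.2 _ (mt (hσT' w).1 hw)
  let τ : sU T' →* sU T' := ((Units.map (σ : M →* M)).comp (sU T').subtype).codRestrict
    (sU T') fun a w hw ↦ hσ1 a w hw
  let N : sU T' →* sU T := ((Units.map h.nrm).comp (sU T').subtype).codRestrict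
    (sU T) fun a v hv ↦ by
      obtain ⟨w, rfl⟩ := exists_comapPl_eq (algebraMap F M) v
      rw [comapPl_eq_one]
      change vl w (algebraMap F M (h.nrm ((a : Mˣ) : M))) = 1
      rw [h.algebraMap_nrm, map_mul, hσ1 a w hv, a.2 w hv, one_mul]
  have hext : ∀ {a b : sU T'}, (((a : Mˣ) : M)) = ((b : Mˣ) : M) → a = b :=
    fun h ↦ Subtype.ext (Units.ext h)
  have hι : Function.Injective ι := fun a b hab ↦ by
    have : algebraMap F M ((a : Fˣ) : F) = algebraMap F M ((b : Fˣ) : F) :=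
      congrArg (fun c : sU T' ↦ ((c : Mˣ) : M)) hab
    exact Subtype.ext (Units.ext ((algebraMap F M).injective this))
  have hne : (⟨-1, neg_one_mem_sU T⟩ : sU T) ≠ 1 := fun h1 ↦ by
    have h2 : ((-1 : Fˣ) : F) = ((1 : Fˣ) : F) := congrArg (fun c : sU T ↦ ((c : Fˣ) : F)) h1
    rw [Units.val_neg, Units.val_one] at h2
    exact two_ne_zero (α := F) (by linear_combination -h2)
  have key := index_norm_range ι hι N τ
    (fun a ↦ hext (h.algebraMap_nrm _))
    (fun b ↦ hι (hext (by
      change algebraMap F M (h.nrm (algebraMap F M ((b : Fˣ) : F))) =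
        algebraMap F M (((b : Fˣ) : F) ^ 2)
      rw [h.algebraMap_nrm, AlgEquiv.commutes, ← map_mul, pow_two])))
    (fun a ↦ hext (h.apply_apply _))
    (fun y hy ↦ by
      have hy1 : ((y : Mˣ) : M) * σ ((y : Mˣ) : M) = 1 := by
        rw [← h.algebraMap_nrm]
        have : h.nrm ((y : Mˣ) : M) = 1 := congrArg (fun c : sU T ↦ ((c : Fˣ) : F)) hy
        rw [this, map_one]
      obtain ⟨z, hz0, hz, hyz⟩ := h.exists_sU_eq_div hT y.2 hy1
      exact ⟨⟨Units.mk0 z hz0, hz⟩, hext (by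
        rw [hyz]
        change z / σ z = ((Units.mk0 z hz0 / Units.map (σ : M →* M) (Units.mk0 z hz0) : Mˣ) : M)
        rw [Units.val_div_eq_div_val]
        rfl)⟩)
    (fun z hz ↦ by
      obtain ⟨p, hp⟩ := h.exists_of_fixed (congrArg (fun c : sU T' ↦ ((c : Mˣ) : M)) hz)
      have hp0 : p ≠ 0 := by
        rintro rfl
        exact (z : Mˣ).ne_zero (hp.trans (map_zero _))
      refine ⟨⟨Units.mk0 p hp0, fun v hv ↦ ?_⟩, hext hp⟩
      obtain ⟨w, rfl⟩ := exists_comapPl_eq (algebraMap F M) v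
      rw [comapPl_eq_one]
      change vl w (algebraMap F M p) = 1
      rw [← hp]
      exact z.2 w hv)
    hne (Subtype.ext (by simp)) (fun a ha ↦ by
      have : ((a : Mˣ) : M) ^ 2 = 1 := congrArg (fun c : sU T' ↦ ((c : Mˣ) : M)) ha
      rcases sq_eq_one_iff.1 this with h1 | h1
      · left; exact hext h1
      · right
        refine hext ?_
        rw [h1]
        change -1 = algebraMap F M ((-1 : Fˣ) : F)
        simp)
  have hle : N.range ≤ (nmGroup x).subgroupOf (sU T) := by
    rintro _ ⟨a, rfl⟩
    obtain ⟨p, q, hpq⟩ := h.span ((a : Mˣ) : M)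
    exact ⟨p, q, by rw [← h.nrm_eq, ← hpq]; rfl⟩
  have hdvd := Subgroup.index_dvd_of_le hle
  have hrF : Units.rank F + 1 = Fintype.card (InfinitePlace F) :=
    Nat.sub_add_cancel Fintype.card_pos
  have hrM : Units.rank M + 1 = Fintype.card (InfinitePlace M) :=
    Nat.sub_add_cancel Fintype.card_pos
  rw [h.card_infinitePlace hT.pos] at hrM
  have hcard := h.ncard_preimage hT.finite
  rw [← hT'] at hcard
  rw [rk_sU hT.finite, rk_sU hT'f] at key
  have hN0 : N.range.index ≠ 0 := by
    intro h0
    rw [h0, zero_mul] at key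
    exact pow_ne_zero _ two_ne_zero key.symm
  refine ⟨fun h0 ↦ hN0 (by simpa [h0] using hdvd), ?_⟩
  refine (Nat.mul_le_mul_right 2 (Nat.le_of_dvd (Nat.pos_of_ne_zero hN0) hdvd)).trans ?_
  have h5 : N.range.index * 2 * 2 ^ (T'.ncard + Units.rank M) ≤
      2 ^ {v ∈ T | ¬ LS (vl v) x}.ncard * 2 ^ (T'.ncard + Units.rank M) := by
    rw [mul_right_comm, key, ← pow_add, ← pow_succ]
    refine Nat.pow_le_pow_right two_pos ?_
    omega
  exact Nat.le_of_mul_le_mul_right h5 (by positivity)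

end IsQuad

namespace Places

variable {F : Type*} [Field F] [NumberField F]

theorem Large.index_nmGroup {x : F} (hx : ¬ IsSquare x) {T : Set (Pl F)} (hT : Large x T) :
    ((nmGroup x).subgroupOf (sU T)).index ≠ 0 ∧
      ((nmGroup x).subgroupOf (sU T)).index * 2 ≤ 2 ^ {v ∈ T | ¬ LS (vl v) x}.ncard := by
  obtain ⟨M, _, _, _, u, σ, h⟩ := IsQuad.exists_isQuad hx
  exact h.index_nmGroup_le hT

/-- The map to local norm residue groups. -/
noncomputable def locMap (x : F) (T P : Set (Pl F)) : sU T →* ((v : P) → Fˣ ⧸ anGroup (vl v.1) x) :=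
  MonoidHom.pi fun v ↦ (QuotientGroup.mk' (anGroup (vl v.1) x)).comp (sU T).subtype

theorem mem_ker_locMap {x : F} {T P : Set (Pl F)} {b : sU T} :
    b ∈ (locMap x T P).ker ↔ ∀ v ∈ P, AN (vl v) x ((b : Fˣ) : F) := by
  rw [MonoidHom.mem_ker, funext_iff]
  refine ⟨fun h v hv ↦ (QuotientGroup.eq_one_iff _).1 (h ⟨v, hv⟩), fun h v ↦ ?_⟩
  exact (QuotientGroup.eq_one_iff _).2 (h v.1 v.2)

theorem card_range_locMap_le {x : F} (hx : ¬ IsSquare x) {T : Set (Pl F)} (hT : Large x T)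
    (P : Set (Pl F)) :
    (locMap x T P).ker.index ≠ 0 ∧
      (locMap x T P).ker.index ∣ ((nmGroup x).subgroupOf (sU T)).index := by
  have h := hT.index_nmGroup hx
  have hle : (nmGroup x).subgroupOf (sU T) ≤ (locMap x T P).ker := fun b hb ↦
    mem_ker_locMap.2 fun v _ ↦ nmGroup_le_anGroup v x hb
  have hd := Subgroup.index_dvd_of_le hle
  exact ⟨fun h0 ↦ h.1 (by simpa [h0] using hd), hd⟩

/-- First inequality: local norm residues at the nonsplit primes of `T` cannot be prescribed
independently by `T`-units. -/
theorem Large.not_forall_exists {x : F} (hx : ¬ IsSquare x) {T : Set (Pl F)} (hT : Large x T)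
    (e : Pl F → sU T) (h1 : ∀ v ∈ T, ¬ LS (vl v) x → ¬ AN (vl v) x ((e v : Fˣ) : F))
    (h2 : ∀ v ∈ T, ¬ LS (vl v) x → ∀ v' ∈ T, ¬ LS (vl v') x → v' ≠ v →
      AN (vl v') x ((e v : Fˣ) : F)) : False := by
  classical
  set P := {v ∈ T | ¬ LS (vl v) x} with hP
  have hPf : P.Finite := hT.finite.subset (Set.sep_subset _ _)
  obtain ⟨h0, hd⟩ := card_range_locMap_le hx hT P
  obtain ⟨h3, h4⟩ := hT.index_nmGroup hx
  have h5 := Nat.le_of_dvd (Nat.pos_of_ne_zero h3) hd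
  set Φ := locMap x T P
  have hfin : Finite (sU T ⧸ Φ.ker) := Subgroup.index_ne_zero_iff_finite.1 h0
  have hinj : Function.Injective
      fun A : Finset P ↦ (QuotientGroup.mk (∏ v ∈ A, e v) : sU T ⧸ Φ.ker) := by
    intro A B hAB
    have h6 : Φ (∏ v ∈ A, e v) = Φ (∏ v ∈ B, e v) := by
      have := QuotientGroup.eq.1 hAB
      rw [MonoidHom.mem_ker, map_mul, map_inv] at this
      exact inv_mul_eq_one.1 this
    have h7 : ∀ (A : Finset P) (v : P), Φ (∏ v ∈ A, e v) v = 1 ↔ v ∉ A := by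
      intro A v
      have h8 : ∀ v' : P, v' ≠ v → Φ (e v') v = 1 := fun v' hv' ↦
        (QuotientGroup.eq_one_iff _).2 (h2 v' v'.2.1 v'.2.2 v v.2.1 v.2.2
          fun h ↦ hv' (Subtype.ext h.symm))
      have h9 : Φ (e v) v ≠ 1 := fun h ↦ h1 v v.2.1 v.2.2 ((QuotientGroup.eq_one_iff _).1 h)
      rw [map_prod, Finset.prod_apply]
      by_cases hvA : v ∈ A
      · rw [Finset.prod_eq_single_of_mem v hvA fun b _ hb ↦ h8 b hb]
        simp [h9, hvA]
      · rw [Finset.prod_eq_one fun b hb ↦ h8 b fun h ↦ hvA (h ▸ hb)]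
        simp [hvA]
    ext v
    have h10 := (h7 A v).symm.trans ((by rw [h6]) : _ ↔ _) |>.trans (h7 B v)
    exact not_iff_not.1 h10
  have : Fintype P := hPf.fintype
  have h11 := Nat.card_le_card_of_injective _ hinj
  rw [Nat.card_eq_fintype_card, Fintype.card_finset, ← Nat.card_eq_fintype_card,
    Nat.card_coe_set_eq, ← Subgroup.index_eq_card] at h11
  have : 0 < 2 ^ P.ncard := by positivity
  rw [← hP] at h4
  omega

end Places

end

section

open IsDedekindDomain NumberField LocalSquare Module

namespace Places

variable {F : Type*} [Field F] [NumberField F]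

/-- Infinitely many primes of a progression are nonsquares in a given number field. -/
theorem exists_prime_not_isSquare (F : Type*) [Field F] [NumberField F] {k : ℕ} (hk : k ≠ 0) :
    ∃ p : ℕ, p.Prime ∧ p ≡ 1 [MOD k] ∧ ¬ IsSquare (p : F) := by
  by_contra! hcon
  have hinf := Nat.infinite_setOfPred_prime_modEq_one hk
  have hfin : Finite (IntermediateField ℚ F) :=
    Field.finite_intermediateField_of_exists_primitive_element ℚ F
      (Field.exists_primitive_element ℚ F)
  have hsq : ∀ p : {p : ℕ | p.Prime ∧ p ≡ 1 [MOD k]}, ∃ s : F, s ^ 2 = (p : ℕ) := fun p ↦ by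
    obtain ⟨s, hs⟩ := hcon p p.2.1 p.2.2
    exact ⟨s, by rw [hs, pow_two]⟩
  choose s hs using hsq
  have := hinf.to_subtype
  obtain ⟨p, q, hpq, h⟩ := Finite.exists_ne_map_eq_of_infinite
    fun p : {p : ℕ | p.Prime ∧ p ≡ 1 [MOD k]} ↦ IntermediateField.adjoin ℚ {s p}
  have h1 : s p ∈ IntermediateField.adjoin ℚ {s q} := by
    rw [← h]
    exact IntermediateField.mem_adjoin_simple_self ℚ _
  have h2 : s p ∈ Algebra.adjoin ℚ {s q} := by
    rw [← IntermediateField.adjoin_simple_toSubalgebra_of_isAlgebraic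
      (Algebra.IsAlgebraic.isAlgebraic _)]
    exact h1
  have hlin : ∀ y ∈ Algebra.adjoin ℚ {s q}, ∃ a b : ℚ, y = a + b * s q := fun y hy ↦ by
    induction hy using Algebra.adjoin_induction with
    | mem x hx => exact ⟨0, 1, by rw [Set.mem_singleton_iff.1 hx]; simp⟩
    | algebraMap r => exact ⟨r, 0, by simp⟩
    | add x y _ _ h1 h2 =>
      obtain ⟨a, b, rfl⟩ := h1
      obtain ⟨c, d, rfl⟩ := h2
      exact ⟨a + c, b + d, by push_cast; ring⟩
    | mul x y _ _ h1 h2 =>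
      obtain ⟨a, b, rfl⟩ := h1
      obtain ⟨c, d, rfl⟩ := h2
      refine ⟨a * c + b * d * (q : ℕ), a * d + b * c, ?_⟩
      push_cast
      rw [← hs q]
      ring
  obtain ⟨a, b, hab⟩ := hlin _ h2
  have hirr : ∀ p : {p : ℕ | p.Prime ∧ p ≡ 1 [MOD k]}, ∀ c : ℚ, c ^ 2 ≠ (p : ℕ) := fun p c hc ↦ by
    have h5 : padicValRat (p : ℕ) (c ^ 2) = padicValRat (p : ℕ) ((p : ℕ) : ℚ) := by rw [hc]
    have : Fact (p : ℕ).Prime := ⟨p.2.1⟩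
    have hc0 : c ≠ 0 := by
      rintro rfl
      have : ((p : ℕ) : ℚ) ≠ 0 := by exact_mod_cast p.2.1.ne_zero
      exact this (by rw [← hc]; simp)
    rw [padicValRat.pow, padicValRat.self p.2.1.one_lt] at h5
    push_cast at h5
    omega
  have h3 : ((p : ℕ) : F) = a ^ 2 + b ^ 2 * (q : ℕ) + 2 * a * b * s q := by
    rw [← hs p, ← hs q, hab]
    ring
  have hq : ∀ c : ℚ, s q ≠ c := fun c hc ↦ hirr q c (by
    have := hs q
    rw [hc] at this
    exact_mod_cast this)
  by_cases hab0 : a * b = 0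
  · rcases mul_eq_zero.1 hab0 with rfl | rfl
    · have h4 : ((p : ℕ) : ℚ) = b ^ 2 * (q : ℕ) := by
        have : ((p : ℕ) : F) = b ^ 2 * (q : ℕ) := by rw [h3]; simp
        exact_mod_cast this
      have : Fact (p : ℕ).Prime := ⟨p.2.1⟩
      have hb0 : b ≠ 0 := by
        rintro rfl
        have : ((p : ℕ) : ℚ) ≠ 0 := by exact_mod_cast p.2.1.ne_zero
        exact this (by rw [h4]; simp)
      have hq0 : ((q : ℕ) : ℚ) ≠ 0 := by exact_mod_cast q.2.1.ne_zero
      have h5 : padicValRat (p : ℕ) ((p : ℕ) : ℚ) = padicValRat (p : ℕ) (b ^ 2 * (q : ℕ)) := by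
        rw [← h4]
      have hnd : ¬ (p : ℕ) ∣ q := fun hd ↦
        hpq (Subtype.ext ((Nat.prime_dvd_prime_iff_eq p.2.1 q.2.1).1 hd))
      rw [padicValRat.mul (pow_ne_zero _ hb0) hq0, padicValRat.pow,
        padicValRat.self p.2.1.one_lt, padicValRat.of_nat, padicValNat.eq_zero_of_not_dvd hnd] at h5
      push_cast at h5
      omega
    · refine hirr p a ?_
      have : ((p : ℕ) : F) = a ^ 2 := by rw [h3]; simp
      exact_mod_cast this.symm
  · refine hq (((p : ℕ) - a ^ 2 - b ^ 2 * (q : ℕ)) / (2 * (a * b))) ?_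
    have hab' : (2 : F) * (a * b) ≠ 0 := by
      refine mul_ne_zero two_ne_zero ?_
      exact_mod_cast hab0
    push_cast
    rw [eq_div_iff hab', h3]
    ring

theorem val_eight (v : Pl F) : vl v 8 = vl v 2 * vl v 4 := by
  rw [← map_mul]
  norm_num

theorem finite_two (F : Type*) [Field F] [NumberField F] : {v : Pl F | vl v 2 ≠ 1}.Finite :=
  finite_ne_one two_ne_zero

theorem vl_two_lt (v : Pl F) (h : vl v 2 ≠ 1) : vl v 2 < 1 :=
  lt_of_le_of_ne (val_two_le_one (vl v)) h

/-- Integers congruent to `1` modulo `8` are local squares at the even primes. -/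
theorem LS_intCast_of_even (v : Pl F) (h : vl v 2 ≠ 1) {m : ℤ} (hm : 8 ∣ m - 1) :
    LS (vl v) (m : F) := by
  obtain ⟨k, hk⟩ := hm
  have h2 := vl_two_lt v h
  have h20 : vl v 2 ≠ 0 := vl_ne_zero v two_ne_zero
  have h40 : 0 < vl v 4 := vl_pos v (by norm_num : (4 : F) ≠ 0)
  have h1 : (m : F) = 1 + 8 * k := by
    have : (m : F) - 1 = 8 * k := by exact_mod_cast congrArg (Int.cast (R := F)) hk
    linear_combination this
  refine (LS.one (v := vl v)).congr ?_
  rw [h1, mul_one, show (1 : F) - (1 + 8 * k) = -(8 * k) by ring, Valuation.map_neg, map_mul,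
    val_eight]
  calc vl v 2 * vl v 4 * vl v k ≤ vl v 2 * vl v 4 :=
        mul_le_of_le_one_right zero_le (val_intCast_le_one (vl v) k)
    _ < 1 * vl v 4 := mul_lt_mul_of_pos_right h2 h40
    _ = vl v 4 := one_mul _

theorem exists_not_LS_prime {p : ℕ} (hp : p.Prime) (hp8 : p ≡ 1 [MOD 8])
    (hsq : ¬ IsSquare (p : F)) {B : Set (Pl F)} (hB : B.Finite) :
    ∃ v ∉ B, ¬ LS (vl v) (p : F) := by
  classical
  by_contra! hcon
  have hp0 : (p : F) ≠ 0 := by exact_mod_cast hp.ne_zero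
  have hLS2 : ∀ v : Pl F, vl v 2 ≠ 1 → LS (vl v) (p : F) := fun v hv ↦ by
    have := LS_intCast_of_even v hv (m := p) (by
      have := (Nat.modEq_iff_dvd.1 hp8.symm)
      exact_mod_cast this)
    exact_mod_cast this
  set P := {v : Pl F | ¬ LS (vl v) (p : F)} with hP
  have hPB : P ⊆ B := fun v hv ↦ by_contra fun h ↦ hv (hcon v h)
  have hPf : P.Finite := hB.subset hPB
  have hP2 : ∀ v ∈ P, vl v 2 = 1 := fun v hv ↦ by_contra fun h ↦ hv (hLS2 v h)
  have h1 : ∀ v : Pl F, ∃ b : F, v ∈ P → b ≠ 0 ∧ ¬ AN (vl v) (p : F) b := fun v ↦ by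
    by_cases hv : v ∈ P
    · obtain ⟨b, hb⟩ := exists_not_AN v (hP2 v hv) hp0 hv
      exact ⟨b, fun _ ↦ hb⟩
    · exact ⟨0, fun h ↦ (hv h).elim⟩
  choose b hb using h1
  have h2 : ∀ v : Pl F, ∃ e : Fˣ, v ∈ P → ¬ AN (vl v) (p : F) e ∧
      ∀ v' ∈ P, v' ≠ v → AN (vl v') (p : F) e := fun v ↦ by
    by_cases hv : v ∈ P
    · obtain ⟨y, hy⟩ := exists_approx hPf (fun w ↦ if w = v then b v else 1)
        (fun w ↦ if w = v then b v else 1) (fun w _ ↦ by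
          split_ifs
          · exact (hb v hv).1
          · exact one_ne_zero)
      have hyv : vl v (y - b v) < vl v (b v) := by simpa using hy v hv
      have hy0 : y ≠ 0 := by
        rintro rfl
        rw [zero_sub, Valuation.map_neg] at hyv
        exact lt_irrefl _ hyv
      refine ⟨Units.mk0 y hy0, fun _ ↦ ⟨fun h ↦ ?_, fun v' hv' hne ↦ ?_⟩⟩
      · rw [Units.val_mk0] at h
        refine (hb v hv).2 (h.congr ?_)
        have : vl v y = vl v (b v) := val_eq_of_sub_lt
          (by rwa [Valuation.map_sub_swap] at hyv)
        rwa [this]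
      · have h3 := hy v' hv'
        rw [if_neg hne, map_one] at h3
        refine AN.of_LS ((LS.one (v := vl v')).congr ?_)
        rwa [Units.val_mk0, mul_one, val_four, hP2 v' hv', one_mul, Valuation.map_sub_swap]
    · exact ⟨1, fun h ↦ (hv h).elim⟩
  choose e he using h2
  obtain ⟨T, hTf, hBT, hcl⟩ := exists_ClT_superset (F := F)
    (B := (B ∪ {v | vl v 2 ≠ 1} ∪ {v | vl v (p : F) ≠ 1}) ∪ ⋃ v ∈ P, {w | vl w (e v : F) ≠ 1})
    (((hB.union (finite_two F)).union (finite_ne_one hp0)).union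
      (hPf.biUnion fun v _ ↦ finite_ne_one (e v).ne_zero))
  have hT : Large (p : F) T :=
    { finite := hTf
      clT := hcl
      two := fun v hv ↦ hBT (Or.inl (Or.inl (Or.inr hv)))
      LS_two := hLS2
      even := fun v hv ↦ by
        have : vl v (p : F) = 1 := by_contra fun h ↦ hv (hBT (Or.inl (Or.inr h)))
        rw [(od_eq_zero v hp0).2 this]
        exact Even.zero
      pos := fun φ ↦ by
        rw [map_natCast]
        exact_mod_cast hp.pos }
  have heT : ∀ v ∈ P, e v ∈ sU T := fun v hv w hw ↦ by
    by_contra h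
    exact hw (hBT (Or.inr (Set.mem_biUnion hv h)))
  refine hT.not_forall_exists hsq (fun v ↦ if hv : v ∈ P then ⟨e v, heT v hv⟩ else 1)
    (fun v _ hv ↦ ?_) (fun v _ hv w _ hw hne ↦ ?_)
  · rw [dif_pos (show v ∈ P from hv)]
    exact (he v hv).1
  · rw [dif_pos (show v ∈ P from hv)]
    exact (he v hv).2 w hw hne

/-- A nonsquare is a local nonsquare at infinitely many primes. -/
theorem exists_not_LS {x : F} (hx : ¬ IsSquare x) {B : Set (Pl F)} (hB : B.Finite) :
    ∃ v ∉ B, ¬ LS (vl v) x := by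
  by_contra! hcon
  obtain ⟨p, hp, hp8, hpF⟩ := exists_prime_not_isSquare F (k := 8) (by norm_num)
  have hx0 : x ≠ 0 := fun h ↦ hx (h ▸ IsSquare.zero)
  have hp0 : (p : F) ≠ 0 := by exact_mod_cast hp.ne_zero
  by_cases hxp : IsSquare (x * p)
  · obtain ⟨v, hv, hv'⟩ := exists_not_LS_prime hp hp8 hpF hB
    exact hv' ((hcon v hv).of_mul_self (LS.of_isSquare (mul_ne_zero hx0 hp0) hxp))
  · obtain ⟨M, _, _, _, u, σ, h⟩ := IsQuad.exists_isQuad hxp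
    have hpM : ¬ IsSquare (p : M) := by
      rintro ⟨y, hy⟩
      obtain ⟨a, b, rfl⟩ := h.span y
      have h1 : algebraMap F M (p - a ^ 2 - b ^ 2 * (x * p)) + algebraMap F M (-(2 * a * b)) * u
          = 0 := by
        simp only [map_sub, map_mul, map_pow, map_neg, map_ofNat, map_natCast]
        have := h.sq
        simp only [map_mul, map_natCast] at this
        linear_combination hy + (algebraMap F M b) ^ 2 * this
      obtain ⟨h2, h3⟩ := h.indep h1
      have h4 : a = 0 ∨ b = 0 := by simpa using h3
      rcases h4 with rfl | rfl
      · have hb0 : b ≠ 0 := by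
          rintro rfl
          exact hp0 (by simpa using h2)
        have h5 : p * (1 - b ^ 2 * x) = 0 := by linear_combination h2
        have h6 : 1 - b ^ 2 * x = 0 := by simpa [hp0] using h5
        refine hx ⟨b⁻¹, ?_⟩
        field_simp
        linear_combination -h6
      · exact hpF ⟨a, by linear_combination h2⟩
    obtain ⟨w, hw, hw'⟩ := exists_not_LS_prime hp hp8 hpM (finite_preimage (algebraMap F M) hB)
    refine hw' ?_
    have h1 : LS (vl w) (algebraMap F M x) := LS_of_comapPl _ w (hcon _ hw)
    refine h1.of_mul_self (LS.of_isSquare ?_ ⟨u, ?_⟩)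
    · have : (p : M) ≠ 0 := by exact_mod_cast hp.ne_zero
      simpa [hx0] using this
    · rw [← pow_two, h.sq, map_mul, map_natCast]

theorem _root_.IsQuad.isSquare_or {M : Type*} [Field M] [Algebra F M] {x : F} {u : M}
    {σ : M ≃ₐ[F] M} (h : IsQuad x u σ) {e : F} (he : IsSquare (algebraMap F M e)) :
    IsSquare e ∨ ∃ c : F, e = x * c ^ 2 := by
  obtain ⟨y, hy⟩ := he
  obtain ⟨a, b, rfl⟩ := h.span y
  have h1 : algebraMap F M (e - a ^ 2 - b ^ 2 * x) + algebraMap F M (-(2 * a * b)) * u = 0 := by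
    simp only [map_sub, map_mul, map_pow, map_neg, map_ofNat]
    rw [hy]
    linear_combination (algebraMap F M b) ^ 2 * h.sq
  obtain ⟨h2, h3⟩ := h.indep h1
  have h4 : a = 0 ∨ b = 0 := by simpa using h3
  rcases h4 with rfl | rfl
  · exact Or.inr ⟨b, by linear_combination h2⟩
  · exact Or.inl ⟨a, by linear_combination h2⟩

/-- There are primes which split for `a` and are inert for `e`. -/
theorem exists_LS_not_LS {a e : F} (ha0 : a ≠ 0) (he : ¬ IsSquare e)
    (hae : ∀ c : F, e ≠ a * c ^ 2) {B : Set (Pl F)} (hB : B.Finite) :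
    ∃ v ∉ B, LS (vl v) a ∧ ¬ LS (vl v) e := by
  by_cases ha : IsSquare a
  · obtain ⟨v, hv, hv'⟩ := exists_not_LS he hB
    exact ⟨v, hv, LS.of_isSquare ha0 ha, hv'⟩
  obtain ⟨M, _, _, _, u, σ, h⟩ := IsQuad.exists_isQuad ha
  have he0 : e ≠ 0 := fun h ↦ he (h ▸ IsSquare.zero)
  have heM : ¬ IsSquare (algebraMap F M e) := fun hs ↦ by
    rcases h.isSquare_or hs with h1 | ⟨c, hc⟩
    · exact he h1
    · exact hae c hc
  obtain ⟨w, hw, hw'⟩ := exists_not_LS heM (finite_preimage (algebraMap F M)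
    (((hB.union (finite_two F)).union (finite_ne_one ha0)).union (finite_ne_one he0)))
  rw [Set.mem_preimage] at hw
  simp only [Set.mem_union, not_or, Set.mem_ofPred_eq, not_not] at hw
  obtain ⟨⟨⟨hwB, hw2⟩, hwa⟩, hwe⟩ := hw
  have h3 : ¬ LS (vl (comapPl (algebraMap F M) w)) e := fun h ↦ hw' (LS_of_comapPl _ _ h)
  refine ⟨_, hwB, by_contra fun h4 ↦ ?_, h3⟩
  have h5 := LS_of_comapPl _ _ (LS_mul_of_not_LS _ hw2 hwa hwe h4 h3)
  rw [map_mul] at h5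
  refine hw' (LS.of_mul_self (LS.of_isSquare (by simpa using ha0) ⟨u, ?_⟩) h5)
  rw [← h.sq, pow_two]

end Places

end

section

open IsDedekindDomain NumberField LocalSquare Module

namespace Places

variable {F : Type*} [Field F] [NumberField F]

/-- The number of even primes is at most the degree. -/
theorem ncard_two_le (F : Type*) [Field F] [NumberField F] :
    {v : Pl F | vl v 2 ≠ 1}.ncard ≤ finrank ℚ F := by
  classical
  have hf := finite_two F
  set P := hf.toFinset.image fun v ↦ v.asIdeal with hP
  have hcard : P.card = {v : Pl F | vl v 2 ≠ 1}.ncard := by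
    rw [hP, Finset.card_image_of_injective _ fun v w h ↦ HeightOneSpectrum.ext h,
      Set.ncard_eq_toFinset_card _ hf]
  have hdvd : ∏ I ∈ P, I ∣ Ideal.span {(2 : 𝓞 F)} := by
    refine Finset.prod_primes_dvd _ (fun I hI ↦ ?_) fun I hI ↦ ?_
    · obtain ⟨v, -, rfl⟩ := Finset.mem_image.1 hI
      exact v.prime
    · obtain ⟨v, hv, rfl⟩ := Finset.mem_image.1 hI
      rw [Ideal.dvd_span_singleton]
      by_contra h
      have := valuation_eq_one_of_notMem v h
      rw [show ((2 : 𝓞 F) : F) = 2 from map_ofNat (algebraMap (𝓞 F) F) 2] at this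
      exact (hf.mem_toFinset.1 hv) this
  have h1 : Ideal.absNorm (Ideal.span {(2 : 𝓞 F)}) = 2 ^ finrank ℚ F := by
    rw [Ideal.absNorm_span_singleton, show (2 : 𝓞 F) = algebraMap ℤ (𝓞 F) 2 from (map_ofNat _ 2).symm,
      Algebra.norm_algebraMap, RingOfIntegers.rank, Int.natAbs_pow]
    rfl
  have h2 : 2 ^ P.card ≤ Ideal.absNorm (∏ I ∈ P, I) := by
    rw [map_prod, ← Finset.prod_const]
    refine Finset.prod_le_prod' fun I hI ↦ ?_
    obtain ⟨v, -, rfl⟩ := Finset.mem_image.1 hI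
    have h3 : Ideal.absNorm v.asIdeal ≠ 0 := Ideal.absNorm_eq_zero_iff.not.2 v.ne_bot
    have h4 : Ideal.absNorm v.asIdeal ≠ 1 := Ideal.absNorm_eq_one_iff.not.2 v.isPrime.ne_top
    omega
  have h3 := Nat.le_of_dvd (by rw [h1]; positivity) (Ideal.absNorm_dvd_absNorm_of_le
    (Ideal.dvd_iff_le.1 hdvd))
  rw [h1] at h3
  rw [← hcard]
  exact (Nat.pow_le_pow_iff_right (by norm_num)).1 (h2.trans h3)

/-- The elements which are positive at a given real embedding. -/
def posGroup (φ : F →+* ℝ) : Subgroup Fˣ where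
  carrier := {x | 0 < φ x}
  one_mem' := by simp
  mul_mem' := fun ha hb ↦ by
    simp only [Set.mem_ofPred_eq, Units.val_mul, map_mul] at *
    exact mul_pos ha hb
  inv_mem' := fun ha ↦ by
    simp only [Set.mem_ofPred_eq, Units.val_inv_eq_inv_val, map_inv₀] at *
    exact inv_pos.2 ha

theorem index_posGroup (φ : F →+* ℝ) : (posGroup φ).index ≠ 0 ∧ (posGroup φ).index ≤ 2 := by
  classical
  have h := index_le_of_cover (posGroup φ) {1, -1} fun x ↦ by
    have : φ (x : F) ≠ 0 := by simp
    rcases this.lt_or_gt with h | h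
    · exact ⟨-1, by simp, show 0 < φ _ by simpa using h⟩
    · exact ⟨1, by simp, show 0 < φ _ by simpa using h⟩
  exact ⟨h.1, h.2.trans Finset.card_le_two⟩

/-- Split primes at which the units are independent. -/
theorem exists_split_set {a : F} (ha0 : a ≠ 0) {T : Set (Pl F)} (hT : T.Finite)
    (h2 : ∀ v, vl v 2 ≠ 1 → v ∈ T) (haT : ∀ v ∉ T, vl v a = 1) (k : ℕ)
    (hk : k + 1 ≤ T.ncard + Fintype.card (InfinitePlace F)) :
    ∃ W : Finset (Pl F), W.card = k ∧ (∀ w ∈ W, w ∉ T ∧ LS (vl w) a) ∧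
      ∀ S : Set (Pl F), ∃ ε ∈ sU T, ∀ w ∈ W, LS (vl w) ((ε : Fˣ) : F) ↔ w ∈ S := by
  classical
  induction k with
  | zero => exact ⟨∅, rfl, by simp, fun S ↦ ⟨1, one_mem _, by simp⟩⟩
  | succ k ih =>
    obtain ⟨W, hW, hWT, hS⟩ := ih (by omega)
    have hW2 : ∀ w ∈ W, vl w 2 = 1 := fun w hw ↦ by_contra fun h ↦ (hWT w hw).1 (h2 w h)
    choose ε hε hεS using hS
    have hunit : ∀ x y : Fˣ, x ∈ sU T → y ∈ sU T → ∀ w, w ∉ T → ¬ LS (vl w) (x : F) →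
        ¬ LS (vl w) (y : F) → LS (vl w) ((x * y : Fˣ) : F) := fun x y hx hy w hw hx' hy' ↦ by
      rw [Units.val_mul]
      exact LS_mul_of_not_LS w (by_contra fun h ↦ hw (h2 w h)) (hx w hw) (hy w hw) hx' hy'
    let a' : sU T := ⟨Units.mk0 a ha0, haT⟩
    obtain ⟨e, heW, he1, he2⟩ : ∃ e : sU T, (∀ w ∈ W, LS (vl w) ((e : Fˣ) : F)) ∧
        e ∉ (powMonoidHom (α := sU T) 2).range ∧ e * a' ∉ (powMonoidHom (α := sU T) 2).range := by
      by_contra! hcon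
      have h3 := (index_le_of_cover (powMonoidHom (α := sU T) 2).range
        ((W.powerset ×ˢ {1, a'}).image fun p ↦ (⟨ε p.1, hε _⟩ : sU T) * p.2) fun x ↦ by
          have h4 : ∀ w ∈ W, LS (vl w) ((x * ⟨ε (W.filter fun w ↦ LS (vl w) ((x : Fˣ) : F)), hε _⟩ :
              sU T) : Fˣ) := fun w hw ↦ by
            have h5 := hεS (W.filter fun w ↦ LS (vl w) ((x : Fˣ) : F)) w hw
            rw [Finset.mem_coe, Finset.mem_filter, and_iff_right hw] at h5
            by_cases h6 : LS (vl w) ((x : Fˣ) : F)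
            · simpa using h6.mul (h5.2 h6)
            · exact hunit _ _ x.2 (hε _) w (hWT w hw).1 h6 (h5.not.2 h6)
          by_cases h5 : x * ⟨ε (W.filter fun w ↦ LS (vl w) ((x : Fˣ) : F)), hε _⟩ ∈
              (powMonoidHom (α := sU T) 2).range
          · exact ⟨_, Finset.mem_image.2 ⟨(W.filter fun w ↦ LS (vl w) ((x : Fˣ) : F), 1),
              by simp, rfl⟩, by rw [mul_one]; exact h5⟩
          · refine ⟨_, Finset.mem_image.2 ⟨(W.filter fun w ↦ LS (vl w) ((x : Fˣ) : F), a'),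
              by simp, rfl⟩, ?_⟩
            rw [← mul_assoc]
            exact hcon _ h4 h5).2
      rw [index_sq_sU hT] at h3
      have h4 := h3.trans Finset.card_image_le
      rw [Finset.card_product, Finset.card_powerset, hW] at h4
      have h5 := h4.trans (Nat.mul_le_mul_left _ Finset.card_le_two)
      rw [← pow_succ, Nat.pow_le_pow_iff_right (by norm_num)] at h5
      omega
    have hsqrt : ∀ (c : F) (x : sU T), ((x : Fˣ) : F) = c ^ 2 → x ∈ (powMonoidHom (α := sU T) 2).range :=
      fun c x hc ↦ by
        have hc0 : c ≠ 0 := by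
          rintro rfl
          exact (x : Fˣ).ne_zero (by rw [hc]; simp)
        refine ⟨⟨Units.mk0 c hc0, fun v hv ↦ ?_⟩, Subtype.ext (Units.ext hc.symm)⟩
        have := x.2 v hv
        rw [hc, map_pow] at this
        exact (pow_eq_one_iff_of_nonneg zero_le (by norm_num)).1 this
    obtain ⟨w, hw, hwa, hwe⟩ := exists_LS_not_LS (a := a) (e := ((e : Fˣ) : F)) ha0
      (fun ⟨c, hc⟩ ↦ he1 (hsqrt c e (by rw [hc, pow_two])))
      (fun c hc ↦ he2 (hsqrt (a * c) (e * a') (by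
        change ((e : Fˣ) : F) * a = _
        rw [hc]
        ring))) (hT.union W.finite_toSet)
    rw [Set.mem_union, not_or, Finset.mem_coe] at hw
    refine ⟨insert w W, by rw [Finset.card_insert_of_notMem hw.2, hW], ?_, fun S ↦ ?_⟩
    · intro v hv
      rcases Finset.mem_insert.1 hv with rfl | hv
      · exact ⟨hw.1, hwa⟩
      · exact hWT v hv
    · by_cases h3 : LS (vl w) (ε S : F) ↔ w ∈ S
      · refine ⟨ε S, hε S, fun v hv ↦ ?_⟩
        rcases Finset.mem_insert.1 hv with rfl | hv
        · exact h3
        · exact hεS S v hv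
      · refine ⟨ε S * e, mul_mem (hε S) e.2, fun v hv ↦ ?_⟩
        rcases Finset.mem_insert.1 hv with rfl | hv
        · by_cases h4 : LS (vl v) (ε S : F)
          · have h5 : v ∉ S := fun h ↦ h3 ⟨fun _ ↦ h, fun _ ↦ h4⟩
            refine ⟨fun h6 ↦ (hwe (h4.of_mul_self (by simpa using h6))).elim, fun h ↦ (h5 h).elim⟩
          · have h5 : v ∈ S := by_contra fun h ↦ h3 ⟨fun h' ↦ (h4 h').elim, fun h' ↦ (h h').elim⟩
            exact ⟨fun _ ↦ h5, fun _ ↦ hunit _ _ (hε S) e.2 v hw.1 h4 hwe⟩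
        · rw [← hεS S v hv, Units.val_mul, mul_comm, LS.mul_iff_right (heW v hv)]

/-- Independence of local square classes at a set of split primes. -/
theorem exists_sU_LS {T : Set (Pl F)} (hcl : ClT T) {W : Finset (Pl F)}
    (hW2 : ∀ w ∈ W, vl w 2 = 1) (hWT : ∀ w ∈ W, w ∉ T)
    (hS : ∀ S : Set (Pl F), ∃ ε ∈ sU T, ∀ w ∈ W, LS (vl w) ((ε : Fˣ) : F) ↔ w ∈ S)
    (c : Pl F → F) (hc : ∀ w ∈ W, c w ≠ 0) :
    ∃ e ∈ sU (T ∪ W), ∀ w ∈ W, LS (vl w) ((e : Fˣ) * c w : F) := by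
  classical
  obtain ⟨f, hf0, hf⟩ := hcl (fun w ↦ if w ∈ W then od w (c w) else 0)
    (W.finite_toSet.subset fun w hw ↦ by
      by_contra h
      rw [Finset.mem_coe] at h
      simp [h] at hw)
  obtain ⟨ε, hε, hεS⟩ := hS {w | LS (vl w) (f * c w)}
  refine ⟨ε * Units.mk0 f hf0, mul_mem (sU_mono Set.subset_union_left hε) fun v hv ↦ ?_,
    fun w hw ↦ ?_⟩
  · rw [Set.mem_union, not_or, Finset.mem_coe] at hv
    have := hf v hv.1
    rw [if_neg hv.2] at this
    exact (od_eq_zero v hf0).1 this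
  · have h1 := hεS w hw
    rw [Set.mem_ofPred_eq] at h1
    rw [Units.val_mul, Units.val_mk0, mul_assoc]
    by_cases h2 : LS (vl w) (f * c w)
    · exact (h1.2 h2).mul h2
    · have h3 := hf w (hWT w hw)
      rw [if_pos hw] at h3
      obtain ⟨z, hz0, hz⟩ := exists_eq_sq_of_even_od w (mul_ne_zero hf0 (hc w hw))
        (by rw [od_mul w hf0 (hc w hw), h3]; exact ⟨_, rfl⟩)
      have h4 : f * c w = (f * c w * (z⁻¹) ^ 2) * z ^ 2 := by
        field_simp
      rw [h4, LS.mul_sq_iff hz0] at h2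
      rw [h4, ← mul_assoc, LS.mul_sq_iff hz0]
      refine LS_mul_of_not_LS w (hW2 w hw) (hε w (hWT w hw)) ?_ (fun h ↦ ?_) h2
      · rw [inv_pow, (vl w).map_mul, hz, ← (vl w).map_mul, mul_inv_cancel₀ (pow_ne_zero _ hz0), map_one]
      · have := h1.1 h
        rw [h4, LS.mul_sq_iff hz0] at this
        exact h2 this

/-- The elements which are local squares at `T` and positive. -/
noncomputable def lsPos (T : Set (Pl F)) : Subgroup Fˣ :=
  (⨅ v : T, lsGroup (vl v.1)) ⊓ ⨅ φ : F →+* ℝ, posGroup φ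

theorem mem_lsPos {T : Set (Pl F)} {x : Fˣ} :
    x ∈ lsPos T ↔ (∀ v ∈ T, LS (vl v) (x : F)) ∧ ∀ φ : F →+* ℝ, 0 < φ x := by
  simp only [lsPos, Subgroup.mem_inf, Subgroup.mem_iInf, mem_lsGroup, Subtype.forall]
  rfl

instance : Finite (F →+* ℝ) :=
  Finite.of_injective (fun φ : F →+* ℝ ↦ Complex.ofRealHom.comp φ) fun φ ψ h ↦ by
    ext x
    have := RingHom.congr_fun h x
    simpa using this

theorem card_real_le (F : Type*) [Field F] [NumberField F] :
    Nat.card (F →+* ℝ) ≤ finrank ℚ F := by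
  rw [← Embeddings.card F ℂ, ← Nat.card_eq_fintype_card]
  refine Nat.card_le_card_of_injective (fun φ : F →+* ℝ ↦ Complex.ofRealHom.comp φ) fun φ ψ h ↦ ?_
  ext x
  have := RingHom.congr_fun h x
  simpa using this

theorem index_lsPos {T : Set (Pl F)} (hT : T.Finite) (h2 : ∀ v, vl v 2 ≠ 1 → v ∈ T ∧ IsQ2 v) :
    (lsPos T).index ≠ 0 ∧ (lsPos T).index ≤ 2 ^ (2 * (T.ncard + finrank ℚ F)) := by
  classical
  have := hT.to_subtype
  have := Fintype.ofFinite T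
  have := Fintype.ofFinite (F →+* ℝ)
  have hv : ∀ v : Pl F, (lsGroup (vl v)).index ≠ 0 ∧
      (lsGroup (vl v)).index ≤ 2 ^ (2 + if vl v 2 ≠ 1 then 1 else 0) := fun v ↦ by
    by_cases h : vl v 2 = 1
    · simpa [h] using index_lsGroup_odd v h
    · simpa [h] using index_lsGroup_two v (h2 v h).2
  refine ⟨Subgroup.index_inf_ne_zero (Subgroup.index_iInf_ne_zero fun v ↦ (hv _).1)
    (Subgroup.index_iInf_ne_zero fun v ↦ (index_posGroup _).1), ?_⟩
  have h3 : ∏ v : T, (lsGroup (vl v.1)).index ≤ 2 ^ (2 * T.ncard + finrank ℚ F) := by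
    refine (Finset.prod_le_prod' fun v _ ↦ (hv v.1).2).trans ?_
    rw [Finset.prod_pow_eq_pow_sum, Finset.sum_add_distrib, Finset.sum_const, Finset.card_univ,
      smul_eq_mul, ← Nat.card_eq_fintype_card, Nat.card_coe_set_eq, mul_comm]
    refine Nat.pow_le_pow_right (by norm_num) (Nat.add_le_add_left (le_trans ?_ (ncard_two_le F)) _)
    rw [Finset.sum_boole, Nat.cast_id, ← Set.ncard_coe_finset]
    refine Set.ncard_le_ncard_of_injOn (fun v : T ↦ v.1) (fun v hv ↦ ?_)
      (fun v _ w _ h ↦ Subtype.ext h) (finite_two F)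
    simpa using hv
  have h4 : ∏ φ : F →+* ℝ, (posGroup φ).index ≤ 2 ^ finrank ℚ F := by
    refine (Finset.prod_le_prod' fun φ _ ↦ (index_posGroup φ).2).trans ?_
    rw [Finset.prod_const, Finset.card_univ, ← Nat.card_eq_fintype_card]
    exact Nat.pow_le_pow_right (by norm_num) (card_real_le F)
  calc _ ≤ _ := Subgroup.index_inf_le
    _ ≤ _ := Nat.mul_le_mul ((Subgroup.index_iInf_le _).trans h3)
      ((Subgroup.index_iInf_le _).trans h4)
    _ = _ := by rw [← pow_add]; congr 1; ring

/-- The elements which are local norms at a finite set of primes. -/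
noncomputable def anInf (a : F) (P : Set (Pl F)) : Subgroup Fˣ := ⨅ v : P, anGroup (vl v.1) a

theorem mem_anInf {a : F} {P : Set (Pl F)} {x : Fˣ} :
    x ∈ anInf a P ↔ ∀ v ∈ P, AN (vl v) a (x : F) := by
  simp only [anInf, Subgroup.mem_iInf, mem_anGroup, Subtype.forall]

theorem two_pow_le_index_anInf {a : F} (ha0 : a ≠ 0) {P : Set (Pl F)} (hP : P.Finite)
    (hP2 : ∀ v ∈ P, vl v 2 = 1 ∧ ¬ LS (vl v) a) (h0 : (anInf a P).index ≠ 0) :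
    2 ^ P.ncard ≤ (anInf a P).index := by
  classical
  have : (anInf a P).FiniteIndex := ⟨h0⟩
  have h1 : ∀ v : Pl F, ∃ b : F, b ≠ 0 ∧ (v ∈ P → ¬ AN (vl v) a b) := fun v ↦ by
    by_cases hv : v ∈ P
    · obtain ⟨b, hb0, hb⟩ := exists_not_AN v (hP2 v hv).1 ha0 (hP2 v hv).2
      exact ⟨b, hb0, fun _ ↦ hb⟩
    · exact ⟨1, one_ne_zero, fun h ↦ (hv h).elim⟩
  choose b hb0 hb using h1
  have h2 : ∀ S : Set (Pl F), ∃ y : Fˣ, ∀ v ∈ P, AN (vl v) a (y : F) ↔ v ∉ S := fun S ↦ by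
    obtain ⟨y, hy⟩ := exists_approx (hP.union (Set.finite_empty)) (fun w ↦ if w ∈ S then b w else 1)
        (fun w ↦ if w ∈ S then b w else 1) (fun w _ ↦ by
          split_ifs
          · exact hb0 w
          · exact one_ne_zero)
    have hy' : ∀ v ∈ P, vl v ((if v ∈ S then b v else 1) - y) < vl v (if v ∈ S then b v else 1) :=
      fun v hv ↦ by
        rw [Valuation.map_sub_swap]
        exact hy v (Or.inl hv)
    by_cases hy0 : y = 0
    · refine ⟨1, fun v hv ↦ ?_⟩
      have := hy' v hv
      rw [hy0, sub_zero] at this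
      exact (lt_irrefl _ this).elim
    refine ⟨Units.mk0 y hy0, fun v hv ↦ ?_⟩
    have h3 := hy' v hv
    rw [Units.val_mk0]
    split_ifs at h3 with h4
    · refine ⟨fun h ↦ (hb v hv (h.congr ?_)).elim, fun h ↦ (h h4).elim⟩
      rwa [val_eq_of_sub_lt h3, Valuation.map_sub_swap]
    · refine ⟨fun _ ↦ h4, fun _ ↦ AN.of_LS ((LS.one (v := vl v)).congr ?_)⟩
      rwa [mul_one, val_four, (hP2 v hv).1, one_mul, ← map_one (vl v)]
  choose y hy using h2
  rw [← Set.ncard_powerset _ hP, ← Nat.card_coe_set_eq]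
  refine Nat.card_le_card_of_injective
    (fun S : 𝒫 P ↦ (y S.1 : Fˣ ⧸ anInf a P)) fun S S' h ↦ Subtype.ext (Set.ext fun v ↦ ?_)
  have h3 := mem_anInf.1 (QuotientGroup.eq.1 h)
  by_cases hv : v ∈ P
  · have h4 := h3 v hv
    have h5 := hy S.1 v hv
    have h6 := hy S'.1 v hv
    rw [← not_iff_not, ← h5, ← h6]
    change (y S.1)⁻¹ * y S'.1 ∈ anGroup (vl v) a at h4
    change y S.1 ∈ anGroup (vl v) a ↔ y S'.1 ∈ anGroup (vl v) a
    refine ⟨fun h ↦ ?_, fun h ↦ ?_⟩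
    · simpa using mul_mem h h4
    · simpa using mul_mem h (inv_mem h4)
  · exact ⟨fun h ↦ (hv (S.2 h)).elim, fun h ↦ (hv (S'.2 h)).elim⟩

/-- The Hasse norm theorem for quadratic extensions which split at all even and infinite primes. -/
theorem exists_norm_of_local {a b : F} (hN : Fintype.card (InfinitePlace F) = finrank ℚ F)
    (ha : ¬ IsSquare a) (hpos : ∀ φ : F →+* ℝ, 0 < φ a)
    (h2 : ∀ v : Pl F, vl v 2 ≠ 1 → IsQ2 v ∧ LS (vl v) a) (hb0 : b ≠ 0)
    (hloc : ∀ v : Pl F, vl v 2 = 1 → ¬ LS (vl v) a → AN (vl v) a b) :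
    ∃ p q, b = p ^ 2 - a * q ^ 2 := by
  classical
  have ha0 : a ≠ 0 := fun h ↦ ha (h ▸ IsSquare.zero)
  obtain ⟨T, hTf, hBT, hcl⟩ := exists_ClT_superset (F := F)
    (B := ({v | vl v 2 ≠ 1} ∪ {v | vl v a ≠ 1}) ∪ {v | vl v b ≠ 1})
    (((finite_two F).union (finite_ne_one ha0)).union (finite_ne_one hb0))
  have hT2 : ∀ v, vl v 2 ≠ 1 → v ∈ T := fun v hv ↦ hBT (Or.inl (Or.inl hv))
  have hTa : ∀ v ∉ T, vl v a = 1 := fun v hv ↦ by_contra fun h ↦ hv (hBT (Or.inl (Or.inr h)))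
  have hTb : ∀ v ∉ T, vl v b = 1 := fun v hv ↦ by_contra fun h ↦ hv (hBT (Or.inr h))
  have hdeg : 0 < finrank ℚ F := finrank_pos
  obtain ⟨W, hWc, hW, hS⟩ := exists_split_set ha0 hTf hT2 hTa (T.ncard + finrank ℚ F - 1)
    (by rw [hN]; omega)
  have hW2 : ∀ w ∈ W, vl w 2 = 1 := fun w hw ↦ by_contra fun h ↦ (hW w hw).1 (hT2 w h)
  set T' : Set (Pl F) := T ∪ W with hT'
  have hT'f : T'.Finite := hTf.union W.finite_toSet
  have hT'c : T'.ncard = T.ncard + (T.ncard + finrank ℚ F - 1) := by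
    rw [hT', Set.ncard_union_eq (Set.disjoint_left.2 fun v hv hw ↦ (hW v hw).1 hv) hTf
      W.finite_toSet, Set.ncard_coe_finset, hWc]
  have hcl' : ClT T' := hcl.mono Set.subset_union_left
  have hlarge : Large a T' :=
    { finite := hT'f
      clT := hcl'
      two := fun v hv ↦ Or.inl (hT2 v hv)
      LS_two := fun v hv ↦ (h2 v hv).2
      even := fun v hv ↦ by
        rw [(od_eq_zero v ha0).2 (hTa v fun h ↦ hv (Or.inl h))]
        exact Even.zero
      pos := hpos }
  set P := {v ∈ T' | ¬ LS (vl v) a} with hP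
  have hPT : ∀ v ∈ P, v ∈ T := fun v hv ↦ hv.1.resolve_right fun h ↦ hv.2 (hW v h).2
  have hP2 : ∀ v ∈ P, vl v 2 = 1 := fun v hv ↦ by_contra fun h ↦ hv.2 (h2 v h).2
  obtain ⟨hnm0, hnm⟩ := hlarge.index_nmGroup ha
  have hsq : ∀ x : sU T', (x : Fˣ) ∈ lsPos T → IsSquare ((x : Fˣ) : F) := fun x hx ↦ by
    by_contra hns
    obtain ⟨hx1, hx2⟩ := mem_lsPos.1 hx
    have hlx : Large ((x : Fˣ) : F) T' :=
      { finite := hT'f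
        clT := hcl'
        two := fun v hv ↦ Or.inl (hT2 v hv)
        LS_two := fun v hv ↦ hx1 v (hT2 v hv)
        even := fun v hv ↦ by
          rw [(od_eq_zero v (Units.ne_zero _)).2 (x.2 v hv)]
          exact Even.zero
        pos := hx2 }
    have hmem : ∀ v ∈ T', ¬ LS (vl v) ((x : Fˣ) : F) → v ∈ W := fun v hv hv' ↦
      hv.resolve_left fun h ↦ hv' (hx1 v h)
    have hex : ∀ v : Pl F, ∃ e : sU T', v ∈ T' → ¬ LS (vl v) ((x : Fˣ) : F) →
        ¬ AN (vl v) ((x : Fˣ) : F) ((e : Fˣ) : F) ∧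
        ∀ v' ∈ T', ¬ LS (vl v') ((x : Fˣ) : F) → v' ≠ v →
          AN (vl v') ((x : Fˣ) : F) ((e : Fˣ) : F) := fun v ↦ by
      by_cases hv : v ∈ T' ∧ ¬ LS (vl v) ((x : Fˣ) : F)
      · obtain ⟨c, hc0, hc⟩ := exists_not_AN v (hW2 v (hmem v hv.1 hv.2)) (Units.ne_zero _) hv.2
        obtain ⟨e, he, he'⟩ := exists_sU_LS hcl hW2 (fun w hw ↦ (hW w hw).1) hS
          (fun w ↦ if w = v then c else 1) (fun w _ ↦ by
            split_ifs
            · exact hc0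
            · exact one_ne_zero)
        refine ⟨⟨e, he⟩, fun _ _ ↦ ⟨fun h ↦ hc ?_, fun v' h1 h3 h4 ↦ ?_⟩⟩
        · have := he' v (hmem v hv.1 hv.2)
          rw [if_pos rfl] at this
          exact h.mul_iff_right.1 (AN.of_LS this)
        · have := he' v' (hmem v' h1 h3)
          rw [if_neg h4, mul_one] at this
          exact AN.of_LS this
      · exact ⟨1, fun h h' ↦ (hv ⟨h, h'⟩).elim⟩
    choose e he using hex
    exact hlx.not_forall_exists hns e (fun v hv hv' ↦ (he v hv hv').1)
      fun v hv hv' ↦ (he v hv hv').2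
  obtain ⟨hls0, hls⟩ := index_lsPos hTf fun v hv ↦ ⟨hT2 v hv, (h2 v hv).1⟩
  have h3 : 2 ^ (2 * (T.ncard + finrank ℚ F) - 1) ≤ (lsPos T).relIndex (sU T') := by
    have h4 := index_sq_sU hT'f
    rw [hT'c, hN] at h4
    rw [show 2 * (T.ncard + finrank ℚ F) - 1 =
      T.ncard + (T.ncard + finrank ℚ F - 1) + finrank ℚ F by omega, ← h4]
    refine Nat.le_of_dvd (Nat.pos_of_ne_zero fun h ↦ hls0 (by
        rw [← Subgroup.relIndex_mul_index (le_sup_right : lsPos T ≤ sU T' ⊔ lsPos T),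
          Subgroup.relIndex_sup_right]
        exact mul_eq_zero_of_left h _))
      (Subgroup.index_dvd_of_le fun x hx ↦ ?_)
    obtain ⟨c, hc⟩ := hsq x hx
    have hc0 : c ≠ 0 := by
      rintro rfl
      exact (x : Fˣ).ne_zero (by rw [hc]; simp)
    refine ⟨⟨Units.mk0 c hc0, fun v hv ↦ ?_⟩, Subtype.ext (Units.ext ?_)⟩
    · have := x.2 v hv
      rw [hc, ← pow_two, map_pow] at this
      exact (pow_eq_one_iff_of_nonneg zero_le (by norm_num)).1 this
    · exact (pow_two c).trans hc.symm
  have h4 : (sU T' ⊔ lsPos T).index ≤ 2 := by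
    have h5 := Subgroup.relIndex_mul_index (le_sup_right : lsPos T ≤ sU T' ⊔ lsPos T)
    rw [Subgroup.relIndex_sup_right] at h5
    have h6 := (Nat.mul_le_mul_right (sU T' ⊔ lsPos T).index h3).trans (h5.le.trans hls)
    have h7 : 2 ^ (2 * (T.ncard + finrank ℚ F)) = 2 ^ (2 * (T.ncard + finrank ℚ F) - 1) * 2 := by
      rw [← pow_succ]
      congr 1
      omega
    rw [h7] at h6
    exact Nat.le_of_mul_le_mul_left h6 (by positivity)
  have hle : lsPos T ≤ anInf a P := fun x hx ↦ mem_anInf.2 fun v hv ↦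
    AN.of_LS ((mem_lsPos.1 hx).1 v (hPT v hv))
  have hA0 : (anInf a P).index ≠ 0 := fun h ↦ hls0 (by
    have := Subgroup.index_dvd_of_le hle
    rwa [h, zero_dvd_iff] at this)
  have h5 : (sU T' ⊔ anInf a P).index ≤ 2 := by
    refine le_trans (Nat.le_of_dvd (Nat.pos_of_ne_zero fun h ↦ hls0 ?_)
      (Subgroup.index_dvd_of_le (sup_le_sup_left hle _))) h4
    have := Subgroup.index_dvd_of_le (le_sup_right : lsPos T ≤ sU T' ⊔ lsPos T)
    rwa [h, zero_dvd_iff] at this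
  have h6 : 2 ^ P.ncard ≤ (anInf a P).relIndex (sU T') * 2 := by
    refine (two_pow_le_index_anInf ha0 (hT'f.subset (Set.sep_subset _ _))
      (fun v hv ↦ ⟨hP2 v hv, hv.2⟩) hA0).trans ?_
    rw [← Subgroup.relIndex_mul_index (le_sup_right : anInf a P ≤ sU T' ⊔ anInf a P),
      Subgroup.relIndex_sup_right]
    exact Nat.mul_le_mul_left _ h5
  have h7 : (nmGroup a).relIndex (sU T') ≤ (anInf a P).relIndex (sU T') :=
    Nat.le_of_mul_le_mul_right (hnm.trans h6) two_pos
  have h8 : (nmGroup a).subgroupOf (sU T') ≤ (anInf a P).subgroupOf (sU T') := fun x hx ↦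
    mem_anInf.2 fun v _ ↦ nmGroup_le_anGroup v a hx
  have h9 := Subgroup.relIndex_mul_index h8
  have h10 : ((nmGroup a).subgroupOf (sU T')).relIndex ((anInf a P).subgroupOf (sU T')) = 1 := by
    have h11 : 0 < ((anInf a P).subgroupOf (sU T')).index :=
      Nat.pos_of_ne_zero fun h ↦ hnm0 (by rw [← h9, h, mul_zero])
    have h12 : ((nmGroup a).subgroupOf (sU T')).relIndex ((anInf a P).subgroupOf (sU T')) ≠ 0 :=
      fun h ↦ hnm0 (by rw [← h9, h, zero_mul])
    have h13 := h9.le.trans h7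
    have := Nat.le_of_mul_le_mul_right (h13.trans (one_mul _).symm.le) h11
    omega
  have h11 := Subgroup.relIndex_eq_one.1 h10
  have hbm : (⟨Units.mk0 b hb0, fun v hv ↦ hTb v fun h ↦ hv (Or.inl h)⟩ : sU T') ∈
      (anInf a P).subgroupOf (sU T') :=
    mem_anInf.2 fun v hv ↦ hloc v (hP2 v hv) hv.2
  exact mem_nmGroup.1 (h11 hbm)

end Places

end

section

open Module

namespace TwoCocycle

variable {G A : Type*} [Group G] [CommGroup A] [MulDistribMulAction G A]

/-- The coboundary of a one-cochain. -/
def cobd (β : G → A) (g h : G) : A := β g * g • β h / β (g * h)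

theorem cobd_mul (β γ : G → A) (g h : G) :
    cobd (fun x ↦ β x * γ x) g h = cobd β g h * cobd γ g h := by
  simp only [cobd, smul_mul', div_eq_mul_inv, mul_inv]
  ac_rfl

/-- Two-cocycles. -/
def IsCoc (c : G → G → A) : Prop := ∀ g h k, g • c h k * c g (h * k) = c (g * h) k * c g h

theorem IsCoc.cobd (β : G → A) : IsCoc (cobd β) := fun g h k ↦ by
  simp only [TwoCocycle.cobd, smul_mul', smul_div', mul_smul, mul_assoc]
  simp only [div_eq_mul_inv]
  have : (g • β (h * k))⁻¹ * g • β (h * k) = 1 := inv_mul_cancel _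
  calc _ = β g * g • β h * g • h • β k * ((g • β (h * k))⁻¹ * g • β (h * k)) *
        (β (g * (h * k)))⁻¹ := by ac_rfl
    _ = β g * g • β h * g • h • β k * (β (g * (h * k)))⁻¹ * ((β (g * h))⁻¹ * β (g * h)) := by
        rw [this, inv_mul_cancel, mul_one, mul_one]
    _ = _ := by ac_rfl

theorem IsCoc.div {c d : G → G → A} (hc : IsCoc c) (hd : IsCoc d) :
    IsCoc fun g h ↦ c g h / d g h := fun g h k ↦ by
  have h1 := hc g h k
  have h2 := hd g h k
  rw [smul_div', div_mul_div_comm, h1, h2, div_mul_div_comm]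

theorem mul_mem_of_index_two {H : Subgroup G} (hH : H.index = 2) {g h : G} (hg : g ∉ H)
    (hh : h ∉ H) : g * h ∈ H := by
  by_contra h1
  rw [Subgroup.mul_mem_iff_of_index_two hH] at h1
  exact h1 ⟨fun h ↦ (hg h).elim, fun h ↦ (hh h).elim⟩

open scoped Classical in
/-- A cocycle whose restriction to a subgroup of index two is trivial is inflated. -/
theorem exists_inflated {H : Subgroup G} (hH : H.index = 2)
    (h90 : ∀ f : H → A, (∀ k l : H, f (k * l) = f k * (k : G) • f l) →
      ∃ γ : A, ∀ k : H, f k = (k : G) • γ / γ)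
    {c : G → G → A} (hc : IsCoc c)
    (hy : ∃ y : G → A, ∀ k ∈ H, ∀ l ∈ H, c k l = cobd y k l) :
    ∃ (β : G → A) (b : A), (∀ g : G, g • b = b) ∧
      ∀ g h, c g h = (if g ∈ H ∨ h ∈ H then 1 else b) * cobd β g h := by
  obtain ⟨y, hy⟩ := hy
  obtain ⟨h, hh⟩ : ∃ h, h ∉ H := by
    by_contra! hcon
    rw [(Subgroup.eq_top_iff' H).2 hcon, Subgroup.index_top] at hH
    omega
  have hinv : h⁻¹ ∉ H := fun h' ↦ hh (by simpa using inv_mem h')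
  have hnorm : ∀ k ∈ H, h⁻¹ * k * h ∈ H := fun k hk ↦
    mul_mem_of_index_two hH (fun h' ↦ hinv (by simpa using mul_mem h' (inv_mem hk))) hh
  -- make the cocycle trivial on `H`
  set c1 : G → G → A := fun g k ↦ c g k / cobd y g k with hc1
  have hc1c : IsCoc c1 := hc.div (IsCoc.cobd y)
  have h1 : ∀ k ∈ H, ∀ l ∈ H, c1 k l = 1 := fun k hk l hl ↦ by
    rw [hc1]
    simp only
    rw [hy k hk l hl, div_self']
  have h1one : ∀ g, c1 g 1 = 1 := fun g ↦ by
    have := hc1c g 1 1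
    rw [h1 1 (one_mem _) 1 (one_mem _), smul_one, one_mul, mul_one, mul_one] at this
    exact left_eq_mul.1 this
  -- make it trivial on `G × H`
  set β2 : G → A := fun g ↦ if g ∈ H then 1 else (c1 h (h⁻¹ * g))⁻¹ with hβ2
  set c2 : G → G → A := fun g k ↦ c1 g k / cobd β2 g k with hc2
  have hc2c : IsCoc c2 := hc1c.div (IsCoc.cobd β2)
  have h2 : ∀ k ∈ H, ∀ l ∈ H, c2 k l = 1 := fun k hk l hl ↦ by
    simp [hc2, h1 k hk l hl, cobd, hβ2, hk, hl, mul_mem hk hl]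
  have h2h : ∀ k ∈ H, c2 h k = 1 := fun k hk ↦ by
    have : h * k ∉ H := fun h' ↦ hh (by simpa using mul_mem h' (inv_mem hk))
    simp [hc2, cobd, hβ2, hk, hh, this, h1one]
  have h2g : ∀ g, ∀ k ∈ H, c2 g k = 1 := fun g k hk ↦ by
    by_cases hg : g ∈ H
    · exact h2 g hg k hk
    · have hg' : h⁻¹ * g ∈ H := mul_mem_of_index_two hH hinv hg
      have := hc2c h (h⁻¹ * g) k
      rw [h2 _ hg' k hk, h2h _ hg', h2h _ (mul_mem hg' hk), mul_inv_cancel_left, smul_one, one_mul,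
        mul_one] at this
      exact this.symm
  have h2r : ∀ k ∈ H, ∀ l ∈ H, c2 k (h * l) = c2 k h := fun k hk l hl ↦ by
    have := hc2c k h l
    rwa [h2h l hl, h2g (k * h) l hl, smul_one, one_mul, one_mul] at this
  obtain ⟨γ, hγ⟩ := h90 (fun k ↦ c2 k h) fun k l ↦ by
    have := hc2c k l h
    rw [h2 k k.2 l l.2, mul_one, show (l : G) * h = h * (h⁻¹ * l * h) by group,
      h2r k k.2 _ (hnorm l l.2)] at this
    rw [Subgroup.coe_mul, ← this, mul_comm]
  -- make it trivial on `H × G`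
  set β3 : G → A := fun g ↦ if g ∈ H then 1 else γ with hβ3
  set c3 : G → G → A := fun g k ↦ c2 g k / cobd β3 g k with hc3
  have hc3c : IsCoc c3 := hc2c.div (IsCoc.cobd β3)
  have h3g : ∀ g, ∀ k ∈ H, c3 g k = 1 := fun g k hk ↦ by
    by_cases hg : g ∈ H
    · simp [hc3, h2g g k hk, cobd, hβ3, hk, hg, mul_mem hg hk]
    · have : g * k ∉ H := fun h' ↦ hg (by simpa using mul_mem h' (inv_mem hk))
      simp [hc3, h2g g k hk, cobd, hβ3, hk, hg, this]
  have h3h : ∀ k ∈ H, c3 k h = 1 := fun k hk ↦ by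
    have : k * h ∉ H := fun h' ↦ hh (by simpa using mul_mem (inv_mem hk) h')
    have h4 := hγ ⟨k, hk⟩
    simp only at h4
    simp [hc3, cobd, hβ3, hk, hh, this, h4]
  have h3 : ∀ k ∈ H, ∀ g, c3 k g = 1 := fun k hk g ↦ by
    by_cases hg : g ∈ H
    · exact h3g k g hg
    · have hg' : h⁻¹ * g ∈ H := mul_mem_of_index_two hH hinv hg
      have := hc3c k h (h⁻¹ * g)
      rwa [h3g h _ hg', h3g _ _ hg', h3h k hk, mul_inv_cancel_left, smul_one, one_mul,
        one_mul] at this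
  have h3b : ∀ g, g ∉ H → ∀ g', g' ∉ H → c3 g g' = c3 h h := fun g hg g' hg' ↦ by
    have hk : h⁻¹ * g ∈ H := mul_mem_of_index_two hH hinv hg
    have h4 := hc3c h (h⁻¹ * g) g'
    rw [h3 _ hk, h3g h _ hk, mul_inv_cancel_left, smul_one, one_mul, mul_one] at h4
    have h5 : h⁻¹ * (h⁻¹ * g * g') ∈ H :=
      mul_mem_of_index_two hH hinv fun h' ↦ hg' ((H.mul_mem_cancel_left hk).1 h')
    have h6 := hc3c h h (h⁻¹ * (h⁻¹ * g * g'))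
    rw [h3g h _ h5, h3g _ _ h5, mul_inv_cancel_left, smul_one, one_mul, one_mul] at h6
    rw [← h4, h6]
  refine ⟨fun g ↦ y g * β2 g * β3 g, c3 h h, fun g ↦ ?_, fun g k ↦ ?_⟩
  · have h4 := hc3c g h h
    have h5 : h * h ∈ H := mul_mem_of_index_two hH hh hh
    rw [h3g g _ h5, mul_one] at h4
    by_cases hg : g ∈ H
    · have : g * h ∉ H := fun h' ↦ hh (by simpa using mul_mem (inv_mem hg) h')
      rw [h4, h3b _ this h hh, h3 g hg, mul_one]
    · have : g * h ∈ H := mul_mem_of_index_two hH hg hh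
      rw [h4, h3 _ this, h3b g hg h hh, one_mul]
  · rw [cobd_mul, cobd_mul]
    have h4 : c g k = c3 g k * (cobd y g k * cobd β2 g k * cobd β3 g k) := by
      simp only [hc3, hc2, hc1]
      rw [div_div, div_div, mul_assoc (cobd y g k), div_mul_cancel]
    rw [h4]
    congr 1
    split_ifs with h5
    · rcases h5 with h5 | h5
      · exact h3 g h5 k
      · exact h3g g k h5
    · rw [not_or] at h5
      exact h3b g h5.1 k h5.2

open scoped Classical in
/-- If the invariant of an inflated cocycle is a norm, the cocycle is a coboundary. -/
theorem exists_cobd_of_norm {H : Subgroup G} (hH : H.index = 2) {h : G} (hh : h ∉ H)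
    {c : G → G → A} {β : G → A} {b y : A}
    (hc : ∀ g h, c g h = (if g ∈ H ∨ h ∈ H then 1 else b) * cobd β g h)
    (hy : ∀ k ∈ H, k • y = y) (hb : b = y * h • y) :
    ∃ β' : G → A, ∀ g h, c g h = cobd β' g h := by
  refine ⟨fun g ↦ (if g ∈ H then 1 else y) * β g, fun g k ↦ ?_⟩
  rw [hc, cobd_mul]
  congr 1
  have hinv : h⁻¹ ∉ H := fun h' ↦ hh (by simpa using inv_mem h')
  by_cases hg : g ∈ H <;> by_cases hk : k ∈ H
  · simp [cobd, hg, hk, mul_mem hg hk]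
  · have : g * k ∉ H := fun h' ↦ hk (by simpa using mul_mem (inv_mem hg) h')
    simp [cobd, hg, hk, this, hy g hg]
  · have : g * k ∉ H := fun h' ↦ hg (by simpa using mul_mem h' (inv_mem hk))
    simp [cobd, hg, hk, this]
  · have := mul_mem_of_index_two hH hg hk
    have h1 : h⁻¹ * g ∈ H := mul_mem_of_index_two hH hinv hg
    have h2 : g • y = h • y := by
      conv_rhs => rw [← hy _ h1, ← mul_smul, mul_inv_cancel_left]
    simp [cobd, hg, hk, this, h2, hb]

/-- Hilbert 90 for a finite group of field automorphisms. -/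
theorem hilbert90 {F K H : Type*} [Field F] [Field K] [Algebra F K] [Group H] [Finite H]
    {φ : H →* (K ≃ₐ[F] K)} (hφ : Function.Injective φ) (f : H → Kˣ)
    (hf : ∀ k l : H, f (k * l) = f k * φ k • f l) :
    ∃ γ : Kˣ, ∀ k : H, f k = φ k • γ / γ := by
  classical
  have := Fintype.ofFinite H
  have hli : LinearIndependent K fun k : H ↦ ((φ k : K →* K) : K → K) :=
    (linearIndependent_monoidHom K K).comp (fun k : H ↦ (φ k : K →* K))
      fun k l hkl ↦ hφ (AlgEquiv.ext fun x ↦ DFunLike.congr_fun hkl x)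
  obtain ⟨a, ha⟩ : ∃ a : K, ∑ k : H, (f k : K) * φ k a ≠ 0 := by
    by_contra! hcon
    have := Fintype.linearIndependent_iff.1 hli (fun k ↦ (f k : K)) (by
      ext a
      rw [Finset.sum_apply]
      simpa using hcon a) 1
    exact (f 1).ne_zero this
  refine ⟨(Units.mk0 _ ha)⁻¹, fun l ↦ ?_⟩
  rw [smul_inv', inv_div_inv, eq_div_iff_mul_eq']
  ext
  have h1 : ∀ (σ : K ≃ₐ[F] K) (u : Kˣ), ((σ • u : Kˣ) : K) = σ u := fun _ _ ↦ rfl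
  rw [Units.val_mul, h1, Units.val_mk0, map_sum, Finset.mul_sum]
  rw [← Equiv.sum_comp (Equiv.mulLeft l) fun k ↦ (f k : K) * φ k a]
  refine Finset.sum_congr rfl fun k _ ↦ ?_
  rw [Equiv.coe_mulLeft, hf, map_mul, map_mul, Units.val_mul, h1, AlgEquiv.mul_apply]
  ring

/-- A chain of subgroups of index two. -/
theorem induction_two_group {G : Type*} [Group G] [Finite G] (hG : IsPGroup 2 G)
    (P : Subgroup G → Prop) (h0 : P ⊥)
    (hs : ∀ H H' : Subgroup G, H ≤ H' → H.relIndex H' = 2 → P H → P H') : P ⊤ := by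
  have : Fact (Nat.Prime 2) := ⟨Nat.prime_two⟩
  obtain ⟨n, hn⟩ := IsPGroup.iff_card.1 hG
  have key : ∀ k ≤ n, ∃ H : Subgroup G, Nat.card H = 2 ^ k ∧ P H := fun k ↦ by
    induction k with
    | zero => exact fun _ ↦ ⟨⊥, by simp, h0⟩
    | succ k ih =>
      intro hk
      obtain ⟨H, hH, hP⟩ := ih (by omega)
      obtain ⟨H', hH', hle⟩ := Sylow.exists_subgroup_card_pow_prime_le (p := 2) (n := k) (m := k + 1)
        (by rw [hn]; exact pow_dvd_pow 2 hk) H hH (by omega)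
      refine ⟨H', hH', hs H H' hle ?_ hP⟩
      have h1 := Subgroup.relIndex_mul_relIndex ⊥ H H' bot_le hle
      rw [Subgroup.relIndex_bot_left, Subgroup.relIndex_bot_left, hH, hH', pow_succ] at h1
      exact Nat.eq_of_mul_eq_mul_left (by positivity) h1
  obtain ⟨H, hH, hP⟩ := key n le_rfl
  rwa [← (Subgroup.card_eq_iff_eq_top H).1 (by rw [hH, hn])]

end TwoCocycle

end

section

open IsDedekindDomain NumberField LocalSquare Module

namespace Places

/-- Local conditions: residue field `𝔽₂` at the even primes, ramification only at the primes in
`T`, with ramification index at most two, and prime residue fields at the primes in `S`. -/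
structure LocAdm (S T : Set ℕ) (K : Type*) [Field K] [NumberField K] : Prop where
  two : ∀ w : Pl K, vl w 2 ≠ 1 → ∀ x, vl w x ≤ 1 → vl w x < 1 ∨ vl w (x - 1) < 1
  unram : ∀ w : Pl K, (∀ q ∈ T, vl w (q : K) = 1) → ∀ x, x ≠ 0 → ∃ z : ℚ, vl w x = vl w (z : K)
  tame : ∀ w : Pl K, ∀ q ∈ T, vl w (q : K) ≠ 1 → ∀ x, x ≠ 0 → ∃ z : ℚ, vl w x ^ 2 = vl w (z : K)
  resid : ∀ w : Pl K, ∀ q ∈ S, vl w (q : K) ≠ 1 → ∀ x, vl w x ≤ 1 → ∃ m : ℤ, vl w (x - m) < 1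

/-- The primes of `S` are one modulo eight. -/
def OneModEight (S : Set ℕ) : Prop := ∀ q ∈ S, q.Prime ∧ q % 8 = 1

section basic

variable {K : Type*} [Field K] [NumberField K]

theorem vl_natCast_lt (w : Pl K) {p : ℕ} (hp : vl w (p : K) ≠ 1) : vl w (p : K) < 1 :=
  lt_of_le_of_ne (val_natCast_le_one _ _) hp

theorem vl_intCast_eq_one (w : Pl K) {p : ℕ} (hp : p.Prime) (hw : vl w (p : K) ≠ 1) {m : ℤ}
    (hm : ¬(p : ℤ) ∣ m) : vl w (m : K) = 1 := by
  have hlt := vl_natCast_lt w hw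
  have hc : IsCoprime (p : ℤ) m := (Nat.prime_iff_prime_int.1 hp).coprime_iff_not_dvd.2 hm
  obtain ⟨a, b, hab⟩ := hc
  by_contra h
  have h1 : vl w (m : K) < 1 := lt_of_le_of_ne (val_intCast_le_one _ _) h
  have h2 : vl w ((a : K) * (p : K) + (b : K) * (m : K)) < 1 := by
    refine (vl w).map_add_lt ?_ ?_
    · rw [map_mul]
      exact (mul_le_of_le_one_left' (val_intCast_le_one (vl w) a)).trans_lt hlt
    · rw [map_mul]
      exact (mul_le_of_le_one_left' (val_intCast_le_one (vl w) b)).trans_lt h1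
  have h3 : (a : K) * (p : K) + (b : K) * (m : K) = 1 := by exact_mod_cast hab
  rw [h3, map_one] at h2
  exact lt_irrefl _ h2

theorem vl_natCast_prime_eq_one (w : Pl K) {p q : ℕ} (hp : p.Prime) (hq : q.Prime) (hpq : p ≠ q)
    (hw : vl w (p : K) ≠ 1) : vl w (q : K) = 1 := by
  have := vl_intCast_eq_one w hp hw (m := q) fun h ↦
    hpq ((Nat.prime_dvd_prime_iff_eq hp hq).1 (by exact_mod_cast h))
  exact_mod_cast this

theorem exists_forall_vl_intCast_eq (K : Type*) [Field K] [NumberField K] {p : ℕ} (hp : p.Prime)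
    {m : ℤ} (hm : m ≠ 0) :
    ∃ k : ℕ, ∀ w : Pl K, vl w (p : K) ≠ 1 → vl w (m : K) = vl w (p : K) ^ k := by
  have hf : FiniteMultiplicity (p : ℤ) m :=
    Int.finiteMultiplicity_iff.2 ⟨by simpa using hp.ne_one, hm⟩
  obtain ⟨c, hc, hpc⟩ := hf.exists_eq_pow_mul_and_not_dvd
  refine ⟨multiplicity (p : ℤ) m, fun w hw ↦ ?_⟩
  conv_lhs => rw [hc]
  push_cast
  rw [map_mul, map_pow, vl_intCast_eq_one w hp hw hpc, mul_one]

theorem exists_forall_vl_ratCast_eq (K : Type*) [Field K] [NumberField K] {p : ℕ} (hp : p.Prime)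
    {z : ℚ} (hz : z ≠ 0) :
    ∃ k : ℤ, ∀ w : Pl K, vl w (p : K) ≠ 1 → vl w (z : K) = vl w (p : K) ^ k := by
  obtain ⟨k, hk⟩ := exists_forall_vl_intCast_eq K hp (Rat.num_ne_zero.2 hz)
  obtain ⟨l, hl⟩ := exists_forall_vl_intCast_eq K hp (m := z.den) (by exact_mod_cast z.den_nz)
  refine ⟨k - l, fun w hw ↦ ?_⟩
  have hp0 : vl w (p : K) ≠ 0 := vl_ne_zero w (by exact_mod_cast hp.ne_zero)
  have h1 : (z : K) = (z.num : K) / ((z.den : ℤ) : K) := by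
    rw [Rat.cast_def]
    push_cast
    rfl
  rw [h1, map_div₀, hk w hw, hl w hw, zpow_sub₀ hp0, zpow_natCast, zpow_natCast]

theorem exists_vl_ratCast_eq (w : Pl K) {p : ℕ} (hp : p.Prime) (hw : vl w (p : K) ≠ 1) {z : ℚ}
    (hz : z ≠ 0) : ∃ k : ℤ, vl w (z : K) = vl w (p : K) ^ k :=
  (exists_forall_vl_ratCast_eq K hp hz).imp fun _ hk ↦ hk w hw

theorem ratCast_ne_zero_of_vl {w : Pl K} {x : K} (hx : x ≠ 0) {z : ℚ} {n : ℕ}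
    (h : vl w x ^ n = vl w (z : K)) : z ≠ 0 := by
  rintro rfl
  rw [Rat.cast_zero, map_zero] at h
  exact pow_ne_zero n (vl_ne_zero w hx) h

variable {S : Set ℕ}

theorem OneModEight.vl_eq_one_of_even (hS : OneModEight S) {w : Pl K} (h2 : vl w 2 ≠ 1) {q : ℕ}
    (hq : q ∈ S) : vl w (q : K) = 1 := by
  refine vl_natCast_prime_eq_one w Nat.prime_two (hS q hq).1 ?_ (by exact_mod_cast h2)
  rintro rfl
  have := (hS _ hq).2
  omega

theorem OneModEight.vl_two (hS : OneModEight S) {w : Pl K} {q : ℕ} (hq : q ∈ S)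
    (hw : vl w (q : K) ≠ 1) : vl w 2 = 1 := by
  by_contra h
  exact hw (hS.vl_eq_one_of_even h hq)

theorem LocAdm.isQ2 {T : Set ℕ} (hL : LocAdm S T K) (hT : OneModEight T) {w : Pl K}
    (h2 : vl w 2 ≠ 1) : IsQ2 w := by
  refine ⟨vl_two_lt w h2, fun x hx ↦ ?_, hL.two w h2⟩
  obtain ⟨z, hz⟩ := hL.unram w (fun q hq ↦ hT.vl_eq_one_of_even h2 hq) x hx
  have hz0 : z ≠ 0 := ratCast_ne_zero_of_vl (n := 1) hx (by rw [pow_one, hz])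
  obtain ⟨k, hk⟩ := exists_vl_ratCast_eq w Nat.prime_two (by exact_mod_cast h2) hz0
  exact ⟨k, by rw [hz, hk]; norm_cast⟩

theorem LS_neg_one (w : Pl K) {q : ℕ} (hq : q.Prime) (hq8 : q % 8 = 1) (hw : vl w (q : K) ≠ 1) :
    LS (vl w) (-1 : K) := by
  have := Fact.mk hq
  have h2 : vl w 2 = 1 := by
    have : OneModEight {q} := by
      rintro _ rfl
      exact ⟨hq, hq8⟩
    exact this.vl_two rfl hw
  have h4 : vl w 4 = 1 := by rw [val_four, h2, one_mul]
  obtain ⟨m, hm⟩ := (ZMod.exists_sq_eq_neg_one_iff (p := q)).2 (by omega)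
  obtain ⟨m, rfl⟩ := ZMod.intCast_surjective m
  have h5 : (q : ℤ) ∣ -1 - m ^ 2 := by
    rw [← ZMod.intCast_zmod_eq_zero_iff_dvd]
    push_cast
    rw [hm]
    ring
  obtain ⟨k, hk⟩ := h5
  refine ⟨m, ?_⟩
  have h6 : (-1 - (m : K) ^ 2) = (k : K) * q := by
    have : ((-1 - m ^ 2 : ℤ) : K) = ((q * k : ℤ) : K) := by rw [hk]
    push_cast at this
    rw [this, mul_comm]
  rw [h6, map_mul, map_mul, h4, Valuation.map_neg, map_one, one_mul]
  exact (mul_le_of_le_one_left' (val_intCast_le_one (vl w) k)).trans_lt (vl_natCast_lt w hw)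

theorem exists_intCast_mul (w : Pl K) (hres : ∀ x, vl w x ≤ 1 → ∃ m : ℤ, vl w (x - m) < 1) {x y : K}
    (hy : y ≠ 0) (hxy : vl w x = vl w y) : ∃ m : ℤ, vl w (x - m * y) < vl w x := by
  have hy0 := vl_ne_zero w hy
  obtain ⟨m, hm⟩ := hres (x / y) (by rw [map_div₀, hxy, div_self hy0])
  refine ⟨m, ?_⟩
  have h1 : x - m * y = (x / y - m) * y := by field_simp
  rw [h1, map_mul, hxy]
  exact mul_lt_of_lt_one_left (vl_pos w hy) hm

end basic

section ext

variable {F K : Type*} [Field F] [NumberField F] [Field K] [NumberField K]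

theorem comapPl_isQ2 (f : F →+* K) {w : Pl K} (h : IsQ2 w) : IsQ2 (comapPl f w) := by
  have h2 : f 2 = 2 := map_ofNat f 2
  refine ⟨?_, fun x hx ↦ ?_, fun x hx ↦ ?_⟩
  · rw [comapPl_lt_one, h2]
    exact h.1
  · obtain ⟨k, hk⟩ := h.2.1 (f x) (by simpa using hx)
    refine ⟨k, ?_⟩
    rw [← map_zpow₀, comapPl_eq, hk, map_zpow₀ f, h2, map_zpow₀]
  · rcases h.2.2 (f x) ((comapPl_le_one_iff f w).1 hx) with h1 | h1
    · exact Or.inl ((comapPl_lt_one f w).2 h1)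
    · exact Or.inr ((comapPl_lt_one f w).2 (by rwa [map_sub, map_one]))

theorem LS_of_approx (f : F →+* K) (w : Pl K) {a : F} {α : K} (hα : α ^ 2 = f a) {y : F}
    (hy : vl w (α - f y) < vl w (4 * α)) : LS (vl (comapPl f w)) a := by
  refine ⟨y, ?_⟩
  have h1 : vl w (f y) = vl w α := val_eq_of_sub_lt (lt_of_lt_four_mul hy)
  have h2 : vl w (α + f y) ≤ vl w α :=
    ((vl w).map_add _ _).trans (max_le le_rfl h1.le)
  have h0 : 0 < vl w α := by
    refine lt_of_le_of_ne zero_le fun h ↦ ?_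
    rw [(vl w).map_mul, ← h, mul_zero] at hy
    exact not_lt_zero hy
  rw [comapPl_lt, map_sub, map_pow, map_mul f, map_ofNat, ← hα]
  calc vl w (α ^ 2 - f y ^ 2) = vl w (α - f y) * vl w (α + f y) := by
        rw [← (vl w).map_mul]
        ring_nf
    _ ≤ vl w (α - f y) * vl w α := mul_le_mul_right h2 _
    _ < vl w (4 * α) * vl w α := mul_lt_mul_of_pos_right hy h0
    _ = vl w (4 * α ^ 2) := by rw [← (vl w).map_mul]; ring_nf

theorem LS_of_even (f : F →+* K) {w : Pl K} (hw : IsQ2 w) {a : F} {α : K} (hα : α ^ 2 = f a)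
    (hα0 : α ≠ 0) : LS (vl (comapPl f w)) a := by
  obtain ⟨k, hk⟩ := hw.2.1 α hα0
  have h20 : (2 : K) ^ k ≠ 0 := zpow_ne_zero _ two_ne_zero
  have h1 : vl w (α / 2 ^ k) = 1 := by
    rw [map_div₀, map_zpow₀, hk, div_self]
    rw [← hk]
    exact vl_ne_zero w hα0
  obtain ⟨m, hm⟩ := hw.exists_int 3 h1.le
  refine LS_of_approx f w hα (y := m * 2 ^ k) ?_
  have h2 : α - f (m * 2 ^ k) = (α / 2 ^ k - m) * 2 ^ k := by
    rw [map_mul, map_zpow₀, map_intCast, map_ofNat]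
    field_simp
  rw [h2, (vl w).map_mul, (vl w).map_mul, hk, map_zpow₀]
  refine mul_lt_mul_of_pos_right (hm.trans_lt ?_) (zpow_pos (vl_pos w two_ne_zero) _)
  rw [show (2 : K) ^ 3 = 4 * 2 by norm_num, (vl w).map_mul]
  exact mul_lt_of_lt_one_right (vl_pos w (by norm_num : (4 : K) ≠ 0)) hw.1

theorem LS_of_rational (f : F →+* K) {w : Pl K} (h2 : vl w 2 = 1)
    (hres : ∀ x, vl w x ≤ 1 → ∃ m : ℤ, vl w (x - m) < 1) {a : F} {α : K} (hα : α ^ 2 = f a)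
    (hα0 : α ≠ 0) {z : ℚ} (hz : vl w α = vl w (z : K)) : LS (vl (comapPl f w)) a := by
  have hz0 : (z : K) ≠ 0 := by
    exact_mod_cast ratCast_ne_zero_of_vl (n := 1) hα0 (by rw [pow_one, hz])
  obtain ⟨m, hm⟩ := exists_intCast_mul w hres hz0 hz
  refine LS_of_approx f w hα (y := m * z) ?_
  rwa [(vl w).map_mul 4, val_four, h2, one_mul, one_mul, map_mul, map_intCast, map_ratCast]

end ext

section decomp

variable {F K : Type*} [Field F] [Field K] [NumberField K] [Algebra F K]

theorem vl_comapPl_algEquiv (g : K ≃ₐ[F] K) (w : Pl K) (x : K) :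
    vl (comapPl (g : K →+* K) w) x = vl w (g x) :=
  vl_comapPl_equiv (g : K ≃+* K) w x

variable [NumberField F]

theorem exists_decomp [IsGalois F K] (hG : IsPGroup 2 (K ≃ₐ[F] K)) {H : Subgroup (K ≃ₐ[F] K)}
    {a : F} {α : K} (hα : α ^ 2 = algebraMap F K a) (hα0 : α ≠ 0)
    (h1 : ∀ g ∈ H, g α = α) (h2 : ∀ g ∉ H, g α = -α) (w : Pl K) (hw : vl w 2 = 1)
    (ha : ¬LS (vl (comapPl (algebraMap F K) w)) a) :
    ∃ h, h ∉ H ∧ comapPl ((h : K ≃ₐ[F] K) : K →+* K) w = w := by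
  classical
  by_contra! hno
  have hwell : ∀ g ∉ H, ∀ g' ∈ H,
      comapPl ((g : K ≃ₐ[F] K) : K →+* K) w ≠ comapPl ((g' : K ≃ₐ[F] K) : K →+* K) w := by
    intro g hg g' hg' he
    refine hno (g * g'⁻¹) (fun h ↦ hg ?_) ?_
    · simpa using mul_mem h hg'
    · refine eq_of_le_one fun x hx ↦ ?_
      rw [vl_comapPl_algEquiv] at hx
      have h3 := vl_comapPl_algEquiv g w (g'⁻¹ x)
      rw [he, vl_comapPl_algEquiv, AlgEquiv.mul_apply] at *
      rwa [← h3, ← AlgEquiv.mul_apply, mul_inv_cancel, AlgEquiv.one_apply] at hx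
  obtain ⟨y, hy⟩ := exists_approx
    (S := Set.range fun g : K ≃ₐ[F] K ↦ comapPl (g : K →+* K) w) (Set.finite_range _)
    (fun u ↦ if ∃ g ∈ H, comapPl ((g : K ≃ₐ[F] K) : K →+* K) w = u then α else -α) (fun _ ↦ α)
    fun _ _ ↦ hα0
  have hy' : ∀ g : K ≃ₐ[F] K, vl w (g y - α) < vl w α := by
    intro g
    have h3 := hy _ ⟨g, rfl⟩
    simp only at h3
    by_cases hg : g ∈ H
    · rw [if_pos ⟨g, hg, rfl⟩, vl_comapPl_algEquiv, vl_comapPl_algEquiv, map_sub, h1 g hg] at h3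
      exact h3
    · rw [if_neg (by rintro ⟨g', hg', he⟩; exact hwell g hg g' hg' he.symm), vl_comapPl_algEquiv,
        vl_comapPl_algEquiv, map_sub, map_neg, h2 g hg, neg_neg, Valuation.map_neg] at h3
      exact h3
  obtain ⟨n, hn⟩ := IsPGroup.iff_card.1 hG
  rw [Nat.card_eq_fintype_card] at hn
  have hnu : vl w ((Fintype.card (K ≃ₐ[F] K) : ℕ) : K) = 1 := by
    rw [hn, Nat.cast_pow, map_pow, Nat.cast_ofNat, hw, one_pow]
  have hc0 : ((Fintype.card (K ≃ₐ[F] K) : ℕ) : K) ≠ 0 := by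
    exact_mod_cast Fintype.card_ne_zero
  refine ha (LS_of_approx (algebraMap F K) w hα
    (y := Algebra.trace F K y / (Fintype.card (K ≃ₐ[F] K) : ℕ)) ?_)
  have h3 : α - algebraMap F K (Algebra.trace F K y / (Fintype.card (K ≃ₐ[F] K) : ℕ)) =
      -(∑ g : K ≃ₐ[F] K, (g y - α)) / (Fintype.card (K ≃ₐ[F] K) : ℕ) := by
    rw [map_div₀, map_natCast, trace_eq_sum_automorphisms, Finset.sum_sub_distrib,
      Finset.sum_const, Finset.card_univ, nsmul_eq_mul]
    field_simp
    ring
  rw [h3, map_div₀, hnu, div_one, Valuation.map_neg, (vl w).map_mul, val_four, hw, one_mul, one_mul]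
  exact (vl w).map_sum_lt (vl_ne_zero w hα0) fun g _ ↦ hy' g

end decomp

end Places

end

section

open IsDedekindDomain NumberField LocalSquare Module TwoCocycle

namespace Places

theorem AN_div_sq_iff {F : Type*} [Field F] [NumberField F] {v : Pl F} {a b c : F} (hc : c ≠ 0)
    (h : AN (vl v) (a / c ^ 2) b) : AN (vl v) a b := by
  obtain ⟨x, y, hxy⟩ := h
  refine ⟨x, y / c, ?_⟩
  convert hxy using 3
  field_simp

variable {F K : Type*} [Field F] [NumberField F] [Field K] [NumberField K] [Algebra F K]

/-- The norm condition at a place with rational value group. -/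
theorem AN_of_unram {w : Pl K} (hun : ∀ x : K, x ≠ 0 → ∃ z : ℚ, vl w x = vl w (z : K))
    (h2 : vl w 2 = 1) {h k : K ≃ₐ[F] K} (hk : ∀ x, vl w (k x) = vl w x)
    (hh : ∀ x, vl w (h x) = vl w x) [Finite (K ≃ₐ[F] K)]
    {β : (K ≃ₐ[F] K) → Kˣ} (hβ : ∀ n : ℕ, vl w (cobd β k (k ^ n) : Kˣ) = 1)
    (hβ1 : vl w (β 1 : K) = 1) {a b : F} {α : K} (hα : α ^ 2 = algebraMap F K a) (hα0 : α ≠ 0)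
    (hb : vl w (algebraMap F K b * (β h * h (β h) / β k)) = 1) :
    AN (vl (comapPl (algebraMap F K) w)) a b := by
  have hβn : ∀ n : ℕ, vl w (β (k ^ n) : K) = vl w (β k : K) ^ n := fun n ↦ by
    induction n with
    | zero => simpa using hβ1
    | succ n ih =>
      have h3 := hβ n
      have h4 : ((cobd β k (k ^ n) : Kˣ) : K) = β k * k (β (k ^ n)) / β (k ^ (n + 1)) := by
        rw [pow_succ']
        simp [cobd]
      rw [h4, map_div₀, (vl w).map_mul, hk, ih] at h3
      have h5 := vl_ne_zero w (β (k ^ (n + 1))).ne_zero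
      rw [div_eq_one_iff_eq h5] at h3
      rw [← h3, pow_succ']
  have hβk : vl w (β k : K) = 1 := by
    have h3 := hβn (orderOf k)
    rw [pow_orderOf_eq_one, hβ1, eq_comm] at h3
    exact (pow_eq_one_iff_of_nonneg zero_le (orderOf_pos k).ne').1 h3
  obtain ⟨z, hz⟩ := hun _ (β h).ne_zero
  have hz0 : z ≠ 0 := ratCast_ne_zero_of_vl (n := 1) (β h).ne_zero (by rw [pow_one, hz])
  obtain ⟨z', hz'⟩ := hun _ hα0
  have hz0' : z' ≠ 0 := ratCast_ne_zero_of_vl (n := 1) hα0 (by rw [pow_one, hz'])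
  have hzF : (z : F) ≠ 0 := by exact_mod_cast hz0
  have hzF' : (z' : F) ≠ 0 := by exact_mod_cast hz0'
  have hzK' : (z' : K) ≠ 0 := by exact_mod_cast hz0'
  have hv2 : vl (comapPl (algebraMap F K) w) 2 = 1 := by
    rw [comapPl_eq_one, map_ofNat]
    exact h2
  refine AN_div_sq_iff hzF' ?_
  rw [← AN.mul_iff_right (AN.sq hzF)]
  refine AN_of_units _ hv2 ?_ ?_
  · rw [comapPl_eq_one, map_div₀, map_pow, map_ratCast, ← hα, ← div_pow, map_pow, map_div₀, hz',
      div_self (vl_ne_zero w hzK'), one_pow]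
  · rw [comapPl_eq_one, map_mul, map_pow, map_ratCast]
    rw [(vl w).map_mul, map_div₀, (vl w).map_mul, hh, hβk, div_one, hz] at hb
    rw [(vl w).map_mul, map_pow, pow_two, mul_comm]
    exact hb

omit [NumberField F] in
/-- An automorphism preserving a tame place and fixing a generator of the tamely ramified
part is trivial. -/
theorem eq_one_of_tame {w : Pl K} [Finite (K ≃ₐ[F] K)] (hG : IsPGroup 2 (K ≃ₐ[F] K))
    (h2 : vl w 2 = 1) {k : K ≃ₐ[F] K} (hk : ∀ x, vl w (k x) = vl w x)
    (happ : ∀ x : K, x ≠ 0 → ∃ t, k t = t ∧ vl w (x - t) < vl w x) : k = 1 := by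
  obtain ⟨r, hr⟩ := IsPGroup.iff_orderOf.1 hG k
  have hn1 : vl w ((orderOf k : ℕ) : K) = 1 := by
    rw [hr, Nat.cast_pow, map_pow, Nat.cast_ofNat, h2, one_pow]
  have hn0 : ((orderOf k : ℕ) : K) ≠ 0 := by exact_mod_cast (orderOf_pos k).ne'
  have hpow : ∀ (n : ℕ) x, vl w ((k ^ n) x) = vl w x := fun n ↦ by
    induction n with
    | zero => simp
    | succ n ih =>
      intro x
      rw [pow_succ', AlgEquiv.mul_apply, hk, ih]
  have hfix : ∀ (n : ℕ) t, k t = t → (k ^ n) t = t := fun n t ht ↦ by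
    induction n with
    | zero => simp
    | succ n ih => rw [pow_succ, AlgEquiv.mul_apply, ht, ih]
  have hsum : ∀ x, k (∑ i ∈ Finset.range (orderOf k), (k ^ i) x) =
      ∑ i ∈ Finset.range (orderOf k), (k ^ i) x := fun x ↦ by
    have h3 := (Finset.sum_range_succ' (fun i ↦ (k ^ i) x) (orderOf k)).symm.trans
      (Finset.sum_range_succ (fun i ↦ (k ^ i) x) (orderOf k))
    rw [pow_orderOf_eq_one, pow_zero, add_left_inj] at h3
    rw [map_sum, ← h3]
    exact Finset.sum_congr rfl fun i _ ↦ by rw [pow_succ', AlgEquiv.mul_apply]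
  have hzero : ∀ x, ∑ i ∈ Finset.range (orderOf k), (k ^ i) x = 0 → x = 0 := by
    intro x hx
    by_contra hx0
    obtain ⟨t, ht, hxt⟩ := happ x hx0
    have h4 : ∑ i ∈ Finset.range (orderOf k), (k ^ i) (x - t) = -((orderOf k : ℕ) * t) := by
      simp only [map_sub, Finset.sum_sub_distrib, hx, hfix _ t ht, Finset.sum_const,
        Finset.card_range, nsmul_eq_mul, zero_sub]
    have h5 : vl w (∑ i ∈ Finset.range (orderOf k), (k ^ i) (x - t)) < vl w x :=
      (vl w).map_sum_lt (vl_ne_zero w hx0) fun i _ ↦ by rwa [hpow]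
    rw [h4, Valuation.map_neg, (vl w).map_mul, hn1, one_mul, val_eq_of_sub_lt hxt] at h5
    exact lt_irrefl _ h5
  ext x
  set y := (∑ i ∈ Finset.range (orderOf k), (k ^ i) x) / (orderOf k : ℕ) with hy
  have hky : k y = y := by rw [hy, map_div₀, hsum, map_natCast]
  have h6 : x - y = 0 := hzero _ (by
    simp only [map_sub, Finset.sum_sub_distrib, hfix _ y hky, Finset.sum_const,
        Finset.card_range, nsmul_eq_mul]
    rw [hy]
    field_simp
    ring)
  rw [sub_eq_zero] at h6
  rw [h6, hky]
  rfl

theorem AN_of_tame {w : Pl K} {q : ℕ} (hq : q.Prime) (hq8 : q % 8 = 1) (hw : vl w (q : K) ≠ 1)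
    (htame : ∀ x : K, x ≠ 0 → ∃ z : ℚ, vl w x ^ 2 = vl w (z : K))
    (hres : ∀ x : K, vl w x ≤ 1 → ∃ m : ℤ, vl w (x - m) < 1)
    [Finite (K ≃ₐ[F] K)] (hG : IsPGroup 2 (K ≃ₐ[F] K)) (h2 : vl w 2 = 1)
    {h : K ≃ₐ[F] K} (hh : ∀ x, vl w (h x) = vl w x) {a b : F} {α : K}
    (hα : α ^ 2 = algebraMap F K a) (hα0 : α ≠ 0) (hhα : h α = -α)
    (ha : ¬LS (vl (comapPl (algebraMap F K) w)) a) {x : K} (hx0 : x ≠ 0)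
    (hb : (h * h = 1) → algebraMap F K b * (x * h x) = 1 ∨ algebraMap F K b * (x * h x) = -1) :
    AN (vl (comapPl (algebraMap F K) w)) a b := by
  have hqK : (q : K) ≠ 0 := by exact_mod_cast hq.ne_zero
  have hq0 := vl_ne_zero w hqK
  have hk : ∀ x : K, x ≠ 0 → ∃ k : ℤ, vl w x ^ 2 = vl w (q : K) ^ k := fun x hx ↦ by
    obtain ⟨z, hz⟩ := htame x hx
    obtain ⟨k, hk⟩ := exists_vl_ratCast_eq w hq hw (ratCast_ne_zero_of_vl hx hz)
    exact ⟨k, hz.trans hk⟩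
  have hroot : ∀ x y : K, vl w x ^ 2 = vl w y ^ 2 → vl w x = vl w y := fun x y hxy ↦
    (pow_left_inj₀ zero_le zero_le two_ne_zero).1 hxy
  obtain ⟨k0, hk0⟩ := hk α hα0
  have hodd : Odd k0 := by
    by_contra heven
    rw [Int.not_odd_iff_even] at heven
    obtain ⟨l, rfl⟩ := heven
    refine ha (LS_of_rational _ h2 hres hα hα0 (z := (q : ℚ) ^ l) (hroot _ _ ?_))
    rw [hk0, Rat.cast_zpow, Rat.cast_natCast, map_zpow₀, pow_two, ← zpow_add₀ hq0]
  have hval : ∀ x : K, x ≠ 0 → ∃ (l : ℤ) (j : ℕ), vl w x = vl w ((q : K) ^ l * α ^ j) := by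
    intro x hx
    obtain ⟨k, hkx⟩ := hk x hx
    rcases Int.even_or_odd k with ⟨l, rfl⟩ | hko
    · refine ⟨l, 0, hroot _ _ ?_⟩
      rw [hkx, pow_zero, mul_one, map_zpow₀, zpow_add₀ hq0, pow_two]
    · obtain ⟨l, hl⟩ := hko.sub_odd hodd
      refine ⟨l, 1, hroot _ _ ?_⟩
      rw [hkx, pow_one, (vl w).map_mul, mul_pow, hk0, map_zpow₀, pow_two, ← zpow_add₀ hq0,
        ← zpow_add₀ hq0]
      congr 1
      omega
  have happ : ∀ x : K, x ≠ 0 → ∃ (t : F) (j : ℕ),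
      vl w (x - algebraMap F K t * α ^ j) < vl w x := by
    intro x hx
    obtain ⟨l, j, hlj⟩ := hval x hx
    obtain ⟨m, hm⟩ := exists_intCast_mul w hres
      (mul_ne_zero (zpow_ne_zero l hqK) (pow_ne_zero j hα0)) hlj
    refine ⟨m * (q : F) ^ l, j, ?_⟩
    rwa [map_mul, map_intCast, map_zpow₀, map_natCast, mul_assoc]
  have hone : h * h = 1 := by
    refine eq_one_of_tame hG h2 (w := w) (fun x ↦ by rw [AlgEquiv.mul_apply, hh, hh])
      fun x hx ↦ ?_
    obtain ⟨t, j, htj⟩ := happ x hx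
    exact ⟨_, by simp [hhα], htj⟩
  obtain ⟨t, j, htj⟩ := happ x hx0
  set s := algebraMap F K t * α ^ j with hs
  have hsx := val_eq_of_sub_lt htj
  have ht0 : t ≠ 0 := by
    rintro rfl
    rw [map_zero, zero_mul] at hs
    rw [hs, sub_zero] at htj
    exact lt_irrefl _ htj
  have ha0 : a ≠ 0 := by
    rintro rfl
    rw [map_zero] at hα
    exact hα0 (by simpa using hα)
  have hsh : s * h s = algebraMap F K (t ^ 2 * (-a) ^ j) := by
    rw [hs, map_mul h, AlgEquiv.commutes, map_pow, hhα, map_mul, map_pow, map_pow, map_neg, ← hα,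
      neg_pow α, neg_pow (α ^ 2)]
    ring
  have hval2 : vl w (x * h x - s * h s) < vl w (x * h x) := by
    have h5 : x * h x - s * h s = (x - s) * h x + s * h (x - s) := by rw [map_sub]; ring
    have hx1 := vl_pos w hx0
    rw [h5, (vl w).map_mul x, hh]
    refine (vl w).map_add_lt ?_ ?_
    · rw [(vl w).map_mul, hh]
      exact mul_lt_mul_of_pos_right htj hx1
    · rw [(vl w).map_mul, hh, hsx]
      exact mul_lt_mul_of_pos_left htj hx1
  have hpow : ∀ n : ℕ, AN (vl (comapPl (algebraMap F K) w)) a ((-a) ^ n) := fun n ↦ by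
    induction n with
    | zero => simpa using AN.sq (a := a) (one_ne_zero (α := F))
    | succ n ih =>
      rw [pow_succ]
      exact ih.mul (AN.neg_self ha0)
  have hAN := (AN.sq ht0).mul (hpow j)
  have hneg : AN (vl (comapPl (algebraMap F K) w)) a (-1) := by
    refine AN.of_LS (LS_neg_one _ hq hq8 fun h5 ↦ hw ?_)
    rwa [comapPl_eq_one, map_natCast] at h5
  obtain ⟨ε, hε, hεb⟩ : ∃ ε : F, AN (vl (comapPl (algebraMap F K) w)) a ε ∧
      algebraMap F K b * (x * h x) = algebraMap F K ε := by
    rcases hb hone with h5 | h5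
    · exact ⟨1, by simpa using hpow 0, by rw [h5, map_one]⟩
    · exact ⟨-1, hneg, by rw [h5, map_neg, map_one]⟩
  have hb0 : b ≠ 0 := by
    rintro rfl
    rw [map_zero, zero_mul, eq_comm, map_eq_zero] at hεb
    exact hε.ne_zero hεb
  have hbK : algebraMap F K b ≠ 0 := by simpa using hb0
  have hx : x * h x = algebraMap F K (ε * b⁻¹) := by
    rw [map_mul, map_inv₀, ← hεb]
    field_simp
  rw [hsh, hx, ← map_sub, ← comapPl_lt] at hval2
  have h7 := hAN.congr (c := ε * b⁻¹) (by
    rw [Valuation.map_sub_swap, val_eq_of_sub_lt hval2]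
    exact hval2)
  rw [AN.mul_iff_right hε] at h7
  simpa using h7.inv

/-- Real embeddings extend along totally real extensions. -/
theorem exists_real_extension (hreal : ∀ φ : K →+* ℂ, ∀ x, (φ x).im = 0) (φ : F →+* ℝ) :
    ∃ ψ : K →+* ℝ, ∀ x, ψ (algebraMap F K x) = φ x := by
  let : Algebra F ℂ := (Complex.ofRealHom.comp φ).toAlgebra
  have : Algebra.IsAlgebraic F K := by
    have := Algebra.IsAlgebraic.tower_top (K := ℚ) (L := F) (A := K)
    exact this
  let ψ : K →ₐ[F] ℂ := IsAlgClosed.lift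
  have hψ : ∀ x, ((ψ x).re : ℂ) = ψ x := fun x ↦ Complex.ext rfl (hreal (ψ : K →+* ℂ) x).symm
  refine ⟨{ toFun := fun x ↦ (ψ x).re
            map_one' := by simp
            map_zero' := by simp
            map_mul' := fun x y ↦ by
              have h1 := hreal (ψ : K →+* ℂ) x
              simp only [RingHom.coe_coe] at h1
              simp [h1]
            map_add' := fun x y ↦ by simp }, fun x ↦ ?_⟩
  change (ψ (algebraMap F K x)).re = φ x
  rw [ψ.commutes]
  rfl

theorem card_eq_finrank_of_real (hreal : ∀ φ : F →+* ℂ, ∀ x, (φ x).im = 0) :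
    Fintype.card (InfinitePlace F) = finrank ℚ F := by
  have : IsTotallyReal F := ⟨fun v ↦ by
    rw [InfinitePlace.isReal_iff, ComplexEmbedding.isReal_iff]
    exact RingHom.ext fun x ↦ Complex.conj_eq_iff_im.2 (hreal _ x)⟩
  have h1 := IsTotallyReal.finrank F
  have h2 := InfinitePlace.card_add_two_mul_card_eq_rank F
  rw [InfinitePlace.card_eq_nrRealPlaces_add_nrComplexPlaces]
  omega

theorem real_of_ext (hreal : ∀ φ : K →+* ℂ, ∀ x, (φ x).im = 0) :
    ∀ φ : F →+* ℂ, ∀ x, (φ x).im = 0 := by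
  intro φ x
  let : Algebra F ℂ := φ.toAlgebra
  have : Algebra.IsAlgebraic F K := Algebra.IsAlgebraic.tower_top (K := ℚ) (L := F) (A := K)
  let ψ : K →ₐ[F] ℂ := IsAlgClosed.lift
  have := hreal (ψ : K →+* ℂ) (algebraMap F K x)
  rw [RingHom.coe_coe, ψ.commutes] at this
  exact this

end Places

end

section

open IsDedekindDomain NumberField LocalSquare Module TwoCocycle

namespace Places

variable {F K : Type*} [Field F] [NumberField F] [Field K] [NumberField K] [Algebra F K]

theorem exists_algebraMap_of_fixed [IsGalois F K] {x : K} (hx : ∀ g : K ≃ₐ[F] K, g x = x) :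
    ∃ y, x = algebraMap F K y := by
  obtain ⟨y, hy⟩ := IntermediateField.mem_bot.1 ((IsGalois.mem_bot_iff_fixed x).2 hx)
  exact ⟨y, hy.symm⟩

theorem exists_sign_generator [IsGalois F K] {H : Subgroup (K ≃ₐ[F] K)} (hH : H.index = 2) :
    ∃ (α : K) (a : F), α ≠ 0 ∧ α ^ 2 = algebraMap F K a ∧ ¬IsSquare a ∧
      (∀ g ∈ H, g α = α) ∧ ∀ g ∉ H, g α = -α := by
  have : FiniteDimensional F K := Module.Finite.right ℚ F K
  obtain ⟨h, hh⟩ : ∃ h, h ∉ H := by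
    by_contra! h
    rw [(Subgroup.eq_top_iff' H).2 h, Subgroup.index_top] at hH
    omega
  obtain ⟨x, hx, hhx⟩ : ∃ x, (∀ k ∈ H, k x = x) ∧ h x ≠ x := by
    by_contra! hno
    apply hh
    rw [← IntermediateField.fixingSubgroup_fixedField H]
    rintro ⟨x, hx⟩
    exact hno x fun k hk ↦ hx ⟨k, hk⟩
  have hinv : h⁻¹ ∉ H := fun h' ↦ hh (inv_mem_iff.1 h')
  have hkh : ∀ k ∈ H, k (h x) = h x := fun k hk ↦ by
    have h1 : h⁻¹ * k ∉ H := fun h' ↦ hinv (by simpa using mul_mem h' (inv_mem hk))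
    have h2 := hx _ (mul_mem_of_index_two hH h1 hh)
    have h3 : k (h x) = h ((h⁻¹ * k * h) x) := by
      rw [← AlgEquiv.mul_apply, ← AlgEquiv.mul_apply]
      congr 1
      group
    rw [h3, h2]
  have hhh : h (h x) = x := hx _ (mul_mem_of_index_two hH hh hh)
  have hα0 : x - h x ≠ 0 := fun h' ↦ hhx (sub_eq_zero.1 h').symm
  have hα1 : ∀ g ∈ H, g (x - h x) = x - h x := fun g hg ↦ by rw [map_sub, hx g hg, hkh g hg]
  have hα2 : ∀ g ∉ H, g (x - h x) = -(x - h x) := fun g hg ↦ by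
    have h1 := hα1 _ (mul_mem_of_index_two hH hinv hg)
    have h2 : g (x - h x) = h ((h⁻¹ * g) (x - h x)) := by
      rw [← AlgEquiv.mul_apply]
      congr 1
      group
    rw [h2, h1, map_sub, hhh, neg_sub]
  obtain ⟨a, ha⟩ := exists_algebraMap_of_fixed (F := F) (x := (x - h x) ^ 2) fun g ↦ by
    rw [map_pow]
    by_cases hg : g ∈ H
    · rw [hα1 g hg]
    · rw [hα2 g hg, neg_sq]
  refine ⟨_, a, hα0, ha, ?_, hα1, hα2⟩
  rintro ⟨d, rfl⟩
  have h1 : h (x - h x) = x - h x := by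
    rw [map_mul, ← pow_two] at ha
    rcases sq_eq_sq_iff_eq_or_eq_neg.1 ha with h3 | h3
    · rw [h3, AlgEquiv.commutes]
    · rw [h3, map_neg, AlgEquiv.commutes]
  rw [hα2 h hh, neg_eq_iff_add_eq_zero, ← two_mul] at h1
  exact hα0 (by simpa using h1)

theorem exists_cobd_step [IsGalois F K] {S : Set ℕ} (hS : OneModEight S)
    (hreal : ∀ φ : K →+* ℂ, ∀ x, (φ x).im = 0) (hL : LocAdm S S K)
    (hG : IsPGroup 2 (K ≃ₐ[F] K)) {H : Subgroup (K ≃ₐ[F] K)} (hH : H.index = 2)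
    {c : (K ≃ₐ[F] K) → (K ≃ₐ[F] K) → Kˣ} (hc : IsCoc c) (hpm : ∀ g k, c g k = 1 ∨ c g k = -1)
    (hy : ∃ y : (K ≃ₐ[F] K) → Kˣ, ∀ k ∈ H, ∀ l ∈ H, c k l = cobd y k l) :
    ∃ β, ∀ g k, c g k = cobd β g k := by
  classical
  have : FiniteDimensional F K := Module.Finite.right ℚ F K
  obtain ⟨β, b, hb, hβ⟩ := exists_inflated hH
    (fun f hf ↦ hilbert90 (φ := H.subtype) H.subtype_injective f hf) hc hy
  obtain ⟨bF, hbF⟩ := exists_algebraMap_of_fixed (F := F) (x := (b : K)) fun g ↦ by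
    exact congrArg Units.val (hb g)
  obtain ⟨α, a, hα0, hα, ha, hα1, hα2⟩ := exists_sign_generator (F := F) hH
  have hb0 : bF ≠ 0 := by
    rintro rfl
    rw [map_zero] at hbF
    exact b.ne_zero hbF
  have hpmv : ∀ (w : Pl K) g k, vl w (c g k : K) = 1 := fun w g k ↦ by
    rcases hpm g k with h | h <;> simp [h]
  have hin : ∀ g ∈ H, ∀ k, c g k = cobd β g k := fun g hg k ↦ by
    rw [hβ, if_pos (Or.inl hg), one_mul]
  have hβ1 : (β 1 : K) = 1 ∨ (β 1 : K) = -1 := by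
    have h1 := hin 1 (one_mem H) 1
    have h2 : cobd β 1 1 = β 1 := by simp [cobd]
    rw [← h2, ← h1]
    rcases hpm 1 1 with h | h <;> simp [h]
  have hchh : ∀ h ∉ H, (c h h : K) = algebraMap F K bF * (β h * h (β h) / β (h * h)) := by
    intro h hh
    rw [hβ, if_neg (by simpa using hh), ← hbF]
    simp [cobd]
  obtain ⟨p, q, hpq⟩ := exists_norm_of_local (F := F) (a := a) (b := bF)
    (card_eq_finrank_of_real (real_of_ext (K := K) hreal)) ha (fun φ ↦ by
      obtain ⟨ψ, hψ⟩ := exists_real_extension hreal φ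
      rw [← hψ, ← hα, map_pow]
      have : ψ α ≠ 0 := by simpa using hα0
      positivity) (fun v hv ↦ by
      obtain ⟨w, rfl⟩ := exists_comapPl_eq (algebraMap F K) v
      have hw : IsQ2 w := hL.isQ2 hS fun h ↦ hv (by rwa [comapPl_eq_one, map_ofNat])
      exact ⟨comapPl_isQ2 _ hw, LS_of_even _ hw hα hα0⟩) hb0 fun v hv hav ↦ by
    obtain ⟨w, rfl⟩ := exists_comapPl_eq (algebraMap F K) v
    have hw2 : vl w 2 = 1 := by rwa [comapPl_eq_one, map_ofNat] at hv
    obtain ⟨h, hh, hhw⟩ := exists_decomp hG hα hα0 hα1 hα2 w hw2 hav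
    have hhx : ∀ x, vl w (h x) = vl w x := fun x ↦ by rw [← vl_comapPl_algEquiv, hhw]
    by_cases hex : ∃ q ∈ S, vl w (q : K) ≠ 1
    · obtain ⟨q, hq, hqw⟩ := hex
      refine AN_of_tame (hS q hq).1 (hS q hq).2 hqw (hL.tame w q hq hqw) (hL.resid w q hq hqw) hG
        hw2 hhx hα hα0 (hα2 h hh) hav (β h).ne_zero fun hone ↦ ?_
      have h3 := hchh h hh
      rw [hone] at h3
      have h4 : (c h h : K) = 1 ∨ (c h h : K) = -1 := by
        rcases hpm h h with h | h <;> simp [h]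
      rcases hβ1 with h1 | h1 <;> rw [h1] at h3 <;> rcases h4 with h4 | h4 <;> rw [h4] at h3
      · left; simpa using h3.symm
      · right; simpa using h3.symm
      · right; rw [div_neg, div_one, mul_neg] at h3; rw [h3, neg_neg]
      · left; rw [div_neg, div_one, mul_neg, neg_inj] at h3; rw [h3]
    · push Not at hex
      refine AN_of_unram (β := β) (h := h) (k := h * h) (hL.unram w hex) hw2
        (fun x ↦ by rw [AlgEquiv.mul_apply, hhx, hhx]) hhx (fun n ↦ ?_) ?_ hα hα0 ?_
      · rw [← hin _ (mul_mem_of_index_two hH hh hh), hpmv]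
      · rcases hβ1 with h1 | h1 <;> simp [h1]
      · rw [← hchh h hh, hpmv]
  obtain ⟨h, hh⟩ : ∃ h, h ∉ H := by
    by_contra! h
    rw [(Subgroup.eq_top_iff' H).2 h, Subgroup.index_top] at hH
    omega
  set y : K := algebraMap F K p + algebraMap F K q * α with hydef
  have hyb : y * h y = b := by
    rw [hbF, hpq, hydef, map_add, map_mul, AlgEquiv.commutes, AlgEquiv.commutes, hα2 h hh, map_sub,
      map_mul, map_pow, map_pow, ← hα]
    ring
  have hy0 : y ≠ 0 := by
    intro h0
    rw [h0, zero_mul] at hyb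
    exact b.ne_zero hyb.symm
  refine exists_cobd_of_norm hH hh hβ (y := Units.mk0 y hy0) (fun k hk ↦ Units.ext ?_)
    (Units.ext hyb.symm)
  change k y = y
  rw [hydef, map_add, map_mul, AlgEquiv.commutes, AlgEquiv.commutes, hα1 k hk]


theorem exists_cobd [IsGalois ℚ K] {S : Set ℕ} (hS : OneModEight S)
    (hreal : ∀ φ : K →+* ℂ, ∀ x, (φ x).im = 0) (hL : LocAdm S S K)
    (hG : IsPGroup 2 (K ≃ₐ[ℚ] K)) {c : (K ≃ₐ[ℚ] K) → (K ≃ₐ[ℚ] K) → Kˣ} (hc : IsCoc c)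
    (hpm : ∀ g k, c g k = 1 ∨ c g k = -1) : ∃ β, ∀ g k, c g k = cobd β g k := by
  classical
  have key := induction_two_group hG
    (fun H ↦ ∃ y : (K ≃ₐ[ℚ] K) → Kˣ, ∀ k ∈ H, ∀ l ∈ H, c k l = cobd y k l)
    ⟨fun _ ↦ c 1 1, fun k hk l hl ↦ by
      rw [Subgroup.mem_bot.1 hk, Subgroup.mem_bot.1 hl]
      simp [cobd]⟩ fun H H' hle hidx hP ↦ by
    let E := IntermediateField.fixedField H'
    let r : (K ≃ₐ[E] K) →* (K ≃ₐ[ℚ] K) := AlgEquiv.restrictScalarsHom ℚ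
    have hr : Function.Injective r := AlgEquiv.restrictScalars_injective ℚ
    have hrange : r.range = H' := by
      rw [← IntermediateField.fixingSubgroup_fixedField H']
      ext g
      constructor
      · rintro ⟨k, rfl⟩
        exact fun x ↦ k.commutes x
      · intro hg
        exact ⟨{ g with commutes' := fun x ↦ hg x }, rfl⟩
    obtain ⟨y, hy⟩ := hP
    obtain ⟨β, hβ⟩ := exists_cobd_step (F := E) hS hreal hL (H := H.comap r)
      (c := fun g k ↦ c (r g) (r k)) (hG.of_injective r hr)
      (by rw [Subgroup.index_comap, hrange, hidx])
      (fun g h k ↦ by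
        have := hc (r g) (r h) (r k)
        rw [← map_mul, ← map_mul] at this
        exact this) (fun g k ↦ hpm _ _) ⟨y ∘ r, fun k hk l hl ↦ by
        have := hy _ hk _ hl
        rw [this]
        simp only [cobd, Function.comp_apply, map_mul]
        rfl⟩
    refine ⟨Function.extend r β 1, fun k hk l hl ↦ ?_⟩
    rw [← hrange] at hk hl
    obtain ⟨k, rfl⟩ := hk
    obtain ⟨l, rfl⟩ := hl
    have := hβ k l
    rw [this]
    simp only [cobd, ← map_mul, hr.extend_apply]
    rfl
  obtain ⟨y, hy⟩ := key
  exact ⟨y, fun g k ↦ hy g (Subgroup.mem_top _) k (Subgroup.mem_top _)⟩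

end Places

end

section

open IsDedekindDomain NumberField LocalSquare Module TwoCocycle

namespace Places

section lying

variable {K : Type*} [Field K] [NumberField K]

theorem vl_natCast_lt_one_iff (w : Pl K) (n : ℕ) :
    vl w (n : K) < 1 ↔ (n : 𝓞 K) ∈ w.asIdeal := by
  rw [← w.valuation_lt_one_iff_mem (K := K) (n : 𝓞 K)]
  simp

theorem exists_prime_vl (w : Pl K) : ∃ p : ℕ, p.Prime ∧ vl w (p : K) ≠ 1 := by
  have h1 := (vl_natCast_lt_one_iff w _).2 (Ideal.absNorm_mem w.asIdeal)
  by_contra! hno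
  have h2 : ∀ n : ℕ, n ≠ 0 → vl w (n : K) = 1 := by
    intro n
    induction n using Nat.recOnMul with
    | zero => simp
    | one => simp
    | prime p hp => exact fun _ ↦ hno p hp
    | mul a b ha hb =>
      intro hab
      rw [Nat.cast_mul, map_mul, ha (left_ne_zero_of_mul hab), hb (right_ne_zero_of_mul hab),
        mul_one]
  exact h1.ne (h2 _ fun h ↦ w.ne_bot (Ideal.absNorm_eq_zero_iff.1 h))

theorem exists_place_over (K : Type*) [Field K] [NumberField K] {p : ℕ} (hp : p.Prime) :
    ∃ w : Pl K, vl w (p : K) ≠ 1 := by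
  have hnu : ¬IsUnit (p : 𝓞 K) := by
    intro h
    have h1 := h.map (Algebra.norm ℤ)
    have h2 : (p : 𝓞 K) = algebraMap ℤ (𝓞 K) p := by simp
    rw [h2, Algebra.norm_algebraMap, isUnit_pow_iff, Int.isUnit_iff] at h1
    · have := hp.two_le
      omega
    · rw [RingOfIntegers.rank]
      exact finrank_pos.ne'
  obtain ⟨I, hI, hpI⟩ := Ideal.exists_le_maximal _ (mt Ideal.span_singleton_eq_top.1 hnu)
  have hmem : (p : 𝓞 K) ∈ I := hpI (Ideal.mem_span_singleton_self _)
  refine ⟨⟨I, hI.isPrime, ?_⟩, ?_⟩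
  · rintro rfl
    rw [Ideal.mem_bot, Nat.cast_eq_zero] at hmem
    exact hp.ne_zero hmem
  · exact ((vl_natCast_lt_one_iff _ p).2 hmem).ne

theorem exists_comapPl_of_over [IsGalois ℚ K] {w w' : Pl K} {p : ℕ} (hp : p.Prime)
    (hw : vl w (p : K) ≠ 1) (hw' : vl w' (p : K) ≠ 1) :
    ∃ σ : K ≃ₐ[ℚ] K, comapPl (σ : K →+* K) w = w' := by
  refine exists_comapPl_algEquiv (eq_of_le_one fun x hx ↦ ?_)
  rw [comapPl_le_one_iff, eq_ratCast] at hx ⊢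
  by_cases hx0 : x = 0
  · simp [hx0]
  obtain ⟨k, hk⟩ := exists_forall_vl_ratCast_eq K hp hx0
  have hpK : (p : K) ≠ 0 := by exact_mod_cast hp.ne_zero
  rw [hk w' hw']
  rw [hk w hw] at hx
  have hk0 : 0 ≤ k := by
    by_contra! hk0
    refine absurd hx (not_le.2 ?_)
    exact one_lt_zpow_of_neg₀ (vl_pos w hpK) (vl_natCast_lt w hw) hk0
  lift k to ℕ using hk0
  rw [zpow_natCast]
  exact pow_le_one₀ zero_le (vl_natCast_lt w' hw').le

theorem LS_comapPl_of_sq [IsGalois ℚ K] {w : Pl K} {η : K} (h : LS (vl w) η)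
    (σ : K ≃ₐ[ℚ] K) {b : K} (hb : b ≠ 0) (hσ : σ η = η * b ^ 2) :
    LS (vl (comapPl (σ : K →+* K) w)) η := by
  rw [← LS.mul_sq_iff hb, ← hσ] at h
  obtain ⟨z, hz⟩ := h
  refine ⟨σ.symm z, ?_⟩
  rw [vl_comapPl_algEquiv, vl_comapPl_algEquiv, map_sub, map_pow, σ.apply_symm_apply, map_mul,
    map_ofNat]
  exact hz

theorem even_od_comapPl {w : Pl K} {γ : K} (hγ : γ ≠ 0) (h : Even (od w γ))
    (σ : K ≃ₐ[ℚ] K) {b : K} (hb : b ≠ 0) (hσ : σ γ = γ * b ^ 2) :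
    Even (od (comapPl (σ : K →+* K) w) γ) := by
  have h1 : od (comapPl (σ : K →+* K) w) γ = od w (σ γ) := by
    unfold od
    rw [vl_comapPl_algEquiv]
  rw [h1, hσ, od_mul w hγ (pow_ne_zero _ hb), od_pow]
  exact h.add (by simp)

/-- The rational prime is a uniformizer at an unramified place. -/
theorem odd_od_of_unram {w : Pl K} (hun : ∀ x : K, x ≠ 0 → ∃ z : ℚ, vl w x = vl w (z : K))
    {p : ℕ} (hp : p.Prime) (hw : vl w (p : K) ≠ 1) : Odd (od w (p : K)) := by
  have hpK : (p : K) ≠ 0 := by exact_mod_cast hp.ne_zero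
  obtain ⟨t, ht0, ht⟩ := exists_od_eq w 1
  obtain ⟨z, hz⟩ := hun t ht0
  obtain ⟨k, hk⟩ := exists_vl_ratCast_eq w hp hw (ratCast_ne_zero_of_vl (n := 1) ht0
    (by rw [pow_one, hz]))
  have h1 : od w t = k * od w (p : K) := by
    rw [← od_zpow]
    unfold od
    rw [hz, hk, map_zpow₀]
  rw [ht] at h1
  have h2 : Odd (k * od w (p : K)) := h1 ▸ odd_one
  exact (Int.odd_mul.1 h2).2

end lying

end Places

end

section

open IsDedekindDomain NumberField LocalSquare Module TwoCocycle

namespace Places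

variable {K : Type*} [Field K] [NumberField K]

theorem exists_even_rat_mul [IsGalois ℚ K] {S : Set ℕ} (hL : LocAdm S S K)
    {γ : K} (hγ : γ ≠ 0) (hsq : ∀ σ : K ≃ₐ[ℚ] K, ∃ b, b ≠ 0 ∧ σ γ = γ * b ^ 2) :
    ∃ r : ℚ, r ≠ 0 ∧ ∀ w : Pl K, vl w 2 = 1 → (∀ q ∈ S, vl w (q : K) = 1) →
      Even (od w (r * γ)) := by
  classical
  set P : Set ℕ := {p | p.Prime ∧ ∃ w : Pl K, vl w (p : K) ≠ 1 ∧ Odd (od w γ)} with hPdef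
  have hmem : ∀ {p}, p ∈ P ↔ p.Prime ∧ ∃ w : Pl K, vl w (p : K) ≠ 1 ∧ Odd (od w γ) := Iff.rfl
  have huniq : ∀ (w : Pl K) {p p' : ℕ}, p.Prime → p'.Prime → vl w (p : K) ≠ 1 →
      vl w (p' : K) ≠ 1 → p = p' := fun w p p' hp hp' h h' ↦ by
    by_contra hne
    exact h' (vl_natCast_prime_eq_one w hp hp' hne h)
  have hPfin : P.Finite := by
    refine ((finite_ne_one hγ).biUnion (t := fun w ↦ {p : ℕ | p.Prime ∧ vl w (p : K) ≠ 1})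
      fun w _ ↦ Set.Subsingleton.finite fun p hp p' hp' ↦
        huniq w hp.1 hp'.1 hp.2 hp'.2).subset ?_
    rintro p ⟨hp, w, hw, hodd⟩
    refine Set.mem_biUnion (x := w) ?_ ⟨hp, hw⟩
    intro h
    rw [← od_eq_zero w hγ] at h
    rw [h] at hodd
    exact absurd hodd (by decide)
  lift P to Finset ℕ using hPfin with P' hP'
  simp only [Finset.mem_coe] at hmem
  refine ⟨((∏ p ∈ P', p : ℕ) : ℚ), ?_, fun w h2 hw ↦ ?_⟩
  · rw [Nat.cast_ne_zero, Finset.prod_ne_zero_iff]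
    exact fun p hp ↦ (hmem.1 hp).1.ne_zero
  obtain ⟨p, hp, hwp⟩ := exists_prime_vl w
  have hr0 : (((∏ p ∈ P', p : ℕ) : ℚ) : K) ≠ 0 := by
    rw [Rat.cast_natCast, Nat.cast_ne_zero, Finset.prod_ne_zero_iff]
    exact fun p hp ↦ (hmem.1 hp).1.ne_zero
  have hone : ∀ s : Finset ℕ, s ⊆ P' → p ∉ s → vl w ((∏ p ∈ s, p : ℕ) : K) = 1 := by
    intro s hs hps
    rw [Nat.cast_prod, map_prod]
    refine Finset.prod_eq_one fun p' hp' ↦ ?_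
    by_contra h
    exact hps (huniq w hp (hmem.1 (hs hp')).1 hwp h ▸ hp')
  rw [od_mul w hr0 hγ]
  by_cases hpP : p ∈ P'
  · have h1 : od w (((∏ p ∈ P', p : ℕ) : ℚ) : K) = od w (p : K) := by
      unfold od
      rw [Rat.cast_natCast, ← Finset.mul_prod_erase P' (fun p ↦ p) hpP, Nat.cast_mul, map_mul,
        hone _ (Finset.erase_subset _ _) (Finset.notMem_erase _ _), mul_one]
    rw [h1]
    refine (odd_od_of_unram (hL.unram w hw) hp hwp).add_odd ?_
    obtain ⟨-, w', hw', hodd⟩ := hmem.1 hpP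
    by_contra hev
    rw [Int.not_odd_iff_even] at hev
    obtain ⟨σ, rfl⟩ := exists_comapPl_of_over hp hwp hw'
    obtain ⟨b, hb, hσ⟩ := hsq σ
    exact (Int.not_even_iff_odd.2 hodd) (even_od_comapPl hγ hev σ hb hσ)
  · have h1 : od w (((∏ p ∈ P', p : ℕ) : ℚ) : K) = 0 := by
      rw [od_eq_zero w hr0, Rat.cast_natCast, hone _ subset_rfl hpP]
    rw [h1, zero_add]
    by_contra h
    exact hpP (hmem.2 ⟨hp, w, hwp, Int.not_even_iff_odd.1 h⟩)

/-- The sign attached to a residue modulo two. -/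
def sgn (K : Type*) [Field K] (x : ZMod 2) : Kˣ := if x = 0 then 1 else -1

omit [NumberField K] in
theorem sgn_add (x y : ZMod 2) : sgn K (x + y) = sgn K x * sgn K y := by
  have h2 : (1 + 1 : ZMod 2) = 0 := by decide
  have h3 : ∀ z : ZMod 2, z = 0 ∨ z = 1 := by decide
  rcases h3 x with rfl | rfl <;> rcases h3 y with rfl | rfl <;> simp [sgn, h2]

omit [NumberField K] in
theorem sgn_sq (x : ZMod 2) : sgn K x ^ 2 = 1 := by
  unfold sgn
  split_ifs <;> simp

omit [NumberField K] in
theorem sgn_or (x : ZMod 2) : sgn K x = 1 ∨ sgn K x = -1 := by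
  unfold sgn
  split_ifs <;> simp

theorem neg_one_ne_one_units : (-1 : Kˣ) ≠ 1 := by
  intro h
  have h2 := congrArg Units.val h
  rw [Units.val_neg, Units.val_one, neg_eq_iff_add_eq_zero] at h2
  norm_num at h2

theorem sgn_injective : Function.Injective (sgn K) := by
  have h1 := neg_one_ne_one_units (K := K)
  intro x y h
  fin_cases x <;> fin_cases y <;> first | rfl | skip
  · simp [sgn] at h
    exact (h1 h.symm).elim
  · simp [sgn] at h
    exact (h1 h).elim

theorem smul_sgn (g : K ≃ₐ[ℚ] K) (x : ZMod 2) : g • sgn K x = sgn K x := by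
  refine Units.ext ?_
  change g (sgn K x : K) = _
  rcases sgn_or (K := K) x with h | h <;> simp [h]

omit [NumberField K] in
theorem exists_sgn_eq {x : Kˣ} (hx : x ^ 2 = 1) : ∃ y, sgn K y = x := by
  have h1 : (x : K) ^ 2 = 1 := by rw [← Units.val_pow_eq_pow_val, hx, Units.val_one]
  rcases sq_eq_sq_iff_eq_or_eq_neg.1 (h1.trans (one_pow 2).symm) with h | h
  · exact ⟨0, Units.ext (by simp [sgn, h])⟩
  · exact ⟨1, Units.ext (by simp [sgn, h])⟩

theorem exists_obstruction_data [IsGalois ℚ K] {S : Set ℕ} (hS : OneModEight S)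
    (hreal : ∀ φ : K →+* ℂ, ∀ x, (φ x).im = 0) (hL : LocAdm S S K)
    (hG : IsPGroup 2 (K ≃ₐ[ℚ] K)) {c : (K ≃ₐ[ℚ] K) → (K ≃ₐ[ℚ] K) → ZMod 2}
    (hc : GolodShafarevich.IsCocycle c) :
    ∃ (β : (K ≃ₐ[ℚ] K) → Kˣ) (γ : Kˣ), (∀ g k, sgn K (c g k) = cobd β g k) ∧
      (∀ g, β g ^ 2 = g • γ / γ) ∧
      ∀ w : Pl K, vl w 2 = 1 → (∀ q ∈ S, vl w (q : K) = 1) → Even (od w (γ : K)) := by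
  obtain ⟨β, hβ⟩ := exists_cobd hS hreal hL hG (c := fun g k ↦ sgn K (c g k))
    (fun g h k ↦ by
      rw [smul_sgn, ← sgn_add, ← sgn_add, add_comm (c (g * h) k), hc.cocycle])
    fun g k ↦ sgn_or _
  obtain ⟨γ, hγ⟩ := hilbert90 (φ := MonoidHom.id (K ≃ₐ[ℚ] K)) Function.injective_id
    (fun g ↦ β g ^ 2) fun k l ↦ by
      have h1 := congrArg (· ^ 2) (hβ k l)
      simp only [sgn_sq, cobd, div_pow, mul_pow] at h1
      rw [eq_comm, div_eq_one] at h1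
      rw [← h1, MonoidHom.id_apply, smul_pow']
  obtain ⟨r, hr0, hr⟩ := exists_even_rat_mul hL γ.ne_zero fun σ ↦ ⟨β σ, (β σ).ne_zero, by
    have h1 : γ * β σ ^ 2 = σ • γ := by
      rw [hγ σ]
      exact mul_div_cancel γ _
    exact (congrArg Units.val h1).symm⟩
  have hrK : (r : K) ≠ 0 := by exact_mod_cast hr0
  refine ⟨β, Units.mk0 (r : K) hrK * γ, hβ, fun g ↦ ?_, fun w h2 hw ↦ by simpa using hr w h2 hw⟩
  have h1 : g • Units.mk0 (r : K) hrK = Units.mk0 (r : K) hrK := Units.ext (by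
    change g (r : K) = r
    simp)
  rw [smul_mul', h1, mul_div_mul_left_eq_div]
  exact hγ g

end Places

end

section

open IsDedekindDomain NumberField LocalSquare Module TwoCocycle

namespace Places

variable {K : Type*} [Field K] [NumberField K]

/-- Every number whose square root would generate a suitable extension is a square. -/
def IsTop (S : Set ℕ) (K : Type*) [Field K] [NumberField K] : Prop :=
  ∀ η : K, η ≠ 0 → (∀ σ : K ≃ₐ[ℚ] K, ∃ b, b ≠ 0 ∧ σ η = η * b ^ 2) → (∀ φ : K →+* ℝ, 0 < φ η) →
    (∀ w : Pl K, vl w 2 = 1 → (∀ q ∈ S, vl w (q : K) = 1) → Even (od w η)) →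
    (∀ w : Pl K, vl w 2 ≠ 1 → LS (vl w) η) →
    (∀ w : Pl K, ∀ q ∈ S, vl w (q : K) ≠ 1 → LS (vl w) η) → IsSquare η

theorem exists_coboundary_of_square {c c' : (K ≃ₐ[ℚ] K) → (K ≃ₐ[ℚ] K) → ZMod 2}
    {β β' : (K ≃ₐ[ℚ] K) → Kˣ} {γ γ' δ : Kˣ} (hβ : ∀ g k, sgn K (c g k) = cobd β g k)
    (hβ' : ∀ g k, sgn K (c' g k) = cobd β' g k) (hγ : ∀ g, β g ^ 2 = g • γ / γ)
    (hγ' : ∀ g, β' g ^ 2 = g • γ' / γ') (hδ : γ = γ' * δ ^ 2) :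
    ∃ b : (K ≃ₐ[ℚ] K) → ZMod 2, ∀ x y, c x y - c' x y = b x + b y - b (x * y) := by
  have h1 : ∀ g, (β g / (β' g * (g • δ / δ))) ^ 2 = 1 := fun g ↦ by
    rw [div_pow, mul_pow, div_pow, hγ, hγ', hδ, smul_mul', smul_pow', div_mul_div_comm, div_self']
  choose b hb using fun g ↦ exists_sgn_eq (h1 g)
  have hb' : ∀ g, β g = sgn K (b g) * (β' g * (g • δ / δ)) := fun g ↦ by
    rw [hb, div_mul_cancel]
  refine ⟨b, fun x y ↦ ?_⟩
  have h2 : c x y + b (x * y) = c' x y + (b x + b y) := by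
    refine sgn_injective (K := K) ?_
    rw [sgn_add, sgn_add, sgn_add, hβ, hβ']
    unfold cobd
    rw [hb' x, hb' y, hb' (x * y), smul_mul', smul_mul', smul_sgn, smul_div', mul_smul]
    refine Units.ext ?_
    push_cast
    have d0 : ((δ : Kˣ) : K) ≠ 0 := δ.ne_zero
    have d1 := (x • δ).ne_zero
    have d2 := (x • y • δ).ne_zero
    have d3 := (β' (x * y)).ne_zero
    have d4 := (sgn K (b (x * y))).ne_zero
    field_simp
  linear_combination h2

/-- The Galois group acts transitively on the real embeddings. -/
theorem exists_real_comp [IsGalois ℚ K] (φ ψ : K →+* ℝ) :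
    ∃ σ : K ≃ₐ[ℚ] K, ∀ x, ψ x = φ (σ x) := by
  obtain ⟨σ, hσ⟩ := ComplexEmbedding.exists_comp_symm_eq_of_comp_eq (k := ℚ)
    (Complex.ofRealHom.comp φ) (Complex.ofRealHom.comp ψ) (RingHom.ext fun x ↦ by simp)
  refine ⟨σ.symm, fun x ↦ ?_⟩
  have := RingHom.congr_fun hσ x
  simpa using this.symm

/-- The quadratic characters attached to square roots of distinct primes are independent. -/
theorem exists_independent_chars [IsGalois ℚ K] {S : Finset ℕ} (hS : ∀ q ∈ S, q.Prime)
    (hroot : ∀ q ∈ S, IsSquare (q : K)) {n : ℕ} (hn : S.card = n) :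
    ∃ χ : Fin n → (K ≃ₐ[ℚ] K) → ZMod 2, (∀ i x y, χ i (x * y) = χ i x + χ i y) ∧
      LinearIndependent (ZMod 2) χ := by
  classical
  let e := (S.equivFinOfCardEq hn).symm
  have hq : ∀ i, (e i : ℕ).Prime := fun i ↦ hS _ (e i).2
  choose s hs using fun i ↦ hroot (e i) (e i).2
  have hs0 : ∀ i, s i ≠ 0 := fun i h ↦ by
    have := hs i
    rw [h, mul_zero, Nat.cast_eq_zero] at this
    exact (hq i).ne_zero this
  have hχ : ∀ i (g : K ≃ₐ[ℚ] K), ∃ x : ZMod 2, g (s i) = sgn K x * s i := fun i g ↦ by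
    have h1 : g (s i) ^ 2 = s i ^ 2 := by
      rw [← map_pow, pow_two, ← hs, map_natCast]
    rcases sq_eq_sq_iff_eq_or_eq_neg.1 h1 with h | h
    · exact ⟨0, by simp [sgn, h]⟩
    · exact ⟨1, by simp [sgn, h]⟩
  choose χ hχ using hχ
  refine ⟨χ, fun i x y ↦ ?_, ?_⟩
  · have h1 := hχ i (x * y)
    have h2 : x (sgn K (χ i y) : K) = sgn K (χ i y) := congrArg Units.val (smul_sgn x (χ i y))
    rw [AlgEquiv.mul_apply, hχ i y, map_mul, h2, hχ i x, ← mul_assoc] at h1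
    refine sgn_injective (K := K) (Units.ext ?_)
    rw [sgn_add, Units.val_mul, mul_comm (sgn K (χ i x) : K)]
    exact (mul_right_cancel₀ (hs0 i) h1).symm
  · rw [Fintype.linearIndependent_iff]
    intro a ha i0
    by_contra hai
    set A : Finset (Fin n) := Finset.univ.filter fun i ↦ a i ≠ 0 with hA
    set m : K := ∏ i ∈ A, s i with hm
    have h01 : ∀ z : ZMod 2, z = 0 ∨ z = 1 := by decide
    have hfix : ∀ g : K ≃ₐ[ℚ] K, g m = m := fun g ↦ by
      have h1 : ∑ i ∈ A, χ i g = 0 := by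
        have h2 := congrFun ha g
        rw [Finset.sum_apply] at h2
        refine Eq.trans ?_ h2
        rw [hA, Finset.sum_filter]
        refine Finset.sum_congr rfl fun i _ ↦ ?_
        rcases h01 (a i) with h | h <;> simp [h]
      have h3 : ∀ B : Finset (Fin n), ∏ i ∈ B, sgn K (χ i g) = sgn K (∑ i ∈ B, χ i g) := by
        intro B
        induction B using Finset.induction_on with
        | empty => simp [sgn]
        | insert i B hi ih => rw [Finset.prod_insert hi, Finset.sum_insert hi, sgn_add, ih]
      rw [hm, map_prod]
      simp only [hχ]
      rw [Finset.prod_mul_distrib, ← Units.coe_prod, h3, h1]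
      simp [sgn]
    obtain ⟨y, hy⟩ := exists_algebraMap_of_fixed (F := ℚ) hfix
    have hy2 : y ^ 2 = ((∏ i ∈ A, (e i : ℕ) : ℕ) : ℚ) := by
      have h4 : (algebraMap ℚ K) (y ^ 2) = algebraMap ℚ K ((∏ i ∈ A, (e i : ℕ) : ℕ) : ℚ) := by
        rw [map_pow, ← hy, hm, map_natCast, Nat.cast_prod, ← Finset.prod_pow]
        exact Finset.prod_congr rfl fun i _ ↦ by rw [hs, pow_two]
      exact (algebraMap ℚ K).injective h4
    have hi0 : i0 ∈ A := by simp [hA, hai]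
    have := Fact.mk (hq i0)
    have hy0 : y ≠ 0 := by
      rintro rfl
      rw [zero_pow two_ne_zero, eq_comm, Nat.cast_eq_zero, Finset.prod_eq_zero_iff] at hy2
      obtain ⟨i, -, hi⟩ := hy2
      exact (hq i).ne_zero hi
    have h5 := congrArg (padicValRat (e i0 : ℕ)) hy2
    have h6 : ¬(e i0 : ℕ) ∣ ∏ i ∈ A.erase i0, (e i : ℕ) := by
      rw [Prime.dvd_finsetProd_iff (hq i0).prime]
      rintro ⟨i, hi, hd⟩
      have := (Nat.prime_dvd_prime_iff_eq (hq i0) (hq i)).1 hd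
      exact (Finset.mem_erase.1 hi).1 (e.injective (Subtype.ext this.symm))
    have h7 : ∏ i ∈ A.erase i0, (e i : ℕ) ≠ 0 :=
      Finset.prod_ne_zero_iff.2 fun i _ ↦ (hq i).ne_zero
    rw [padicValRat.pow, padicValRat.of_nat, ← Finset.mul_prod_erase A _ hi0,
      padicValNat.mul (hq i0).ne_zero h7, padicValNat_self,
      padicValNat.eq_zero_of_not_dvd h6] at h5
    push_cast at h5
    omega

theorem false_of_isTop [IsGalois ℚ K] {S : Finset ℕ} (hS : OneModEight S) (hcard : S.card = 10)
    (hroot : ∀ q ∈ S, IsSquare (q : K)) (hreal : ∀ φ : K →+* ℂ, ∀ x, (φ x).im = 0)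
    (hL : LocAdm S S K) (hG : IsPGroup 2 (K ≃ₐ[ℚ] K)) (hT : IsTop S K) : False := by
  classical
  obtain ⟨χ, hχ, hind⟩ := exists_independent_chars (fun q hq ↦ (hS q hq).1) hroot hcard
  obtain ⟨φ, -⟩ := exists_real_extension (F := ℚ) hreal (Rat.castHom ℝ)
  obtain ⟨w2, hw2⟩ := exists_place_over K Nat.prime_two
  rw [Nat.cast_ofNat] at hw2
  choose wq hwq using fun q : S ↦ exists_place_over K (hS q q.2).1
  have hi2 := index_lsGroup_two w2 (hL.isQ2 hS hw2)
  have hiq : ∀ q, _ := fun q ↦ index_lsGroup_odd (wq q) (hS.vl_two q.2 (hwq q))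
  have : Finite (Kˣ ⧸ lsGroup (vl w2)) := Nat.finite_of_card_ne_zero hi2.1
  have : ∀ q, Finite (Kˣ ⧸ lsGroup (vl (wq q))) := fun q ↦ Nat.finite_of_card_ne_zero (hiq q).1
  have hex : ∀ c : (K ≃ₐ[ℚ] K) → (K ≃ₐ[ℚ] K) → ZMod 2, ∃ (β : (K ≃ₐ[ℚ] K) → Kˣ) (γ : Kˣ),
      GolodShafarevich.IsCocycle c → (∀ g k, sgn K (c g k) = cobd β g k) ∧
      (∀ g, β g ^ 2 = g • γ / γ) ∧
      ∀ w : Pl K, vl w 2 = 1 → (∀ q ∈ S, vl w (q : K) = 1) → Even (od w (γ : K)) := fun c ↦ by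
    by_cases hc : GolodShafarevich.IsCocycle c
    · obtain ⟨β, γ, h⟩ := exists_obstruction_data hS hreal hL hG hc
      exact ⟨β, γ, fun _ ↦ h⟩
    · exact ⟨1, 1, fun h ↦ (hc h).elim⟩
  choose β γ hβγ using hex
  refine GolodShafarevich.not_finite_of_chars
    (T := Bool × (Kˣ ⧸ lsGroup (vl w2)) × ∀ q : S, Kˣ ⧸ lsGroup (vl (wq q))) hG (r := 24)
    (by norm_num) (by norm_num) χ hχ hind ?_ (fun c ↦ (decide (0 < φ (γ c)),
      QuotientGroup.mk (γ c), fun q ↦ QuotientGroup.mk (γ c))) ?_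
  · rw [Nat.card_prod, Nat.card_prod, Nat.card_pi]
    have h1 : ∏ q : S, Nat.card (Kˣ ⧸ lsGroup (vl (wq q))) ≤ 4 ^ 10 := by
      refine (Finset.prod_le_pow_card _ _ 4 fun q _ ↦ (hiq q).2).trans ?_
      rw [Finset.card_univ, Fintype.card_coe, hcard]
    have h2 : Nat.card (Kˣ ⧸ lsGroup (vl w2)) ≤ 8 := hi2.2
    calc Nat.card Bool * (Nat.card (Kˣ ⧸ lsGroup (vl w2)) *
          ∏ q : S, Nat.card (Kˣ ⧸ lsGroup (vl (wq q)))) ≤ 2 * (8 * 4 ^ 10) := by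
          gcongr
          simp
      _ ≤ 2 ^ 24 := by norm_num
  · intro c c' hc hc' he
    obtain ⟨hβ, hγ, hev⟩ := hβγ c hc
    obtain ⟨hβ', hγ', hev'⟩ := hβγ c' hc'
    simp only [Prod.mk.injEq, decide_eq_decide, QuotientGroup.eq, funext_iff] at he
    obtain ⟨he0, he2, heq⟩ := he
    have hrel : ∀ σ : K ≃ₐ[ℚ] K, σ • ((γ c)⁻¹ * γ c') =
        (γ c)⁻¹ * γ c' * ((β c σ)⁻¹ * β c' σ) ^ 2 := fun σ ↦ by
      rw [mul_pow, inv_pow, hγ, hγ', smul_mul', smul_inv']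
      refine Units.ext ?_
      push_cast
      have := (σ • γ c).ne_zero
      field_simp
    have hrel' : ∀ σ : K ≃ₐ[ℚ] K, σ ((γ c)⁻¹ * γ c' : Kˣ) =
        ((γ c)⁻¹ * γ c' : Kˣ) * (((β c σ)⁻¹ * β c' σ : Kˣ) : K) ^ 2 := fun σ ↦
      congrArg Units.val (hrel σ)
    have hsq := hT ((γ c)⁻¹ * γ c' : Kˣ) (Units.ne_zero _)
      (fun σ ↦ ⟨_, Units.ne_zero _, hrel' σ⟩) (fun ψ ↦ ?_) (fun w h2 hw ↦ ?_) (fun w hw ↦ ?_)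
      fun w q hq hw ↦ ?_
    · obtain ⟨δ, hδ⟩ := hsq
      have hδ0 : δ ≠ 0 := by
        rintro rfl
        rw [mul_zero] at hδ
        exact Units.ne_zero _ hδ
      refine exists_coboundary_of_square hβ hβ' hγ hγ' (δ := (Units.mk0 δ hδ0)⁻¹) ?_
      have h3 : (γ c)⁻¹ * γ c' = Units.mk0 δ hδ0 ^ 2 := Units.ext (by
        rw [hδ, Units.val_pow_eq_pow_val, Units.val_mk0, pow_two])
      rw [inv_pow, ← h3]
      group
    · obtain ⟨σ, hσ⟩ := exists_real_comp φ ψ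
      rw [hσ, hrel', map_mul, map_pow]
      refine mul_pos ?_ (by
        have : φ (((β c σ)⁻¹ * β c' σ : Kˣ) : K) ≠ 0 := by simp
        positivity)
      have h3 : φ (γ c : K) ≠ 0 := by simp
      have h4 : φ (γ c' : K) ≠ 0 := by simp
      rw [Units.val_mul, map_mul, Units.val_inv_eq_inv_val, map_inv₀]
      rcases lt_or_gt_of_ne h3 with h5 | h5
      · have h6 : φ (γ c' : K) < 0 := lt_of_le_of_ne (not_lt.1 fun h ↦ h5.not_gt (he0.2 h)) h4
        exact mul_pos_of_neg_of_neg (inv_lt_zero.2 h5) h6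
      · exact mul_pos (inv_pos.2 h5) (he0.1 h5)
    · rw [Units.val_mul, od_mul w (Units.ne_zero _) (Units.ne_zero _), Units.val_inv_eq_inv_val,
        od_inv]
      exact (hev w h2 hw).neg.add (hev' w h2 hw)
    · obtain ⟨σ, rfl⟩ := exists_comapPl_of_over Nat.prime_two (w := w2) (w' := w)
        (by rwa [Nat.cast_ofNat]) (by rwa [Nat.cast_ofNat])
      exact LS_comapPl_of_sq he2 σ (Units.ne_zero _) (hrel' σ)
    · obtain ⟨σ, rfl⟩ := exists_comapPl_of_over (hS q hq).1 (hwq ⟨q, hq⟩) hw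
      exact LS_comapPl_of_sq (heq ⟨q, hq⟩) σ (Units.ne_zero _) (hrel' σ)

end Places

end

section

open IsDedekindDomain NumberField LocalSquare Module Places

theorem Places.vl_two_of_comapPl {F M : Type*} [Field F] [Field M] [NumberField F]
    [NumberField M] (f : F →+* M) {w : Pl M} (h2 : vl (comapPl f w) 2 = 1) : vl w 2 = 1 := by
  have := (comapPl_eq_one f w).1 h2
  rwa [show f 2 = 2 from map_ofNat _ 2] at this

namespace IsQuad

variable {F M : Type*} [Field F] [Field M] [NumberField F] [NumberField M] [Algebra F M]
  {x : F} {u : M} {σ : M ≃ₐ[F] M}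

/-- At primes where `x` is a local square there is an idempotent approximation. -/
theorem exists_splitting (h : IsQuad x u σ) {w : Pl M}
    (hx : LS (vl (comapPl (algebraMap F M) w)) x) {y : M} (hy : y ≠ 0) :
    ∃ t : M, vl w (t - y) < vl w y ∧ vl w (σ t) < vl w y := by
  classical
  have hne := h.comapPl_conj_ne hx
  have hσy : σ y ≠ 0 := (map_ne_zero_iff σ σ.injective).2 hy
  obtain ⟨t, ht⟩ := exists_approx (S := {w, comapPl (σ : M →+* M) w}) (Set.toFinite _)
    (fun w' ↦ if w' = w then y else 0) (fun w' ↦ if w' = w then y else σ y)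
    (fun w' _ ↦ by split_ifs <;> assumption)
  refine ⟨t, by simpa using ht w (by simp), ?_⟩
  have h1 := ht (comapPl (σ : M →+* M) w) (by simp)
  simp only [if_neg hne, sub_zero] at h1
  rwa [vl_comapPl_algEquiv, vl_comapPl_algEquiv, h.apply_apply] at h1

/-- At primes where `x` is a local square the base field is locally dense. -/
theorem exists_sub_lt (h : IsQuad x u σ) {w : Pl M}
    (hx : LS (vl (comapPl (algebraMap F M) w)) x) {y : M} (hy : y ≠ 0) :
    ∃ f : F, vl w (y - algebraMap F M f) < vl w y := by
  obtain ⟨t, h1, h2⟩ := h.exists_splitting hx hy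
  obtain ⟨f, hf⟩ := h.exists_of_fixed (y := t + σ t) (by rw [map_add, h.apply_apply, add_comm])
  refine ⟨f, ?_⟩
  rw [← hf, show y - (t + σ t) = -((t - y) + σ t) by ring, Valuation.map_neg]
  exact (vl w).map_add_lt h1 h2

/-- Without ramification the value group does not grow. -/
theorem exists_vl_eq_algebraMap (h : IsQuad x u σ) {w : Pl M}
    (hx : LS (vl (comapPl (algebraMap F M) w)) x ∨ (vl (comapPl (algebraMap F M) w) 2 = 1 ∧
      Even (od (comapPl (algebraMap F M) w) x))) {y : M} (hy : y ≠ 0) :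
    ∃ f : F, vl w y = vl w (algebraMap F M f) := by
  by_cases hLS : LS (vl (comapPl (algebraMap F M) w)) x
  · obtain ⟨f, hf⟩ := h.exists_sub_lt hLS hy
    exact ⟨f, (val_eq_of_sub_lt hf).symm⟩
  obtain ⟨h2, hev⟩ := hx.resolve_left hLS
  obtain ⟨g, hg0, hg⟩ := exists_eq_sq_of_even_od _ h.ne_zero hev
  have hu : vl w u = vl w (algebraMap F M g) := by
    have := (comapPl_eq (algebraMap F M) w).1 hg
    rw [map_pow, ← h.sq, map_pow, map_pow] at this
    exact (pow_left_inj₀ zero_le zero_le two_ne_zero).1 this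
  obtain ⟨p, r, rfl⟩ := h.span y
  have hru : vl w (algebraMap F M r * u) = vl w (algebraMap F M (r * g)) := by
    rw [map_mul, hu, ← map_mul, map_mul (algebraMap F M)]
  rcases lt_trichotomy (vl w (algebraMap F M p)) (vl w (algebraMap F M r * u)) with hlt | heq | hgt
  · exact ⟨r * g, by rw [(vl w).map_add_eq_of_lt_right hlt, hru]⟩
  · refine ⟨p, ?_⟩
    refine le_antisymm (((vl w).map_add _ _).trans (max_le le_rfl heq.ge)) (not_lt.1 fun hlt ↦ ?_)
    have hr0 : r ≠ 0 := by
      rintro rfl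
      rw [map_zero, zero_mul, map_zero] at heq
      rw [heq] at hlt
      exact not_lt_zero hlt
    have hp0 : 0 < vl w (algebraMap F M p) := zero_le.trans_lt hlt
    refine hLS ((LS.mul_sq_iff hr0).1 ⟨p, ?_⟩)
    have hv4 : vl (comapPl (algebraMap F M) w) 4 = 1 := by rw [val_four, h2, one_mul]
    rw [Valuation.map_mul _ 4, hv4, one_mul, comapPl_lt]
    have e1 : algebraMap F M (x * r ^ 2 - p ^ 2) = (algebraMap F M p + algebraMap F M r * u) *
        (algebraMap F M r * u - algebraMap F M p) := by
      rw [map_sub, map_mul, ← h.sq, map_pow, map_pow]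
      ring
    have e2 : vl w (algebraMap F M (x * r ^ 2)) =
        vl w (algebraMap F M p) * vl w (algebraMap F M p) := by
      rw [map_mul (algebraMap F M), ← h.sq, map_pow (algebraMap F M)]
      nth_rw 1 [heq, heq]
      rw [← map_mul]
      congr 1
      ring
    rw [e1, e2, (vl w).map_mul]
    refine (mul_le_mul_right ((vl w).map_sub _ _ |>.trans (max_le heq.ge le_rfl)) _).trans_lt ?_
    exact mul_lt_mul_of_pos_right hlt hp0
  · exact ⟨p, by rw [(vl w).map_add_eq_of_lt_left hgt]⟩

/-- Without ramification there is a local generator with unit different. -/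
theorem exists_sub_conj_eq_one (h : IsQuad x u σ) {w : Pl M}
    (hx : LS (vl (comapPl (algebraMap F M) w)) x ∨ (vl (comapPl (algebraMap F M) w) 2 = 1 ∧
      Even (od (comapPl (algebraMap F M) w) x))) :
    ∃ y : M, vl w y ≤ 1 ∧ vl w (σ y) ≤ 1 ∧ vl w (y - σ y) = 1 := by
  rcases hx with hLS | ⟨h2, hev⟩
  · obtain ⟨t, h1, h3⟩ := h.exists_splitting hLS one_ne_zero
    have ht : vl w t = 1 := by
      have := (vl w).map_eq_of_sub_lt h1
      rwa [map_one] at this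
    rw [map_one] at h3
    exact ⟨t, ht.le, h3.le, by rw [(vl w).map_sub_eq_of_lt_left (by rwa [ht]), ht]⟩
  · obtain ⟨g, hg0, hg⟩ := exists_eq_sq_of_even_od _ h.ne_zero hev
    have hu : vl w u = vl w (algebraMap F M g) := by
      have := (comapPl_eq (algebraMap F M) w).1 hg
      rw [map_pow, ← h.sq, map_pow, map_pow] at this
      exact (pow_left_inj₀ zero_le zero_le two_ne_zero).1 this
    have h1 : vl w (u / algebraMap F M g) = 1 := by
      rw [map_div₀, hu, div_self]
      exact vl_ne_zero w (by simpa using hg0)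
    have h3 : σ (u / algebraMap F M g) = -(u / algebraMap F M g) := by
      rw [map_div₀, h.conj, AlgEquiv.commutes, neg_div]
    refine ⟨u / algebraMap F M g, h1.le, ?_, ?_⟩
    · rw [h3, Valuation.map_neg, h1]
    · rw [h3, sub_neg_eq_add, ← two_mul, (vl w).map_mul, vl_two_of_comapPl _ h2, h1, one_mul]

/-- The ramified case. -/
theorem vl_add_ne (h : IsQuad x u σ) {w : Pl M} {q : ℕ} (hq : q.Prime) (hxq : x = q)
    (hw : vl w (q : M) ≠ 1)
    (hun : ∀ y : F, y ≠ 0 → ∃ z : ℚ,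
      vl (comapPl (algebraMap F M) w) y = vl (comapPl (algebraMap F M) w) (z : F))
    {p r : F} (hp : p ≠ 0) (hr : r ≠ 0) :
    vl w (algebraMap F M p) ≠ vl w (algebraMap F M r * u) := by
  intro heq
  have key : ∀ y : F, y ≠ 0 → ∃ k : ℤ, vl w (algebraMap F M y) = vl w (q : M) ^ k := fun y hy ↦ by
    obtain ⟨z, hz⟩ := hun y hy
    have hz0 : z ≠ 0 := ratCast_ne_zero_of_vl (n := 1) hy (by rw [pow_one, hz])
    rw [comapPl_eq, map_ratCast] at hz
    obtain ⟨k, hk⟩ := exists_vl_ratCast_eq w hq hw hz0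
    exact ⟨k, hz.trans hk⟩
  obtain ⟨a, ha⟩ := key p hp
  obtain ⟨b, hb⟩ := key r hr
  have hu : vl w u ^ 2 = vl w (q : M) := by
    rw [← map_pow, h.sq, hxq, map_natCast]
  have hu0 : 0 < vl w u := vl_pos w h.u_ne_zero
  have hu1 : vl w u ≠ 1 := fun h1 ↦ hw (by rw [← hu, h1, one_pow])
  rw [(vl w).map_mul, ha, hb, ← hu, ← zpow_natCast, ← zpow_mul, ← zpow_mul,
    ← zpow_add_one₀ hu0.ne'] at heq
  have := zpow_right_injective₀ hu0 hu1 heq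
  push_cast at this
  omega

end IsQuad

end

section

open IsDedekindDomain NumberField LocalSquare Module Places Polynomial

namespace IsQuad

variable {F M : Type*} [Field F] [Field M] [NumberField F] [NumberField M] [Algebra F M]
  {x : F} {u : M} {σ : M ≃ₐ[F] M}

omit [NumberField F] [NumberField M] in
theorem adjoin_eq_top (h : IsQuad x u σ) {y : M} (hy : σ y ≠ y) : Algebra.adjoin F {y} = ⊤ := by
  obtain ⟨p, r, rfl⟩ := h.span y
  have hr : r ≠ 0 := by
    rintro rfl
    simp at hy
  set y := algebraMap F M p + algebraMap F M r * u with hy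
  have hu : u ∈ Algebra.adjoin F {y} := by
    have : u = algebraMap F M r⁻¹ * (y - algebraMap F M p) := by
      have hr' : algebraMap F M r ≠ 0 := by simpa using hr
      rw [hy, map_inv₀]
      field_simp
      ring
    rw [this]
    exact mul_mem (algebraMap_mem _ _)
      (sub_mem (Algebra.subset_adjoin rfl) (algebraMap_mem _ _))
  rw [eq_top_iff]
  rintro z -
  obtain ⟨a, b, rfl⟩ := h.span z
  exact add_mem (algebraMap_mem _ _) (mul_mem (algebraMap_mem _ _) hu)

theorem sub_conj_mem_differentIdeal (h : IsQuad x u σ) {y : 𝓞 M} {t n : 𝓞 F}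
    (ht : (y : M) + σ y = algebraMap F M t) (hn : (y : M) * σ y = algebraMap F M n)
    (hy : σ y ≠ y) : ∃ d ∈ differentIdeal (𝓞 F) (𝓞 M), (d : M) = y - σ y := by
  have hmem := aeval_derivative_mem_differentIdeal (𝓞 F) F M y (h.adjoin_eq_top hy)
  have e1 : ∀ a : 𝓞 F, ((algebraMap (𝓞 F) (𝓞 M) a : 𝓞 M) : M) = algebraMap F M a := fun a ↦ rfl
  set P : (𝓞 F)[X] := X ^ 2 - C t * X + C n with hP
  have hPy : aeval y P = 0 := by
    apply RingOfIntegers.coe_injective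
    simp only [hP, map_add, map_sub, map_mul, map_pow, aeval_X, aeval_C, e1, ← ht, ← hn, map_zero]
    ring
  obtain ⟨k, hk⟩ := minpoly.isIntegrallyClosed_dvd (IsIntegral.of_finite (𝓞 F) y) hPy
  refine ⟨aeval y (derivative P), ?_, ?_⟩
  · rw [hk, derivative_mul, map_add, map_mul, map_mul, minpoly.aeval, zero_mul, add_zero]
    exact Ideal.mul_mem_right _ _ hmem
  · have hd : derivative P = X + X - C t := by
      simp only [hP, derivative_add, derivative_sub, derivative_mul, derivative_X_pow, derivative_C,
        derivative_X]
      simp [map_ofNat C 2]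
      ring
    rw [hd]
    simp only [map_add, map_sub, aeval_X, aeval_C, e1, ← ht]
    ring

theorem differentIdeal_eq_top (h : IsQuad x u σ)
    (hx : ∀ v : Pl F, LS (vl v) x ∨ (vl v 2 = 1 ∧ Even (od v x))) :
    differentIdeal (𝓞 F) (𝓞 M) = ⊤ := by
  by_contra hne
  obtain ⟨P, hP, hle⟩ := Ideal.exists_le_maximal _ hne
  have hP0 : P ≠ ⊥ := Ring.ne_bot_of_isMaximal_of_not_isField hP (RingOfIntegers.not_isField M)
  let w : Pl M := ⟨P, hP.isPrime, hP0⟩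
  obtain ⟨y, h1, h2, h3⟩ := h.exists_sub_conj_eq_one (w := w) (hx _)
  obtain ⟨T, hT⟩ := h.exists_of_fixed (y := y + σ y) (by rw [map_add, h.apply_apply, add_comm])
  obtain ⟨N, hN⟩ := h.exists_of_fixed (y := y * σ y) (by rw [map_mul, h.apply_apply, mul_comm])
  set v := comapPl (algebraMap F M) w with hv
  have hvT : vl v T ≤ 1 := by
    rw [comapPl_le_one_iff, ← hT]
    exact ((vl w).map_add _ _).trans (max_le h1 h2)
  have hvN : vl v N ≤ 1 := by
    rw [comapPl_le_one_iff, ← hN, map_mul]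
    exact mul_le_one' h1 h2
  obtain ⟨a, b, hab⟩ := v.exists_primeCompl_mul_eq_of_integer T hvT
  obtain ⟨c, d, hcd⟩ := v.exists_primeCompl_mul_eq_of_integer N hvN
  change T * ((b : 𝓞 F) : F) = (a : F) at hab
  change N * ((d : 𝓞 F) : F) = (c : F) at hcd
  set r : 𝓞 F := (b : 𝓞 F) * (d : 𝓞 F) with hr
  have hr1 : vl v (r : F) = 1 := valuation_eq_one_of_notMem v (mul_mem b.2 d.2)
  have hrM : vl w (algebraMap F M r) = 1 := (comapPl_eq_one _ w).1 hr1
  have hrT : (T * r : F) = (a * d : 𝓞 F) := by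
    change T * ((b : 𝓞 F) * (d : 𝓞 F) : F) = a * (d : 𝓞 F)
    linear_combination ((d : 𝓞 F) : F) * hab
  have hrN : (N * r ^ 2 : F) = (c * d * b ^ 2 : 𝓞 F) := by
    change N * ((b : 𝓞 F) * (d : 𝓞 F) : F) ^ 2 = c * (d : 𝓞 F) * (b : 𝓞 F) ^ 2
    linear_combination ((d : 𝓞 F) : F) * ((b : 𝓞 F) : F) ^ 2 * hcd
  have hσ : σ (y * algebraMap F M r) = σ y * algebraMap F M r := by rw [map_mul, AlgEquiv.commutes]
  have hi : IsIntegral (𝓞 F) (y * algebraMap F M r) := by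
    refine ⟨X ^ 2 - C (a * (d : 𝓞 F)) * X + C (c * (d : 𝓞 F) * (b : 𝓞 F) ^ 2), by monicity!, ?_⟩
    simp only [eval₂_add, eval₂_sub, eval₂_mul, eval₂_pow, eval₂_X, eval₂_C]
    have e1 : ∀ z : 𝓞 F, algebraMap (𝓞 F) M z = algebraMap F M z := fun z ↦ rfl
    rw [e1, e1, ← hrT, ← hrN, map_mul, map_mul, ← hT, ← hN, map_pow]
    ring
  have hiZ : IsIntegral ℤ (y * algebraMap F M r) := isIntegral_trans _ hi
  obtain ⟨δ, hδ, hδy⟩ := h.sub_conj_mem_differentIdeal (y := ⟨_, hiZ⟩) (t := a * d)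
    (n := c * d * b ^ 2) (by
      rw [← hrT, map_mul, ← hT]
      change y * algebraMap F M r + σ (y * algebraMap F M r) = _
      rw [hσ]
      ring) (by
      rw [← hrN, map_mul, ← hN, map_pow]
      change y * algebraMap F M r * σ (y * algebraMap F M r) = _
      rw [hσ]
      ring) (by
      intro h4
      change σ (y * algebraMap F M r) = y * algebraMap F M r at h4
      have hr0 : algebraMap F M r ≠ 0 := fun h0 ↦ by simp [h0] at hrM
      rw [hσ, mul_left_inj' hr0] at h4
      simp [h4] at h3)
  have h4 : vl w (δ : M) < 1 := (w.valuation_lt_one_iff_mem (K := M) δ).2 (hle hδ)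
  have h5 : (δ : M) = (y - σ y) * algebraMap F M r := by
    rw [hδy]
    change y * algebraMap F M r - σ (y * algebraMap F M r) = _
    rw [hσ]
    ring
  rw [h5, map_mul, h3, hrM, one_mul] at h4
  exact lt_irrefl _ h4

theorem natAbs_discr (h : IsQuad x u σ)
    (hx : ∀ v : Pl F, LS (vl v) x ∨ (vl v 2 = 1 ∧ Even (od v x))) :
    (discr M).natAbs = (discr F).natAbs ^ 2 := by
  rw [natAbs_discr_eq_absNorm_differentIdeal_mul_natAbs_discr_pow F (𝓞 F) M (𝓞 M),
    h.differentIdeal_eq_top hx, h.finrank_eq]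
  simp

end IsQuad

end

section

open IsDedekindDomain NumberField LocalSquare Module Places

namespace IsQuad

variable {F M : Type*} [Field F] [Field M] [NumberField F] [NumberField M] [Algebra F M]
  {x : F} {u : M} {σ : M ≃ₐ[F] M}

omit [NumberField F] [NumberField M] in
theorem exists_extension (h : IsQuad x u σ) (τ : F →+* F) {b : F} (hτ : τ x = x * b ^ 2) :
    ∃ τ' : M →+* M, ∀ y : F, τ' (algebraMap F M y) = algebraMap F M (τ y) := by
  choose P R hPR using h.span
  have huniq : ∀ {p r p' r' : F}, algebraMap F M p + algebraMap F M r * u =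
      algebraMap F M p' + algebraMap F M r' * u → p = p' ∧ r = r' := fun {p r p' r'} hh ↦ by
    have h1 := h.indep (p := p - p') (q := r - r') (by
      rw [map_sub, map_sub]
      linear_combination hh)
    exact ⟨sub_eq_zero.1 h1.1, sub_eq_zero.1 h1.2⟩
  have hval : ∀ p r : F, P (algebraMap F M p + algebraMap F M r * u) = p ∧
      R (algebraMap F M p + algebraMap F M r * u) = r := fun p r ↦
    huniq (hPR _).symm
  have halg : ∀ y : F, P (algebraMap F M y) = y ∧ R (algebraMap F M y) = 0 := fun y ↦ by
    simpa using hval y 0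
  have hadd : ∀ y z, P (y + z) = P y + P z ∧ R (y + z) = R y + R z := fun y z ↦
    huniq (by
      rw [← hPR, map_add, map_add]
      linear_combination hPR y + hPR z)
  have hmul : ∀ y z, P (y * z) = P y * P z + R y * R z * x ∧ R (y * z) = P y * R z + R y * P z :=
    fun y z ↦ huniq (by
      rw [← hPR]
      simp only [map_add, map_mul, ← h.sq]
      conv_lhs => rw [hPR y, hPR z]
      ring)
  refine ⟨{ toFun := fun y ↦ algebraMap F M (τ (P y)) + algebraMap F M (τ (R y) * b) * u
            map_one' := ?_
            map_zero' := ?_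
            map_add' := fun y z ↦ ?_
            map_mul' := fun y z ↦ ?_ }, fun y ↦ ?_⟩
  · have := halg 1
    rw [map_one] at this
    simp [this]
  · rw [(hmul y z).1, (hmul y z).2]
    have hτ' : algebraMap F M (τ x) = u ^ 2 * algebraMap F M b ^ 2 := by
      rw [hτ, map_mul, ← h.sq, map_pow]
    simp only [map_add, map_mul, hτ']
    ring
  · have := halg 0
    rw [map_zero] at this
    simp [this]
  · rw [(hadd y z).1, (hadd y z).2]
    simp only [map_add, map_mul]
    ring
  · simp [halg]

theorem isGalois_rat (h : IsQuad x u σ) [IsGalois ℚ F]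
    (hx : ∀ τ : F ≃ₐ[ℚ] F, ∃ b : F, τ x = x * b ^ 2) : IsGalois ℚ M := by
  refine IsGalois.of_fixedField_eq_bot ℚ M (eq_bot_iff.2 fun y hy ↦ ?_)
  have hfix : ∀ τ : M ≃ₐ[ℚ] M, τ y = y := fun τ ↦ hy ⟨τ, trivial⟩
  obtain ⟨p, rfl⟩ := h.exists_of_fixed (hfix (σ.restrictScalars ℚ))
  obtain ⟨z, rfl⟩ := exists_algebraMap_of_fixed (F := ℚ) (x := p) fun τ ↦ by
    obtain ⟨b, hb⟩ := hx τ
    obtain ⟨τ', hτ'⟩ := h.exists_extension (τ : F →+* F) hb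
    let τ₁ : M →ₐ[ℚ] M := τ'.toRatAlgHom
    have hbij : Function.Bijective τ₁ := Algebra.IsAlgebraic.algHom_bijective τ₁
    have h1 := hfix (AlgEquiv.ofBijective τ₁ hbij)
    have h2 : τ' (algebraMap F M p) = algebraMap F M p := h1
    rw [hτ'] at h2
    exact (algebraMap F M).injective h2
  exact ⟨z, by simp⟩

theorem real (h : IsQuad x u σ) (hreal : ∀ φ : F →+* ℂ, ∀ y, (φ y).im = 0)
    (hpos : ∀ φ : F →+* ℝ, 0 < φ x) : ∀ φ : M →+* ℂ, ∀ y, (φ y).im = 0 := by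
  intro φ y
  have hφ : ∀ z, (φ (algebraMap F M z)).im = 0 := hreal (φ.comp (algebraMap F M))
  let ψ : F →+* ℝ :=
    { toFun := fun z ↦ (φ (algebraMap F M z)).re
      map_one' := by simp
      map_zero' := by simp
      map_mul' := fun y z ↦ by simp [hφ]
      map_add' := fun y z ↦ by simp }
  have hψ : ∀ z, (ψ z : ℂ) = φ (algebraMap F M z) := fun z ↦ Complex.ext rfl (hφ z).symm
  have h1 : φ u ^ 2 = (ψ x : ℂ) := by
    rw [← map_pow, h.sq, hψ]
  have h2 := hpos ψ
  have hu : (φ u).im = 0 := by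
    have hre := congrArg Complex.re h1
    have him := congrArg Complex.im h1
    simp only [pow_two, Complex.mul_re, Complex.mul_im, Complex.ofReal_re, Complex.ofReal_im]
      at hre him
    have h3 : (φ u).re * (φ u).im = 0 := by linarith
    rcases mul_eq_zero.1 h3 with h4 | h4
    · rw [h4] at hre
      nlinarith [mul_self_nonneg (φ u).im]
    · exact h4
  obtain ⟨p, r, rfl⟩ := h.span y
  simp [hφ, hu]

/-- Quadratic extensions preserve the local conditions. -/
theorem locAdm (h : IsQuad x u σ) {S T T' : Set ℕ} (hS : OneModEight S) (hTT : T ⊆ T')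
    (hT : T' ⊆ S) (hL : LocAdm S T F)
    (hx : ∀ v : Pl F, LS (vl v) x ∨ (vl v 2 = 1 ∧ (∀ q ∈ S, vl v (q : F) = 1) ∧ Even (od v x)) ∨
      ∃ q ∈ T', q ∉ T ∧ vl v (q : F) ≠ 1 ∧ x = q) : LocAdm S T' M := by
  have hnat : ∀ (w : Pl M) (n : ℕ), vl (comapPl (algebraMap F M) w) (n : F) = 1 ↔
      vl w (n : M) = 1 := fun w n ↦ by rw [comapPl_eq_one, map_natCast]
  have hrat : ∀ (w : Pl M) {y : F} {z : ℚ} {n : ℕ}, vl (comapPl (algebraMap F M) w) y ^ n =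
      vl (comapPl (algebraMap F M) w) (z : F) → vl w (algebraMap F M y) ^ n = vl w (z : M) :=
    fun w y z n hh ↦ by
      rw [← map_pow, comapPl_eq, map_pow, map_ratCast] at hh
      rw [← hh, map_pow]
  have hunF : ∀ v : Pl F, ∀ q ∈ T', q ∉ T → vl v (q : F) ≠ 1 → ∀ y : F, y ≠ 0 →
      ∃ z : ℚ, vl v y = vl v (z : F) := fun v q hq hqT hv ↦ by
    refine hL.unram v fun q' hq' ↦ ?_
    refine vl_natCast_prime_eq_one v (hS q (hT hq)).1 (hS q' (hT (hTT hq'))).1 ?_ hv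
    rintro rfl
    exact hqT hq'
  have hsq : ∀ (v : Pl F) (y : F), y ≠ 0 → ∃ z : ℚ, vl v y ^ 2 = vl v (z : F) := fun v y hy ↦ by
    by_cases hv : ∀ q ∈ T, vl v (q : F) = 1
    · obtain ⟨z, hz⟩ := hL.unram v hv y hy
      exact ⟨z ^ 2, by rw [hz, ← map_pow, Rat.cast_pow]⟩
    · push Not at hv
      obtain ⟨q, hq, hv⟩ := hv
      exact hL.tame v q hq hv y hy
  refine ⟨fun w h2 y hy ↦ ?_, fun w hw y hy ↦ ?_, fun w q hq hw y hy ↦ ?_, fun w q hq hw y hy ↦ ?_⟩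
  · have h2' : vl (comapPl (algebraMap F M) w) 2 ≠ 1 := by
      have := (hnat w 2).not.2 (by exact_mod_cast h2)
      exact_mod_cast this
    rcases hx (comapPl (algebraMap F M) w) with hLS | ⟨h3, -⟩ | ⟨q, hq, -, h3, -⟩
    · by_cases hy0 : y = 0
      · left; simp [hy0]
      obtain ⟨f, hf⟩ := h.exists_sub_lt hLS hy0
      have hf1 : vl (comapPl (algebraMap F M) w) f ≤ 1 := by
        rw [comapPl_le_one_iff, val_eq_of_sub_lt hf]
        exact hy
      have e := val_eq_of_sub_lt hf
      rcases hL.two _ h2' f hf1 with h4 | h4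
      · left
        rwa [comapPl_lt_one, e] at h4
      · right
        rw [comapPl_lt_one, map_sub, map_one] at h4
        rw [show y - 1 = (y - algebraMap F M f) + (algebraMap F M f - 1) by ring]
        exact (vl w).map_add_lt (hf.trans_le hy) h4
    · exact absurd h3 h2'
    · exact absurd (hS.vl_two (hT hq) h3) h2'
  · have hx' : LS (vl (comapPl (algebraMap F M) w)) x ∨ (vl (comapPl (algebraMap F M) w) 2 = 1 ∧
        Even (od (comapPl (algebraMap F M) w) x)) := by
      rcases hx (comapPl (algebraMap F M) w) with hLS | ⟨h3, -, h4⟩ | ⟨q, hq, -, h3, -⟩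
      · exact Or.inl hLS
      · exact Or.inr ⟨h3, h4⟩
      · exact absurd ((hnat w q).2 (hw q hq)) h3
    obtain ⟨f, hf⟩ := h.exists_vl_eq_algebraMap hx' hy
    have hf0 : f ≠ 0 := by
      rintro rfl
      rw [map_zero, map_zero] at hf
      exact vl_ne_zero w hy hf
    obtain ⟨z, hz⟩ := hL.unram (comapPl (algebraMap F M) w)
      (fun q hq ↦ (hnat w q).2 (hw q (hTT hq))) f hf0
    refine ⟨z, ?_⟩
    have := hrat w (n := 1) ((pow_one _).trans hz)
    rwa [pow_one, ← hf] at this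
  · rcases hx (comapPl (algebraMap F M) w) with hLS | ⟨-, h3, -⟩ | ⟨q', hq', hqT, h3, hxq⟩
    · obtain ⟨f, hf⟩ := h.exists_vl_eq_algebraMap (Or.inl hLS) hy
      have hf0 : f ≠ 0 := by
        rintro rfl
        rw [map_zero, map_zero] at hf
        exact vl_ne_zero w hy hf
      obtain ⟨z, hz⟩ := hsq _ f hf0
      exact ⟨z, by rw [hf, hrat w hz]⟩
    · exact absurd ((hnat w q).1 (h3 q (hT hq))) hw
    · obtain ⟨p, r, rfl⟩ := h.span y
      by_cases hr : r = 0
      · subst hr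
        obtain ⟨z, hz⟩ := hsq (comapPl (algebraMap F M) w) p (by rintro rfl; simp at hy)
        exact ⟨z, by rw [map_zero, zero_mul, add_zero, hrat w hz]⟩
      obtain ⟨z', hz'⟩ := hsq (comapPl (algebraMap F M) w) r hr
      have hru : vl w (algebraMap F M r * u) ^ 2 = vl w ((z' * q' : ℚ) : M) := by
        rw [(vl w).map_mul, mul_pow, hrat w hz', ← map_pow, h.sq, hxq, map_natCast (algebraMap F M),
          ← (vl w).map_mul]
        push_cast
        rfl
      by_cases hp : p = 0
      · subst hp
        exact ⟨_, by rw [map_zero, zero_add, hru]⟩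
      have hne := h.vl_add_ne (hS q' (hT hq')).1 hxq (w := w) ((hnat w q').not.1 h3)
        (hunF _ q' hq' hqT h3) hp hr
      rcases hne.lt_or_gt with hlt | hgt
      · exact ⟨_, by rw [(vl w).map_add_eq_of_lt_right hlt, hru]⟩
      · obtain ⟨z, hz⟩ := hsq (comapPl (algebraMap F M) w) p hp
        exact ⟨z, by rw [(vl w).map_add_eq_of_lt_left hgt, hrat w hz]⟩
  · have hqv : vl (comapPl (algebraMap F M) w) (q : F) ≠ 1 := (hnat w q).not.2 hw
    rcases hx (comapPl (algebraMap F M) w) with hLS | ⟨-, h3, -⟩ | ⟨q', hq', hqT, h3, hxq⟩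
    · by_cases hy0 : y = 0
      · exact ⟨0, by simp [hy0]⟩
      obtain ⟨f, hf⟩ := h.exists_sub_lt hLS hy0
      have hf1 : vl (comapPl (algebraMap F M) w) f ≤ 1 := by
        rw [comapPl_le_one_iff, val_eq_of_sub_lt hf]
        exact hy
      obtain ⟨m, hm⟩ := hL.resid _ q hq hqv f hf1
      refine ⟨m, ?_⟩
      rw [comapPl_lt_one, map_sub, map_intCast] at hm
      rw [show y - m = (y - algebraMap F M f) + (algebraMap F M f - m) by ring]
      exact (vl w).map_add_lt (hf.trans_le hy) hm
    · exact absurd (h3 q hq) hqv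
    · obtain ⟨p, r, rfl⟩ := h.span y
      have hle : vl w (algebraMap F M p) ≤ 1 ∧ vl w (algebraMap F M r * u) < 1 := by
        by_cases hr : r = 0
        · subst hr
          simpa using hy
        have hru : vl w (algebraMap F M r * u) ≠ 1 := fun h1 ↦ by
          refine h.vl_add_ne (hS q' (hT hq')).1 hxq (w := w) ((hnat w q').not.1 h3)
            (hunF _ q' hq' hqT h3) one_ne_zero hr ?_
          rw [h1, map_one, map_one]
        by_cases hp : p = 0
        · subst hp
          rw [map_zero, zero_add] at hy
          exact ⟨by simp, lt_of_le_of_ne hy hru⟩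
        have hne := h.vl_add_ne (hS q' (hT hq')).1 hxq (w := w) ((hnat w q').not.1 h3)
          (hunF _ q' hq' hqT h3) hp hr
        rcases hne.lt_or_gt with hlt | hgt
        · rw [(vl w).map_add_eq_of_lt_right hlt] at hy
          exact ⟨hlt.le.trans hy, lt_of_le_of_ne hy hru⟩
        · rw [(vl w).map_add_eq_of_lt_left hgt] at hy
          exact ⟨hy, hgt.trans_le hy⟩
      obtain ⟨m, hm⟩ := hL.resid _ q hq hqv p ((comapPl_le_one_iff _ w).2 hle.1)
      refine ⟨m, ?_⟩
      rw [comapPl_lt_one, map_sub, map_intCast] at hm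
      rw [show algebraMap F M p + algebraMap F M r * u - m =
        (algebraMap F M p - m) + algebraMap F M r * u by ring]
      exact (vl w).map_add_lt hm hle.2

end IsQuad

end

section

open IsDedekindDomain NumberField LocalSquare Module Places

namespace Places

theorem exists_intCast_sub_lt (w : Pl ℚ) {p : ℕ} (hp : p.Prime) (hw : vl w (p : ℚ) ≠ 1) {x : ℚ}
    (hx : vl w x ≤ 1) : ∃ m : ℤ, vl w (x - m) < 1 := by
  have hlt := vl_natCast_lt w hw
  have hden0 : (x.den : ℚ) ≠ 0 := by exact_mod_cast x.den_nz
  have hd : ¬(p : ℤ) ∣ x.den := fun hd ↦ by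
    have hn : ¬(p : ℤ) ∣ x.num := fun hn ↦
      hp.one_lt.ne' (Nat.dvd_one.1 (x.reduced ▸ Nat.dvd_gcd
        (Int.natCast_dvd.1 hn) (Int.natCast_dvd_natCast.1 hd)))
    have h1 := vl_intCast_eq_one w hp hw hn
    obtain ⟨c, hc⟩ := Int.natCast_dvd_natCast.1 hd
    have h2 : vl w (x.den : ℚ) < 1 := by
      rw [hc, Nat.cast_mul, map_mul]
      exact mul_lt_one_of_lt_of_le hlt (val_natCast_le_one _ _)
    have h3 : (x.num : ℚ) = x * x.den := (Rat.mul_den_eq_num x).symm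
    rw [h3, map_mul, mul_comm] at h1
    exact (mul_lt_one_of_lt_of_le h2 hx).ne h1
  have hd1 : vl w (x.den : ℚ) = 1 := by
    have := vl_intCast_eq_one w hp hw hd
    exact_mod_cast this
  obtain ⟨a, b, hab⟩ := (Nat.prime_iff_prime_int.1 hp).coprime_iff_not_dvd.2 hd
  have hab' : (a : ℚ) * p + b * x.den = 1 := by exact_mod_cast hab
  refine ⟨x.num * b, ?_⟩
  have h1 : x - (x.num * b : ℤ) = x * (a * p) := by
    have h3 : (x.num : ℚ) = x * x.den := (Rat.mul_den_eq_num x).symm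
    push_cast
    rw [h3]
    linear_combination -x * hab'
  rw [h1, map_mul, map_mul, mul_comm, mul_comm (vl w (a : ℚ))]
  exact mul_lt_one_of_lt_of_le (mul_lt_one_of_lt_of_le hlt (val_intCast_le_one _ _)) hx

theorem locAdm_rat {S : Set ℕ} (hS : OneModEight S) : LocAdm S ∅ ℚ := by
  refine ⟨fun w hw x hx ↦ ?_, fun w _ x _ ↦ ⟨x, by simp⟩, fun w q hq ↦ hq.elim,
    fun w q hq hw x hx ↦ exists_intCast_sub_lt w (hS q hq).1 hw hx⟩
  obtain ⟨m, hm⟩ := exists_intCast_sub_lt w Nat.prime_two (by exact_mod_cast hw) hx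
  have h2 := vl_two_lt w hw
  rcases Int.even_or_odd' m with ⟨k, rfl | rfl⟩
  · left
    have h1 : vl w (2 * (k : ℚ)) < 1 := by
      rw [(vl w).map_mul]
      exact mul_lt_one_of_lt_of_le h2 (val_intCast_le_one _ _)
    have := (vl w).map_add_lt hm h1
    rwa [show x - ((2 * k : ℤ) : ℚ) + 2 * k = x by push_cast; ring] at this
  · right
    have h1 : vl w (2 * (k : ℚ)) < 1 := by
      rw [(vl w).map_mul]
      exact mul_lt_one_of_lt_of_le h2 (val_intCast_le_one _ _)
    have := (vl w).map_add_lt hm h1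
    rwa [show x - ((2 * k + 1 : ℤ) : ℚ) + 2 * k = x - 1 by push_cast; ring] at this

/-- There are arbitrarily many primes congruent to one modulo eight that are squares modulo
each other. -/
theorem exists_primes (n : ℕ) : ∃ S : Finset ℕ, S.card = n ∧ OneModEight (S : Set ℕ) ∧
    ∀ q ∈ S, ∀ q' ∈ S, q ≠ q' → IsSquare (q : ZMod q') := by
  induction n with
  | zero => exact ⟨∅, by simp, by simp [OneModEight], by simp⟩
  | succ n ih =>
    obtain ⟨S, hcard, hS, hsq⟩ := ih
    have hk : 8 * ∏ q ∈ S, q ≠ 0 :=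
      mul_ne_zero (by norm_num) (Finset.prod_ne_zero_iff.2 fun q hq ↦ (hS q hq).1.ne_zero)
    obtain ⟨p, hp, hlt, hmod⟩ := Nat.exists_prime_gt_modEq_one (S.sup id) hk
    have hpS : ∀ q ∈ S, q < p := fun q hq ↦ (Finset.le_sup (f := id) hq).trans_lt hlt
    have hp8 : p % 8 = 1 := (hmod.of_mul_right _ :)
    have h1 : ∀ q ∈ S, IsSquare (p : ZMod q) := fun q hq ↦ by
      have h2 : p ≡ 1 [MOD q] := (hmod.of_mul_left 8).of_dvd (Finset.dvd_prod_of_mem _ hq)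
      rw [(ZMod.natCast_eq_natCast_iff p 1 q).2 h2, Nat.cast_one]
      exact IsSquare.one
    have h2 : ∀ q ∈ S, IsSquare (q : ZMod p) := fun q hq ↦ by
      have := Fact.mk hp
      have := Fact.mk (hS q hq).1
      refine (ZMod.exists_sq_eq_prime_iff_of_mod_four_eq_one (p := p) (q := q) (by omega) ?_).2
        (h1 q hq)
      rintro rfl
      have := (hS 2 hq).2
      omega
    refine ⟨insert p S, ?_, ?_, ?_⟩
    · rw [Finset.card_insert_of_notMem fun h ↦ (hpS p h).ne rfl, hcard]
    · intro q hq
      rcases Finset.mem_insert.1 hq with rfl | hq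
      · exact ⟨hp, hp8⟩
      · exact hS q hq
    · intro q hq q' hq' hne
      rcases Finset.mem_insert.1 hq with h | h <;> rcases Finset.mem_insert.1 hq' with k | k
      · exact absurd (h.trans k.symm) hne
      · exact h ▸ h1 q' k
      · exact k ▸ h2 q h
      · exact hsq _ h _ k hne

/-- The fields from which the tower is built. -/
structure Adm (S T : Set ℕ) (K : Type) [Field K] [NumberField K] : Prop where
  gal : IsGalois ℚ K
  deg : ∃ n, finrank ℚ K = 2 ^ n
  real : ∀ φ : K →+* ℂ, ∀ x, (φ x).im = 0
  root : ∀ q ∈ T, IsSquare (q : K)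
  loc : LocAdm S T K

theorem Adm.exists_quadratic {S T T' : Set ℕ} (hS : OneModEight S) (hTT : T ⊆ T') (hT : T' ⊆ S)
    {K : Type} [Field K] [NumberField K] (hK : Adm S T K) {x : K} (hx : ¬IsSquare x)
    (hgal : ∀ τ : K ≃ₐ[ℚ] K, ∃ b : K, τ x = x * b ^ 2) (hpos : ∀ φ : K →+* ℝ, 0 < φ x)
    (hroot : ∀ q ∈ T', q ∉ T → x = q)
    (hloc : ∀ v : Pl K, LS (vl v) x ∨
      (vl v 2 = 1 ∧ (∀ q ∈ S, vl v (q : K) = 1) ∧ Even (od v x)) ∨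
        ∃ q ∈ T', q ∉ T ∧ vl v (q : K) ≠ 1 ∧ x = q) :
    ∃ (M : Type) (_ : Field M) (_ : NumberField M), Adm S T' M ∧
      finrank ℚ M = 2 * finrank ℚ K ∧ ((∀ q ∈ T', q ∈ T) →
        (discr M).natAbs = (discr K).natAbs ^ 2) := by
  obtain ⟨M, _, _, _, u, σ, h⟩ := IsQuad.exists_isQuad hx
  have := hK.gal
  have hfin : finrank ℚ M = 2 * finrank ℚ K := by
    rw [← finrank_mul_finrank ℚ K M, h.finrank_eq, mul_comm]
  refine ⟨M, _, _, ⟨h.isGalois_rat hgal, ?_, h.real hK.real hpos, fun q hq ↦ ?_,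
    h.locAdm hS hTT hT hK.loc hloc⟩, hfin, fun hTT' ↦ h.natAbs_discr fun v ↦ ?_⟩
  · obtain ⟨n, hn⟩ := hK.deg
    exact ⟨n + 1, by rw [hfin, hn, pow_succ']⟩
  · by_cases hqT : q ∈ T
    · obtain ⟨s, hs⟩ := hK.root q hqT
      exact ⟨algebraMap K M s, by rw [← map_mul, ← hs, map_natCast]⟩
    · exact ⟨u, by rw [← pow_two, h.sq, hroot q hq hqT, map_natCast]⟩
  · rcases hloc v with h1 | ⟨h1, -, h2⟩ | ⟨q, hq, hqT, -⟩
    · exact Or.inl h1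
    · exact Or.inr ⟨h1, h2⟩
    · exact absurd (hTT' q hq) hqT

theorem LS_of_isSquare_mod {K : Type*} [Field K] [NumberField K] (v : Pl K) {p q : ℕ}
    (hp : p.Prime) (hq : q.Prime) (hpq : p ≠ q) (hv : vl v (p : K) ≠ 1) (h2 : vl v 2 = 1)
    (h : IsSquare (q : ZMod p)) : LS (vl v) (q : K) := by
  obtain ⟨s, hs⟩ := h
  obtain ⟨m, rfl⟩ := ZMod.intCast_surjective s
  have h1 : (p : ℤ) ∣ q - m * m := by
    rw [← ZMod.intCast_zmod_eq_zero_iff_dvd _ p]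
    push_cast
    rw [hs, sub_self]
  obtain ⟨c, hc⟩ := h1
  have hc' : (q : K) - m ^ 2 = p * c := by
    have : ((q - m * m : ℤ) : K) = ((p * c : ℤ) : K) := by rw [hc]
    push_cast at this
    rw [← this]
    ring
  refine ⟨m, ?_⟩
  rw [hc', Valuation.map_mul _ 4, val_four, h2, vl_natCast_prime_eq_one v hp hq hpq hv,
    Valuation.map_mul]
  simpa using mul_lt_one_of_lt_of_le (vl_natCast_lt v hv) (val_intCast_le_one (vl v) c)

theorem exists_adm {S : Finset ℕ} (hS : OneModEight (S : Set ℕ))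
    (hsq : ∀ q ∈ S, ∀ q' ∈ S, q ≠ q' → IsSquare (q : ZMod q')) :
    ∃ (K : Type) (_ : Field K) (_ : NumberField K), Adm S S K := by
  suffices H : ∀ T : Finset ℕ, T ⊆ S →
      ∃ (K : Type) (_ : Field K) (_ : NumberField K), Adm S T K from H S subset_rfl
  intro T
  induction T using Finset.induction_on with
  | empty =>
    refine fun _ ↦ ⟨ℚ, _, inferInstance, IsGalois.self ℚ, ⟨0, by simp⟩, fun φ x ↦ ?_, by simp, ?_⟩
    · rw [eq_ratCast φ x]
      exact_mod_cast Complex.ofReal_im x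
    · rw [Finset.coe_empty]
      exact locAdm_rat hS
  | insert q T hqT ih =>
    intro hT
    obtain ⟨K, _, _, hK⟩ := ih ((Finset.subset_insert q T).trans hT)
    have hqS : q ∈ S := hT (Finset.mem_insert_self q T)
    have hTS : T ⊆ S := (Finset.subset_insert q T).trans hT
    have hq := (hS q hqS).1
    have hnsq : ¬IsSquare (q : K) := by
      rintro ⟨s, hs⟩
      obtain ⟨w, hw⟩ := exists_place_over K hq
      have hun := hK.loc.unram w fun q' hq' ↦ by
        refine vl_natCast_prime_eq_one w hq (hS q' (hTS hq')).1 ?_ hw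
        rintro rfl
        exact hqT hq'
      have h1 := odd_od_of_unram hun hq hw
      have h2 : Even (od w (q : K)) := even_od_of_eq_sq w (z := s) (by rw [hs, pow_two])
      exact (Int.not_even_iff_odd.2 h1) h2
    obtain ⟨M, i1, i2, hM, -⟩ := hK.exists_quadratic (T' := (insert q T : Finset ℕ)) hS
      (by simp) (by exact_mod_cast hT) hnsq (fun τ ↦ ⟨1, by simp⟩)
      (fun φ ↦ by rw [map_natCast]; exact_mod_cast hq.pos)
      (fun q' hq' hq'T ↦ by
        rcases Finset.mem_insert.1 hq' with rfl | h
        · rfl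
        · exact absurd h hq'T) fun v ↦ by
      by_cases h2 : vl v 2 = 1
      · by_cases hv : ∀ q' ∈ S, vl v (q' : K) = 1
        · exact Or.inr (Or.inl ⟨h2, hv, by
            rw [(od_eq_zero v (Nat.cast_ne_zero.2 hq.ne_zero)).2 (hv q hqS)]
            simp⟩)
        · push Not at hv
          obtain ⟨p, hp, hv⟩ := hv
          by_cases hpq : p = q
          · subst hpq
            exact Or.inr (Or.inr ⟨p, by simp, by simpa using hqT, hv, rfl⟩)
          · exact Or.inl (LS_of_isSquare_mod v (hS p hp).1 hq hpq hv h2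
              (hsq q hqS p hp (Ne.symm hpq)))
      · left
        have := LS_intCast_of_even v h2 (m := q) (by have := (hS q hqS).2; omega)
        exact_mod_cast this
    exact ⟨M, i1, i2, hM⟩

/-- Totally real fields of bounded root discriminant and unbounded degree. -/
theorem exists_unbounded : ∃ C : ℕ, 0 < C ∧ ∀ n : ℕ, ∃ (K : Type) (_ : Field K)
    (_ : NumberField K), n ≤ finrank ℚ K ∧ (∀ φ : K →+* ℂ, ∀ x, (φ x).im = 0) ∧
      (discr K).natAbs ≤ C ^ finrank ℚ K := by
  obtain ⟨S, hcard, hS, hsq⟩ := exists_primes 10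
  obtain ⟨K₀, _, _, hK₀⟩ := exists_adm hS hsq
  have hC0 : 0 < (discr K₀).natAbs := Int.natAbs_pos.2 (discr_ne_zero K₀)
  refine ⟨(discr K₀).natAbs, hC0, ?_⟩
  set C := (discr K₀).natAbs
  suffices H : ∀ n : ℕ, ∃ (K : Type) (_ : Field K) (_ : NumberField K), Adm S S K ∧
      n ≤ finrank ℚ K ∧ (discr K).natAbs ≤ C ^ finrank ℚ K by
    intro n
    obtain ⟨K, i1, i2, h1, h2, h3⟩ := H n
    exact ⟨K, i1, i2, h2, h1.real, h3⟩
  intro n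
  induction n with
  | zero =>
    exact ⟨K₀, _, _, hK₀, Nat.zero_le _, Nat.le_self_pow finrank_pos.ne' C⟩
  | succ n ih =>
    obtain ⟨K, i1, i2, hK, hn, hdisc⟩ := ih
    have := hK.gal
    by_contra hno
    refine false_of_isTop hS hcard (fun q hq ↦ hK.root q hq) hK.real hK.loc ?_ ?_
    · obtain ⟨m, hm⟩ := hK.deg
      exact IsPGroup.of_card (n := m) (by rw [IsGalois.card_aut_eq_finrank, hm])
    · intro η hη hgal hpos hev h2 hq
      by_contra hns
      obtain ⟨M, i3, i4, hM, hfin, hd⟩ := hK.exists_quadratic hS subset_rfl subset_rfl hns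
        (fun τ ↦ (hgal τ).imp fun b hb ↦ hb.2) hpos (fun q hq hq' ↦ absurd hq hq') fun v ↦ by
          by_cases hv2 : vl v 2 = 1
          · by_cases hv : ∀ q ∈ (S : Set ℕ), vl v (q : K) = 1
            · exact Or.inr (Or.inl ⟨hv2, hv, hev v hv2 hv⟩)
            · push Not at hv
              obtain ⟨q, hqS, hv⟩ := hv
              exact Or.inl (hq v q hqS hv)
          · exact Or.inl (h2 v hv2)
      have hpos : 0 < finrank ℚ K := finrank_pos
      refine hno ⟨M, i3, i4, hM, by omega, ?_⟩
      rw [hd fun _ h ↦ h, hfin, mul_comm, pow_mul]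
      exact Nat.pow_le_pow_left hdisc 2

end Places

end

/-- (Martinet) There exists an absolute constant `C > 0` such that for infinitely many
`d` there exists a totally real number field of degree `d` with discriminant `≤ C^d`. -/
theorem statement11 :
    ∃ C : ℝ, 0 < C ∧
      ∀ n : ℕ, ∃ d : ℕ, n ≤ d ∧ 0 < d ∧
        ∃ (K : Type) (_ : Field K) (_ : NumberField K),
          TotallyReal K ∧ Module.finrank ℚ K = d ∧
          ((NumberField.discr K).natAbs : ℝ) ≤ C ^ d := by
  obtain ⟨C, hC, h⟩ := Places.exists_unbounded
  refine ⟨C, by exact_mod_cast hC, fun n ↦ ?_⟩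
  obtain ⟨K, i1, i2, h1, h2, h3⟩ := h n
  exact ⟨Module.finrank ℚ K, h1, Module.finrank_pos, K, i1, i2, h2, rfl, by exact_mod_cast h3⟩
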